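/- arXiv:2603.18952 — 3 statements merged into one kernel-verified Lean document; each statement's English description precedes it below -/
import Mathlib

section
/- For every integer k ≥ 4 and every real ε > 0 there exists N such that for every integer n ≥ N, |f(n, ⌊n²/4⌋ + 1, C_{2k+1}) − n²/8| ≤ ε·n². That is, f(n, ⌊n²/4⌋ + 1, C_{2k+1}) = n²/8 + o(n²), confirming the conjecture of Burr, Erdős, Graham, and Sós for all k ≥ 4. -/
open SimpleGraph

/-- The maximal anti-Ramsey number `f(n, e, C_L)`: the minimum integer `c` for which there
exists an `n`-vertex simple graph with at least `e` edges admitting an edge-coloring using at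
most `c` colors in which every copy of the cycle `C_L` (i.e. every cycle of length `L`) is
rainbow. -/
noncomputable def maxAntiRamseyCycle (n e L : ℕ) : ℕ :=
  sInf {c : ℕ | ∃ G : SimpleGraph (Fin n), e ≤ G.edgeSet.ncard ∧
    ∃ χ : Sym2 (Fin n) → ℕ, (χ '' G.edgeSet).ncard ≤ c ∧
      ∀ ⦃v : Fin n⦄ (w : G.Walk v v), w.IsCycle → w.length = L → (w.edges.map χ).Nodup}

/-- Every cycle of length `L` in `G` is rainbow under `χ`. -/
def RainbowCycles {V : Type*} (G : SimpleGraph V) (χ : Sym2 V → ℕ) (L : ℕ) : Prop :=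
  ∀ ⦃v : V⦄ (w : G.Walk v v), w.IsCycle → w.length = L → (w.edges.map χ).Nodup

/-- There is a path of length `l` from `a` to `b` in `G` whose vertices avoid `X`. -/
def LinkedAvoiding {V : Type*} (G : SimpleGraph V) (X : Finset V) (l : ℕ) (a b : V) : Prop :=
  ∃ p : G.Walk a b, p.IsPath ∧ p.length = l ∧ ∀ x ∈ p.support, x ∉ X

/-- The number of common neighbours of `a` and `b`. -/
def codeg {V : Type*} [Fintype V] [DecidableEq V] (G : SimpleGraph V) [DecidableRel G.Adj]
    (a b : V) : ℕ :=
  (G.neighborFinset a ∩ G.neighborFinset b).card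

section Cycles

variable {V : Type*} {G : SimpleGraph V} {χ : Sym2 V → ℕ} {L : ℕ}

theorem LinkedAvoiding.nil {X : Finset V} {a : V} (ha : a ∉ X) : LinkedAvoiding G X 0 a a :=
  ⟨Walk.nil, by simp, rfl, by simpa using ha⟩

theorem LinkedAvoiding.cons [DecidableEq V] {X : Finset V} {l : ℕ} {a b c : V} (hab : G.Adj a b)
    (ha : a ∉ X) (h : LinkedAvoiding G (insert a X) l b c) : LinkedAvoiding G X (l + 1) a c := by
  obtain ⟨p, hp, hl, hX⟩ := h
  refine ⟨Walk.cons hab p, ?_, by simp [hl], ?_⟩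
  · rw [Walk.cons_isPath_iff]
    exact ⟨hp, fun h => hX a h (by simp)⟩
  · intro x hx
    rw [Walk.support_cons, List.mem_cons] at hx
    rcases hx with rfl | hx
    · exact ha
    · exact fun h => hX x hx (by simp [h])

theorem RainbowCycles.ne_of_share [DecidableEq V] (hχ : RainbowCycles G χ L) {u v y : V}
    (huv : G.Adj u v) (huy : G.Adj u y) {l : ℕ} (h : LinkedAvoiding G {u} l y v) (hl : l + 2 = L)
    (hvy : v ≠ y) :
    χ s(u, v) ≠ χ s(u, y) := by
  obtain ⟨q, hq, hql, hX⟩ := h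
  have hu : u ∉ q.support := fun h => hX u h (by simp)
  have hcyc : (Walk.cons huv.symm (Walk.cons huy q)).IsCycle := by
    rw [Walk.cons_isCycle_iff, Walk.cons_isPath_iff]
    refine ⟨⟨hq, hu⟩, ?_⟩
    rw [Walk.edges_cons, List.mem_cons]
    rintro (h | h)
    · rw [Sym2.eq_iff] at h
      rcases h with ⟨rfl, _⟩ | ⟨h, _⟩
      · exact huv.ne rfl
      · exact hvy h
    · exact hu (q.snd_mem_support_of_mem_edges h)
  have := hχ _ hcyc (by simp; omega)
  simp only [Walk.edges_cons, List.map_cons, List.nodup_cons, List.mem_cons, not_or] at this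
  rw [Sym2.eq_swap]
  exact this.1.1

theorem RainbowCycles.ne_of_disjoint [DecidableEq V] (hχ : RainbowCycles G χ L) {u v z x y : V}
    (huv : G.Adj u v) (hvz : G.Adj v z) (hzx : G.Adj z x) (hxy : G.Adj x y) (hvx : v ≠ x)
    {l : ℕ} (h : LinkedAvoiding G {v, z, x} l y u) (hl : l + 4 = L) :
    χ s(u, v) ≠ χ s(x, y) := by
  obtain ⟨q, hq, hql, hX⟩ := h
  have hv : v ∉ q.support := fun h => hX v h (by simp)
  have hz : z ∉ q.support := fun h => hX z h (by simp)
  have hx : x ∉ q.support := fun h => hX x h (by simp)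
  have huz : u ≠ z := by rintro rfl; exact hz q.end_mem_support
  have hvy : v ≠ y := by rintro rfl; exact hv q.start_mem_support
  have hcyc : (Walk.cons huv (Walk.cons hvz (Walk.cons hzx (Walk.cons hxy q)))).IsCycle := by
    rw [Walk.cons_isCycle_iff, Walk.cons_isPath_iff, Walk.cons_isPath_iff, Walk.cons_isPath_iff]
    refine ⟨⟨⟨⟨hq, hx⟩, ?_⟩, ?_⟩, ?_⟩
    · simp [hz, hzx.ne]
    · simp [hv, hvz.ne, hvx]
    · simp only [Walk.edges_cons, List.mem_cons, not_or, Sym2.eq_iff]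
      refine ⟨?_, ?_, ?_, fun h => hv (q.snd_mem_support_of_mem_edges h)⟩
      · exact ⟨fun h => huv.ne h.1, fun h => huz h.1⟩
      · exact ⟨fun h => hvx h.2, fun h => hvz.ne h.2⟩
      · exact ⟨fun h => hvy h.2, fun h => hvx h.2⟩
  have := hχ _ hcyc (by simp; omega)
  simp only [Walk.edges_cons, List.map_cons, List.nodup_cons, List.mem_cons, not_or] at this
  exact this.1.2.2.1

end Cycles

section Codegree

variable {V : Type*} [Fintype V] [DecidableEq V] {G : SimpleGraph V} [DecidableRel G.Adj]

theorem codeg_comm (a b : V) : codeg G a b = codeg G b a := by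
  simp only [codeg, Finset.inter_comm]

/-- Among any three neighbourhoods there is overlap if degrees are large. -/
theorem codeg_triple {D : ℕ} (hdeg : ∀ v, Fintype.card V + D ≤ 3 * G.degree v) (a b c : V) :
    D ≤ codeg G a b + codeg G a c + codeg G b c := by
  have h1 := Finset.card_union_add_card_inter (G.neighborFinset a) (G.neighborFinset b)
  have h2 := Finset.card_union_add_card_inter (G.neighborFinset a ∪ G.neighborFinset b)
    (G.neighborFinset c)
  have h3 := Finset.card_le_univ (G.neighborFinset a ∪ G.neighborFinset b ∪ G.neighborFinset c)
  have h4 : ((G.neighborFinset a ∪ G.neighborFinset b) ∩ G.neighborFinset c).card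
      ≤ codeg G a c + codeg G b c := by
    rw [Finset.union_inter_distrib_right]
    exact Finset.card_union_le _ _
  simp only [card_neighborFinset_eq_degree] at h1 h2
  have ha := hdeg a
  have hb := hdeg b
  have hc := hdeg c
  unfold codeg at *
  omega

theorem exists_common_neighbor {a b : V} {X : Finset V} (h : X.card < codeg G a b) :
    ∃ w, G.Adj a w ∧ G.Adj w b ∧ w ∉ X := by
  obtain ⟨w, hw, hX⟩ := Finset.exists_mem_notMem_of_card_lt_card h
  simp only [Finset.mem_inter, mem_neighborFinset] at hw
  exact ⟨w, hw.1, hw.2.symm, hX⟩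

/-- Vertices with many common neighbours are joined by paths of every positive even length. -/
theorem linkedAvoiding_even {r : ℕ} (hdeg : ∀ v, Fintype.card V + 3 * r ≤ 3 * G.degree v)
    (j : ℕ) : ∀ (X : Finset V) (a b : V), a ≠ b → a ∉ X → b ∉ X → r ≤ codeg G a b →
      X.card + 2 * j + 3 ≤ r → LinkedAvoiding G X (2 * (j + 1)) a b := by
  induction j with
  | zero =>
    intro X a b hab ha hb hr hX
    obtain ⟨w, haw, hwb, hw⟩ := exists_common_neighbor (X := X) (show X.card < codeg G a b by omega)
    refine .cons haw ha (.cons hwb ?_ (.nil ?_))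
    · simp [hw, haw.ne']
    · simp [hb, hwb.ne', hab.symm]
  | succ j ih =>
    intro X a b hab ha hb hr hX
    obtain ⟨p, hap, hpb, hp⟩ := exists_common_neighbor (X := X)
      (show X.card < codeg G a b by omega)
    have c1 := Finset.card_insert_le p X
    obtain ⟨q, haq, hqb, hq⟩ := exists_common_neighbor (X := insert p X)
      (show _ < codeg G a b by omega)
    have c2 := Finset.card_insert_le q (insert p X)
    obtain ⟨t, hat, htb, ht⟩ := exists_common_neighbor (X := insert q (insert p X))
      (show _ < codeg G a b by omega)
    simp only [Finset.mem_insert, not_or] at hq ht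
    have key : ∀ p q : V, G.Adj a p → G.Adj p b → p ∉ X → G.Adj a q → G.Adj q b → q ∉ X → p ≠ q →
        r ≤ codeg G p q → LinkedAvoiding G X (2 * (j + 1 + 1)) a b := by
      intro p q hap hpb hp haq hqb hq hpq hr'
      have c3 := Finset.card_insert_le b (insert a X)
      have c4 := Finset.card_insert_le a X
      obtain ⟨w, hw, hwl, hwX⟩ := ih (insert b (insert a X)) p q hpq
        (by simp [hp, hap.ne', hpb.ne]) (by simp [hq, haq.ne', hqb.ne]) hr' (by omega)
      have hbw : b ∉ w.support := fun h => hwX b h (by simp)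
      have haw : a ∉ w.support := fun h => hwX a h (by simp)
      refine ⟨Walk.cons hap (w.concat hqb), ?_, ?_, ?_⟩
      · rw [Walk.cons_isPath_iff, Walk.concat_isPath_iff]
        refine ⟨⟨hw, hbw⟩, ?_⟩
        simp [Walk.support_concat, haw, hab]
      · simp [Walk.length_concat, hwl]; ring
      · intro x hx
        simp only [Walk.support_cons, Walk.support_concat, List.mem_cons, List.mem_append,
          List.not_mem_nil, or_false] at hx
        rcases hx with rfl | hx | rfl
        · exact ha
        · exact fun h => hwX x hx (by simp [h])
        · exact hb
    have := codeg_triple hdeg p q t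
    by_cases h1 : r ≤ codeg G p q
    · exact key p q hap hpb hp haq hqb hq.2 (Ne.symm hq.1) h1
    by_cases h2 : r ≤ codeg G p t
    · exact key p t hap hpb hp hat htb ht.2.2 (Ne.symm ht.2.1) h2
    exact key q t haq hqb hq.2 hat htb ht.2.2 (Ne.symm ht.1) (by omega)

end Codegree

section Structure

variable {V : Type*} [Fintype V]

/-- The degrees of `G` exceed a third of the number of vertices by a margin controlled by the
scales `r ≪ h`. -/
structure LargeDegrees (G : SimpleGraph V) [DecidableRel G.Adj] (k r h : ℕ) : Prop where
  degree : ∀ v, Fintype.card V + 5 * h ≤ 3 * G.degree v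
  mul_lt : 2 * (Fintype.card V * r) + 4 * h < h * h
  four_mul_le : 4 * r ≤ h
  large : 2 * k + 20 ≤ r

theorem LargeDegrees.two_mul_degree_ge {G : SimpleGraph V} [DecidableRel G.Adj] {k r h : ℕ}
    (H : LargeDegrees G k r h) (v : V) : 5 * h ≤ 2 * G.degree v := by
  have := H.degree v
  have := (G.degree_lt_card_verts v).le
  omega

theorem LargeDegrees.eighty_le {G : SimpleGraph V} [DecidableRel G.Adj] {k r h : ℕ}
    (H : LargeDegrees G k r h) : 80 ≤ h := by
  have := H.four_mul_le
  have := H.large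
  omega

theorem LargeDegrees.exists_adj {G : SimpleGraph V} [DecidableRel G.Adj] {k r h : ℕ}
    (H : LargeDegrees G k r h) (v : V) {X : Finset V} (hX : X.card ≤ 8) :
    ∃ w, G.Adj v w ∧ w ∉ X := by
  have h1 := H.two_mul_degree_ge v
  have h2 := H.eighty_le
  obtain ⟨w, hw, hwX⟩ := Finset.exists_mem_notMem_of_card_lt_card
    (s := X) (t := G.neighborFinset v) (by rw [card_neighborFinset_eq_degree]; omega)
  exact ⟨w, by simpa using hw, hwX⟩

variable [DecidableEq V] (G : SimpleGraph V) [DecidableRel G.Adj]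

/-- No edge outside `Q` joins a vertex with at least `r` common neighbours with `a` to a vertex
with at least `r` common neighbours with `b`. -/
def NoLink (r : ℕ) (Q : Finset V) (a b : V) : Prop :=
  ∀ ⦃c c' : V⦄, c ∉ Q → c' ∉ Q → r ≤ codeg G a c → r ≤ codeg G b c' → ¬ G.Adj c c'

/-- Outside `Q` the graph splits into two nonempty parts with no edges in between. -/
def SplitsOff (Q : Finset V) : Prop :=
  ∃ A : Finset V, (∃ a ∈ A, a ∉ Q) ∧ (∃ b ∉ A, b ∉ Q) ∧
    ∀ ⦃a b⦄, a ∉ Q → b ∉ Q → a ∈ A → b ∉ A → ¬ G.Adj a b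

/-- Outside at most `q` vertices the graph is bipartite. -/
def NearlyBipartite (q : ℕ) : Prop :=
  ∃ Q A : Finset V, Q.card ≤ q ∧ ∀ ⦃a b⦄, a ∉ Q → b ∉ Q → (a ∈ A ↔ b ∈ A) → ¬ G.Adj a b

/-- Distinct edges outside `Q` of the same colour have few common neighbours across. -/
def FarPairs (χ : Sym2 V → ℕ) (h : ℕ) (Q : Finset V) : Prop :=
  ∀ ⦃u v x y⦄, u ∉ Q → v ∉ Q → x ∉ Q → y ∉ Q → G.Adj u v → G.Adj x y →
    χ s(u, v) = χ s(x, y) → s(u, v) ≠ s(x, y) → codeg G u x < h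

variable {G} {χ : Sym2 V → ℕ} {k r h : ℕ} {Q : Finset V}

theorem NoLink.symm {a b : V} (H : NoLink G r Q a b) : NoLink G r Q b a :=
  fun _ _ hc hc' h1 h2 h3 => H hc' hc h2 h1 h3.symm

theorem card_atypical_mul_le (r h : ℕ) (u : V) :
    ((G.neighborFinset u).filter fun w =>
      h ≤ ((G.neighborFinset w).filter fun c => codeg G u c < r).card).card * h ≤
      Fintype.card V * r := by
  have key : ∑ w ∈ G.neighborFinset u,
      ((G.neighborFinset w).filter fun c => codeg G u c < r).card =
      ∑ c ∈ Finset.univ.filter (fun c => codeg G u c < r), codeg G u c := by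
    have := Finset.sum_card_bipartiteAbove_eq_sum_card_bipartiteBelow (s := G.neighborFinset u)
      (t := Finset.univ.filter (fun c => codeg G u c < r)) G.Adj
    convert this using 2 with w hw c hc
    · congr 1; ext c; simp [Finset.bipartiteAbove, and_comm]
    · unfold codeg; congr 1; ext w; simp [Finset.bipartiteBelow, G.adj_comm]
  calc _ ≤ ∑ w ∈ (G.neighborFinset u).filter fun w =>
      h ≤ ((G.neighborFinset w).filter fun c => codeg G u c < r).card,
        ((G.neighborFinset w).filter fun c => codeg G u c < r).card := by
        rw [← smul_eq_mul]
        exact Finset.card_nsmul_le_sum _ _ _ fun w hw => (Finset.mem_filter.1 hw).2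
    _ ≤ ∑ w ∈ G.neighborFinset u,
      ((G.neighborFinset w).filter fun c => codeg G u c < r).card :=
        Finset.sum_le_sum_of_subset (Finset.filter_subset _ _)
    _ = _ := key
    _ ≤ (Finset.univ.filter (fun c => codeg G u c < r)).card • r :=
        Finset.sum_le_card_nsmul _ _ _ fun c hc => (Finset.mem_filter.1 hc).2.le
    _ ≤ _ := by
        rw [smul_eq_mul]; exact Nat.mul_le_mul_right _ (Finset.card_le_univ _)

namespace LargeDegrees

/-- Any large set of common neighbours of `u` and `y` has a vertex almost all of whose neighbours
have many common neighbours with both `u` and `y`. -/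
theorem exists_typical (H : LargeDegrees G k r h) (u y : V) {S : Finset V}
    (hu : S ⊆ G.neighborFinset u) (hy : S ⊆ G.neighborFinset y) (hS : h ≤ S.card + 4) :
    ∃ w ∈ S, ((G.neighborFinset w).filter fun c => codeg G u c < r).card < h ∧
      ((G.neighborFinset w).filter fun c => codeg G y c < r).card < h := by
  by_contra! hcon
  have h1 := card_atypical_mul_le (G := G) r h u
  have h2 := card_atypical_mul_le (G := G) r h y
  set A := (G.neighborFinset u).filter fun w =>
      h ≤ ((G.neighborFinset w).filter fun c => codeg G u c < r).card
  set B := (G.neighborFinset y).filter fun w =>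
      h ≤ ((G.neighborFinset w).filter fun c => codeg G y c < r).card
  have hsub : S ⊆ A ∪ B := by
    intro w hw
    simp only [A, B, Finset.mem_union, Finset.mem_filter]
    by_cases hc : h ≤ ((G.neighborFinset w).filter fun c => codeg G u c < r).card
    · exact .inl ⟨hu hw, hc⟩
    · exact .inr ⟨hy hw, hcon w hw (not_le.1 hc)⟩
  have h3 := (Finset.card_le_card hsub).trans (Finset.card_union_le _ _)
  have h4 := H.mul_lt
  have h5 : h ≤ A.card + B.card + 4 := by omega
  nlinarith [Nat.mul_le_mul_right h h5]

theorem exists_codeg_ge (H : LargeDegrees G k r h) (u : V) (hQ : Q.card ≤ 4) :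
    ∃ c, c ∉ Q ∧ r ≤ codeg G u c := by
  have h1 := H.two_mul_degree_ge
  have h2 := H.eighty_le
  obtain ⟨w, -, hw, -⟩ := H.exists_typical u u subset_rfl subset_rfl
    (by rw [card_neighborFinset_eq_degree]; have := h1 u; omega)
  have h3 := Finset.card_filter_add_card_filter_not (s := G.neighborFinset w)
    (fun c => codeg G u c < r)
  rw [card_neighborFinset_eq_degree] at h3
  obtain ⟨c, hc, hcQ⟩ := Finset.exists_mem_notMem_of_card_lt_card (s := Q)
    (t := (G.neighborFinset w).filter fun c => ¬ codeg G u c < r) (by have := h1 w; omega)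
  exact ⟨c, hcQ, not_lt.1 (Finset.mem_filter.1 hc).2⟩

theorem splitsOff (H : LargeDegrees G k r h) {u y : V} (hQ : Q.card ≤ 4)
    (hN : NoLink G r Q u y) (huy : codeg G u y < h) : SplitsOff G Q := by
  have h2 := H.eighty_le
  have h3 := H.four_mul_le
  have hor : ∀ c, codeg G u c < r → r ≤ codeg G y c := by
    intro c hc
    have := codeg_triple H.degree u y c
    omega
  have hand : ∀ c, c ∉ Q → r ≤ codeg G u c → codeg G y c < r := by
    intro c hc huc
    by_contra! hyc
    obtain ⟨w, hcw, hw⟩ := H.exists_adj c (X := Q) (by omega)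
    by_cases hw' : codeg G u w < r
    · exact hN hc hw huc (hor w hw') hcw
    · exact hN hw hc (not_lt.1 hw') hyc hcw.symm
  refine ⟨Finset.univ.filter fun c => r ≤ codeg G u c, ?_, ?_, ?_⟩
  · obtain ⟨c, hc, h⟩ := H.exists_codeg_ge u hQ
    exact ⟨c, by simpa using h, hc⟩
  · obtain ⟨c, hc, h⟩ := H.exists_codeg_ge y hQ
    refine ⟨c, ?_, hc⟩
    simp only [Finset.mem_filter, Finset.mem_univ, true_and]
    exact fun h' => absurd (hand c hc h') (not_lt.2 h)
  · intro a b ha hb haA hbA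
    simp only [Finset.mem_filter, Finset.mem_univ, true_and, not_le] at haA hbA
    exact hN ha hb haA (hor b hbA)

/-- If `u` and `y` have many common neighbours but are not linked, then some vertex outside is
typical for both. -/
theorem exists_center (H : LargeDegrees G k r h) {u y : V} (hQ : Q.card ≤ 4)
    (hN : NoLink G r Q u y) (huy : h ≤ codeg G u y) :
    ∃ p, codeg G u p < r ∧ codeg G y p < r ∧
      ((G.neighborFinset p).filter fun c => codeg G u c < r).card < h ∧
      ((G.neighborFinset p).filter fun c => codeg G y c < r).card < h := by
  have h1 := H.two_mul_degree_ge
  have h2 := H.eighty_le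
  have hS : codeg G u y ≤
      ((G.neighborFinset u ∩ G.neighborFinset y) \ Q).card + 4 := by
    have := Finset.le_card_sdiff Q (G.neighborFinset u ∩ G.neighborFinset y)
    unfold codeg
    omega
  obtain ⟨p, hp, hpu, hpy⟩ := H.exists_typical u y
    (S := (G.neighborFinset u ∩ G.neighborFinset y) \ Q)
    (Finset.sdiff_subset.trans Finset.inter_subset_left)
    (Finset.sdiff_subset.trans Finset.inter_subset_right) (huy.trans hS)
  have hpQ : p ∉ Q := (Finset.mem_sdiff.1 hp).2
  obtain ⟨t, ht, htX⟩ := Finset.exists_mem_notMem_of_card_lt_card (t := G.neighborFinset p)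
    (s := Q ∪ (((G.neighborFinset p).filter fun c => codeg G u c < r) ∪
      ((G.neighborFinset p).filter fun c => codeg G y c < r))) (by
    have a1 := Finset.card_union_le Q (((G.neighborFinset p).filter fun c => codeg G u c < r) ∪
      ((G.neighborFinset p).filter fun c => codeg G y c < r))
    have a2 := Finset.card_union_le ((G.neighborFinset p).filter fun c => codeg G u c < r)
      ((G.neighborFinset p).filter fun c => codeg G y c < r)
    have := h1 p
    rw [card_neighborFinset_eq_degree]
    omega)
  simp only [Finset.mem_union, Finset.mem_filter, not_or, not_and, not_lt] at htX
  have hpt : G.Adj p t := by simpa using ht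
  refine ⟨p, ?_, ?_, hpu, hpy⟩
  · by_contra! hc
    exact hN hpQ htX.1 hc (htX.2.2 ht) hpt
  · by_contra! hc
    exact hN htX.1 hpQ (htX.2.1 ht) hc hpt.symm

/-- A vertex with few common neighbours with `u` has many neighbours having many common
neighbours with `u`. -/
theorem exists_adj_codeg_ge (H : LargeDegrees G k r h) {u p t : V}
    (hup : codeg G u p < r) (hp : ((G.neighborFinset p).filter fun c => codeg G u c < r).card < h)
    (hut : codeg G u t < r) {X : Finset V} (hX : X.card ≤ 8) :
    ∃ c, G.Adj t c ∧ c ∉ X ∧ r ≤ codeg G u c := by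
  have h2 := H.eighty_le
  have h3 := H.four_mul_le
  have h4 := codeg_triple H.degree u p t
  obtain ⟨c, hc, hcX⟩ := Finset.exists_mem_notMem_of_card_lt_card
    (t := G.neighborFinset p ∩ G.neighborFinset t)
    (s := X ∪ ((G.neighborFinset p).filter fun c => codeg G u c < r)) (by
      have := Finset.card_union_le X ((G.neighborFinset p).filter fun c => codeg G u c < r)
      change _ < codeg G p t
      omega)
  simp only [Finset.mem_union, Finset.mem_filter, not_or, not_and, not_lt, Finset.mem_inter,
    mem_neighborFinset] at hc hcX
  exact ⟨c, hc.2, hcX.1, hcX.2 hc.1⟩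

theorem codeg_ge_of_noLink (H : LargeDegrees G k r h) {u y : V} (hQ : Q.card ≤ 4)
    (hN : NoLink G r Q u y) (huy : h ≤ codeg G u y) {c : V} (hc : c ∉ Q)
    (huc : r ≤ codeg G u c) : r ≤ codeg G y c := by
  by_contra! hyc
  obtain ⟨p, -, hyp, -, hp⟩ := H.exists_center hQ hN huy
  obtain ⟨t, hct, ht, hyt⟩ := H.exists_adj_codeg_ge hyp hp hyc (X := Q) (by omega)
  exact hN hc ht huc hyt hct

/-- In the situation of `exists_center`, vertices close to `u` are independent. -/
theorem noLink_self (H : LargeDegrees G k r h) {u y : V} (hQ : Q.card ≤ 4)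
    (hN : NoLink G r Q u y) (huy : h ≤ codeg G u y) : NoLink G r Q u u :=
  fun _ _ hc hc' h1 h2 => hN hc hc' h1 (H.codeg_ge_of_noLink hQ hN huy hc' h2)

theorem linked (H : LargeDegrees G k r h) {X : Finset V} {a b : V} (j : ℕ) (hj : j ≤ k)
    (hX : X.card ≤ 10) (hab : a ≠ b) (ha : a ∉ X) (hb : b ∉ X) (hr : r ≤ codeg G a b) :
    LinkedAvoiding G X (2 * (j + 1)) a b := by
  have := H.four_mul_le
  have := H.large
  exact linkedAvoiding_even (r := r) (fun v => by have := H.degree v; omega) j X a b hab ha hb hr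
    (by omega)

theorem exists_common (H : LargeDegrees G k r h) {a b : V} {X : Finset V} (hX : X.card ≤ 10)
    (hr : r ≤ codeg G a b) : ∃ w, G.Adj a w ∧ G.Adj w b ∧ w ∉ X := by
  have := H.large
  exact exists_common_neighbor (by omega)

theorem noLink_of_share (H : LargeDegrees G k r h) (hk : 4 ≤ k)
    (hχ : RainbowCycles G χ (2 * k + 1)) {u v y : V} (huv : G.Adj u v) (huy : G.Adj u y)
    (hvy : v ≠ y) (he : χ s(u, v) = χ s(u, y)) : NoLink G r {u, v, y} v y := by
  intro c c' hc hc' h1 h2 hcc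
  simp only [Finset.mem_insert, Finset.mem_singleton, not_or] at hc hc'
  obtain ⟨w, hvw, hwc, hw⟩ := H.exists_common (X := {u, v, y, c, c'})
    ((Finset.card_le_five).trans (by norm_num)) h1
  simp only [Finset.mem_insert, Finset.mem_singleton, not_or] at hw
  refine hχ.ne_of_share huy huv (l := 2 * (k - 3 + 1) + 1 + 1 + 1) ?_ (by omega) hvy.symm he.symm
  refine .cons hvw (by simp [huv.ne']) (.cons hwc (by simp; tauto)
    (.cons hcc (by simp; tauto) ?_))
  refine H.linked _ (by omega) (Finset.card_le_four.trans (by norm_num)) (by tauto) ?_ ?_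
    (by rwa [codeg_comm])
  · have := hcc.ne'
    simp; tauto
  · have := huy.ne'
    simp; tauto

theorem noLink_of_disjoint (H : LargeDegrees G k r h) (hk : 4 ≤ k)
    (hχ : RainbowCycles G χ (2 * k + 1)) {u v x y : V} (huv : G.Adj u v) (hxy : G.Adj x y)
    (hux : u ≠ x) (huy : u ≠ y) (hvx : v ≠ x) (hvy : v ≠ y) (he : χ s(u, v) = χ s(x, y))
    (hcd : h ≤ codeg G v x) : NoLink G r {u, v, x, y} u y := by
  intro c c' hc hc' h1 h2 hcc
  have := H.four_mul_le
  simp only [Finset.mem_insert, Finset.mem_singleton, not_or] at hc hc'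
  obtain ⟨z, hvz, hzx, hz⟩ := H.exists_common (X := {u, y, c, c'})
    ((Finset.card_le_four).trans (by norm_num)) (show r ≤ codeg G v x by omega)
  simp only [Finset.mem_insert, Finset.mem_singleton, not_or] at hz
  obtain ⟨w, hyw, hwc, hw⟩ := H.exists_common (X := {u, y, c, c'} ∪ {v, z, x})
    ((Finset.card_union_le _ _).trans
      ((add_le_add Finset.card_le_four Finset.card_le_three).trans (by norm_num))) h2
  simp only [Finset.mem_union, Finset.mem_insert, Finset.mem_singleton, not_or] at hw
  refine hχ.ne_of_disjoint huv hvz hzx hxy hvx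
    (l := 2 * (k - 4 + 1) + 1 + 1 + 1) ?_ (by omega) he
  have e1 := hxy.ne
  have e2 := huv.ne
  refine .cons hyw (by simp; tauto) (.cons hwc (by simp; tauto)
    (.cons hcc.symm (by simp; tauto) ?_))
  refine H.linked _ (by omega) (Finset.card_le_six.trans (by norm_num)) (by tauto) ?_ ?_
    (by rwa [codeg_comm])
  · have := hcc.ne
    simp; tauto
  · simp; tauto

end LargeDegrees
end Structure

section RepeatedColours

variable {V : Type*} [Fintype V] [DecidableEq V]
variable {G : SimpleGraph V} [DecidableRel G.Adj] {χ : Sym2 V → ℕ} {k r h : ℕ} {Q : Finset V}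

theorem NearlyBipartite.mono {V : Type*} {G : SimpleGraph V} {q q' : ℕ}
    (hq : q ≤ q') (H : NearlyBipartite G q) :
    NearlyBipartite G q' :=
  let ⟨Q, A, hQ, hA⟩ := H
  ⟨Q, A, hQ.trans hq, hA⟩

theorem mem_iff_mem_of_adj {V : Type*} {G : SimpleGraph V} {Q A : Finset V}
    (hA : ∀ ⦃a b⦄, a ∉ Q → b ∉ Q → a ∈ A → b ∉ A → ¬ G.Adj a b) {a b : V}
    (ha : a ∉ Q) (hb : b ∉ Q) (hab : G.Adj a b) : a ∈ A ↔ b ∈ A := by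
  by_contra hcon
  by_cases h : a ∈ A
  · exact hA ha hb h (by tauto) hab
  · exact hA hb ha (by tauto) h hab.symm

/-- Two distinct edges either share an endpoint or are disjoint. -/
theorem share_or_disjoint {V : Type*} [DecidableEq V] {G : SimpleGraph V} {χ : Sym2 V → ℕ}
    {u v x y : V} (huv : G.Adj u v) (hxy : G.Adj x y)
    (he : χ s(u, v) = χ s(x, y)) (hne : s(u, v) ≠ s(x, y)) :
    (∃ c a b, c ∈ ({u, v, x, y} : Finset V) ∧ a ∈ ({u, v, x, y} : Finset V) ∧
      b ∈ ({u, v, x, y} : Finset V) ∧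
      G.Adj c a ∧ G.Adj c b ∧ a ≠ b ∧ χ s(c, a) = χ s(c, b)) ∨
    (u ≠ x ∧ u ≠ y ∧ v ≠ x ∧ v ≠ y) := by
  by_cases h1 : u = x
  · subst h1
    exact .inl ⟨u, v, y, by simp, by simp, by simp, huv, hxy, fun h => hne (by rw [h]), he⟩
  by_cases h2 : u = y
  · subst h2
    rw [Sym2.eq_swap (a := x)] at he hne
    exact .inl ⟨u, v, x, by simp, by simp, by simp, huv, hxy.symm, fun h => hne (by rw [h]), he⟩
  by_cases h3 : v = x
  · subst h3
    rw [Sym2.eq_swap (a := u)] at he hne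
    exact .inl ⟨v, u, y, by simp, by simp, by simp, huv.symm, hxy, fun h => hne (by rw [h]), he⟩
  by_cases h4 : v = y
  · subst h4
    rw [Sym2.eq_swap (a := u), Sym2.eq_swap (a := x)] at he hne
    exact .inl ⟨v, u, x, by simp, by simp, by simp, huv.symm, hxy.symm, fun h => hne (by rw [h]), he⟩
  exact .inr ⟨h1, h2, h3, h4⟩

namespace LargeDegrees

theorem nearlyBipartite_of_share (H : LargeDegrees G k r h) (hk : 4 ≤ k)
    (hχ : RainbowCycles G χ (2 * k + 1)) {u v y : V} (huv : G.Adj u v) (huy : G.Adj u y)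
    (hvy : v ≠ y) (he : χ s(u, v) = χ s(u, y)) (hcd : h ≤ codeg G v y) :
    NearlyBipartite G 4 := by
  have hQ : Finset.card {u, v, y} ≤ 4 := Finset.card_le_three.trans (by norm_num)
  have hN := H.noLink_of_share hk hχ huv huy hvy he
  obtain ⟨p, hvp, -, hp, -⟩ := H.exists_center hQ hN hcd
  refine ⟨{u, v, y}, Finset.univ.filter fun c => r ≤ codeg G v c, hQ, ?_⟩
  intro a b ha hb hab hadj
  simp only [Finset.mem_filter, Finset.mem_univ, true_and] at hab
  by_cases hva : r ≤ codeg G v a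
  · exact H.noLink_self hQ hN hcd ha hb hva (hab.1 hva) hadj
  have hvb : codeg G v b < r := not_le.1 fun h => hva (hab.2 h)
  obtain ⟨d, had, hd, hvd⟩ := H.exists_adj_codeg_ge hvp hp (not_le.1 hva) (X := {u, v, y, b})
    (Finset.card_le_four.trans (by norm_num))
  obtain ⟨d', hbd', hd', hvd'⟩ := H.exists_adj_codeg_ge hvp hp hvb (X := {u, v, y, a, d})
    (Finset.card_le_five.trans (by norm_num))
  simp only [Finset.mem_insert, Finset.mem_singleton, not_or] at hd hd' ha hb
  have hyd' : r ≤ codeg G y d' :=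
    H.codeg_ge_of_noLink hQ hN hcd (by grind) hvd'
  obtain ⟨w, hvw, hwd, hw⟩ := H.exists_common (X := {u, y, a, b, d'})
    ((Finset.card_le_five).trans (by norm_num)) hvd
  simp only [Finset.mem_insert, Finset.mem_singleton, not_or] at hw
  have e1 := hadj.ne
  have e2 := hvw.ne
  have e3 := hwd.ne
  have e4 := had.ne
  have e5 := hbd'.ne
  have e6 := huv.ne
  have e7 := huy.ne
  refine hχ.ne_of_share huy huv (l := 2 * (k - 4 + 1) + 1 + 1 + 1 + 1 + 1) ?_ (by omega)
    hvy.symm he.symm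
  refine .cons hvw (by grind) (.cons hwd (by grind)
    (.cons had.symm (by grind) (.cons hadj (by grind)
    (.cons hbd' (by grind) ?_))))
  refine H.linked _ (by omega) (Finset.card_le_six.trans (by norm_num)) (by grind) ?_ ?_
    (by rwa [codeg_comm])
  · grind
  · grind

/-- Edges of the same colour with many common neighbours across are obstructed. -/
theorem exists_noLink (H : LargeDegrees G k r h) (hk : 4 ≤ k)
    (hχ : RainbowCycles G χ (2 * k + 1)) {u v x y : V} (huv : G.Adj u v) (hxy : G.Adj x y)
    (he : χ s(u, v) = χ s(x, y)) (hne : s(u, v) ≠ s(x, y)) (hcd : h ≤ codeg G u x) :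
    ∃ Q : Finset V, Q.card ≤ 4 ∧ ∃ a b, a ∈ ({u, v, x, y} : Finset V) ∧
      b ∈ ({u, v, x, y} : Finset V) ∧ NoLink G r Q a b := by
  rcases share_or_disjoint huv hxy he hne with ⟨c, a, b, -, ha, hb, hca, hcb, hab, he'⟩ | hd
  · exact ⟨_, Finset.card_le_three.trans (by norm_num), a, b, ha, hb,
      H.noLink_of_share hk hχ hca hcb hab he'⟩
  · rw [Sym2.eq_swap] at he
    exact ⟨_, Finset.card_le_four, v, y, by simp, by simp,
      H.noLink_of_disjoint hk hχ huv.symm hxy hd.2.2.1 hd.2.2.2 hd.1 hd.2.1 he hcd⟩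

theorem codeg_ge_of_split (H : LargeDegrees G k r h) (hQ : Q.card ≤ 4) {A : Finset V}
    (hA : ∀ ⦃a b⦄, a ∉ Q → b ∉ Q → a ∈ A → b ∉ A → ¬ G.Adj a b)
    {a b c : V} (ha : a ∉ Q) (hb : b ∉ Q) (hc : c ∉ Q) (hab : a ∈ A ↔ b ∈ A)
    (hac : ¬ (a ∈ A ↔ c ∈ A)) : h ≤ codeg G a b := by
  have h1 := H.eighty_le
  have hd : ∀ t, t ∉ Q → G.neighborFinset t ⊆
      Q ∪ Finset.univ.filter (fun w => w ∈ A ↔ t ∈ A) := by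
    intro t ht w hw
    have htw : G.Adj t w := by simpa using hw
    by_cases hwQ : w ∈ Q
    · simp [hwQ]
    · have := mem_iff_mem_of_adj hA ht hwQ htw
      simp [hwQ, this]
  have c1 := Finset.card_le_card (hd c hc)
  have c2 := Finset.card_le_card (Finset.union_subset (hd a ha)
    (show G.neighborFinset b ⊆ _ from by simp only [hab]; exact hd b hb))
  have c3 := Finset.card_union_add_card_inter (G.neighborFinset a) (G.neighborFinset b)
  have c4 := Finset.card_filter_add_card_filter_not (s := (Finset.univ : Finset V))
    (fun w => w ∈ A ↔ a ∈ A)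
  have c5 : Finset.univ.filter (fun w => w ∈ A ↔ c ∈ A) =
      Finset.univ.filter (fun w => ¬ (w ∈ A ↔ a ∈ A)) := by
    ext w; simp; tauto
  have c6 := Finset.card_union_le Q (Finset.univ.filter (fun w => w ∈ A ↔ c ∈ A))
  have c7 := Finset.card_union_le Q (Finset.univ.filter (fun w => w ∈ A ↔ a ∈ A))
  rw [c5] at c6 c1
  simp only [card_neighborFinset_eq_degree] at *
  rw [Finset.card_univ] at c4
  have d1 := H.degree a
  have d2 := H.degree b
  have d3 := H.degree c
  unfold codeg
  omega

theorem farPairs_of_splitsOff (H : LargeDegrees G k r h) (hk : 4 ≤ k)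
    (hχ : RainbowCycles G χ (2 * k + 1)) (hQ : Q.card ≤ 4) (hS : SplitsOff G Q) :
    FarPairs G χ h Q := by
  obtain ⟨A, ⟨a₀, ha₀, ha₀Q⟩, ⟨b₀, hb₀, hb₀Q⟩, hA⟩ := hS
  have hex : ∀ a, ∃ c, c ∉ Q ∧ ¬ (a ∈ A ↔ c ∈ A) := by
    intro a
    by_cases h : a ∈ A
    · exact ⟨b₀, hb₀Q, by tauto⟩
    · exact ⟨a₀, ha₀Q, by tauto⟩
  have hcod : ∀ ⦃a b⦄, a ∉ Q → b ∉ Q → (a ∈ A ↔ b ∈ A) → h ≤ codeg G a b := by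
    intro a b ha hb hab
    obtain ⟨c, hc, hac⟩ := hex a
    exact H.codeg_ge_of_split hQ hA ha hb hc hab hac
  have h1 := H.eighty_le
  have h2 := H.four_mul_le
  intro u v x y hu hv hx hy huv hxy he hne
  by_contra! hcd
  obtain ⟨Q', hQ', a, b, ha, hb, hN⟩ := H.exists_noLink hk hχ huv hxy he hne hcd
  have hux : u ∈ A ↔ x ∈ A := by
    obtain ⟨w, huw, hwx, hw⟩ := exists_common_neighbor (X := Q) (show Q.card < codeg G u x by omega)
    exact (mem_iff_mem_of_adj hA hu hw huw).trans (mem_iff_mem_of_adj hA hw hx hwx)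
  have huv' := mem_iff_mem_of_adj hA hu hv huv
  have hxy' := mem_iff_mem_of_adj hA hx hy hxy
  have hall : ∀ t ∈ ({u, v, x, y} : Finset V), t ∉ Q ∧ (t ∈ A ↔ u ∈ A) := by
    intro t ht
    simp only [Finset.mem_insert, Finset.mem_singleton] at ht
    rcases ht with rfl | rfl | rfl | rfl <;> grind
  have hQQ : (Q ∪ Q').card ≤ 8 := (Finset.card_union_le _ _).trans (by omega)
  obtain ⟨c, huc, hc⟩ := H.exists_adj u hQQ
  obtain ⟨c', hcc, hc'⟩ := H.exists_adj c hQQ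
  simp only [Finset.mem_union, not_or] at hc hc'
  have e1 := mem_iff_mem_of_adj hA hu hc.1 huc
  have e2 := mem_iff_mem_of_adj hA hc.1 hc'.1 hcc
  obtain ⟨ha1, ha2⟩ := hall a ha
  obtain ⟨hb1, hb2⟩ := hall b hb
  have := hcod ha1 hc.1 (by grind)
  have := hcod hb1 hc'.1 (by grind)
  exact hN hc.2 hc'.2 (by omega) (by omega) hcc

theorem trichotomy (H : LargeDegrees G k r h) (hk : 4 ≤ k)
    (hχ : RainbowCycles G χ (2 * k + 1)) {u v x y : V} (huv : G.Adj u v) (hxy : G.Adj x y)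
    (he : χ s(u, v) = χ s(x, y)) (hne : s(u, v) ≠ s(x, y)) (hcd : h ≤ codeg G u x) :
    (∃ Q : Finset V, Q.card ≤ 4 ∧ FarPairs G χ h Q) ∨ NearlyBipartite G 8 ∨
      ∃ Q : Finset V, Q.card ≤ 4 ∧ NoLink G r Q u u ∧ NoLink G r Q v v := by
  rcases share_or_disjoint huv hxy he hne with ⟨c, a, b, -, ha, hb, hca, hcb, hab, he'⟩ | hd
  · by_cases hc : codeg G a b < h
    · exact .inl ⟨{c, a, b}, Finset.card_le_three.trans (by norm_num),
        H.farPairs_of_splitsOff hk hχ (Finset.card_le_three.trans (by norm_num))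
        (H.splitsOff (Finset.card_le_three.trans (by norm_num))
          (H.noLink_of_share hk hχ hca hcb hab he') hc)⟩
    · exact .inr (.inl ((H.nearlyBipartite_of_share hk hχ hca hcb hab he' (not_lt.1 hc)).mono
        (by norm_num)))
  · obtain ⟨h1, h2, h3, h4⟩ := hd
    have hN := H.noLink_of_disjoint hk hχ huv.symm hxy h3 h4 h1 h2
      (by rwa [Sym2.eq_swap]) hcd
    by_cases hc : codeg G v y < h
    · exact .inl ⟨_, Finset.card_le_four, H.farPairs_of_splitsOff hk hχ Finset.card_le_four
        (H.splitsOff Finset.card_le_four hN hc)⟩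
    · rw [not_lt] at hc
      have hN' := H.noLink_of_disjoint hk hχ huv hxy.symm h2 h1 h4 h3
        (by rwa [Sym2.eq_swap (a := y)]) hc
      refine .inr (.inr ⟨{u, v, x, y}, Finset.card_le_four, ?_, ?_⟩)
      · convert H.noLink_self Finset.card_le_four hN' hcd using 1
        rw [Finset.pair_comm]
      · convert H.noLink_self Finset.card_le_four hN hc using 1
        rw [Finset.insert_comm]

theorem farPairs_or_nearlyBipartite (H : LargeDegrees G k r h) (hk : 4 ≤ k)
    (hχ : RainbowCycles G χ (2 * k + 1)) :
    (∃ Q : Finset V, Q.card ≤ 4 ∧ FarPairs G χ h Q) ∨ NearlyBipartite G 8 := by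
  by_contra! hcon
  obtain ⟨hF, hB⟩ := hcon
  have hstep : ∀ Q : Finset V, Q.card ≤ 4 → ∃ u v, u ∉ Q ∧ v ∉ Q ∧ G.Adj u v ∧
      ∃ Q' : Finset V, Q'.card ≤ 4 ∧ NoLink G r Q' u u ∧ NoLink G r Q' v v := by
    intro Q hQ
    have := hF Q hQ
    unfold FarPairs at this
    push Not at this
    obtain ⟨u, v, x, y, hu, hv, -, -, huv, hxy, he, hne, hcd⟩ := this
    refine ⟨u, v, hu, hv, huv, ?_⟩
    rcases H.trichotomy hk hχ huv hxy he hne hcd with ⟨Q', hQ', h'⟩ | h' | h'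
    · exact absurd h' (hF Q' hQ')
    · exact absurd h' hB
    · exact h'
  obtain ⟨t, -, -, -, -, Q, hQ, hN, -⟩ := hstep ∅ (by simp)
  obtain ⟨u, v, hu, hv, huv, Q', hQ', hNu, hNv⟩ := hstep Q hQ
  have h1 := H.four_mul_le
  obtain ⟨o, hto, hNo⟩ : ∃ o, codeg G t o < r ∧ NoLink G r Q' o o := by
    by_cases htu : codeg G t u < r
    · exact ⟨u, htu, hNu⟩
    · exact ⟨v, not_le.1 fun htv => hN hu hv (not_lt.1 htu) htv huv, hNv⟩
  have hcl : ∀ c, codeg G t c < r → r ≤ codeg G o c := by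
    intro c hc
    have := codeg_triple H.degree t o c
    omega
  refine hB ⟨Q ∪ Q', Finset.univ.filter fun c => r ≤ codeg G t c,
    (Finset.card_union_le _ _).trans (by omega), ?_⟩
  intro a b ha hb hab hadj
  simp only [Finset.mem_filter, Finset.mem_univ, true_and, Finset.mem_union, not_or] at hab ha hb
  by_cases hta : r ≤ codeg G t a
  · exact hN ha.1 hb.1 hta (hab.1 hta) hadj
  · exact hNo ha.2 hb.2 (hcl a (not_le.1 hta)) (hcl b (not_le.1 fun h => hta (hab.2 h))) hadj

end LargeDegrees
end RepeatedColours

section Counting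

variable {V : Type*} [Fintype V] [DecidableEq V]

theorem degree_add_degree_le (G : SimpleGraph V) [DecidableRel G.Adj] (u v : V) :
    G.degree u + G.degree v ≤ Fintype.card V + codeg G u v := by
  have h1 := Finset.card_union_add_card_inter (G.neighborFinset u) (G.neighborFinset v)
  have h2 := Finset.card_le_univ (G.neighborFinset u ∪ G.neighborFinset v)
  simp only [card_neighborFinset_eq_degree] at h1
  unfold codeg
  omega

/-- The total weight of an edge. -/
noncomputable def edgeWeight (g : V → ℝ) (e : Sym2 V) : ℝ :=
  ∑ v ∈ Finset.univ.filter (· ∈ e), g v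

theorem edgeWeight_mk (g : V → ℝ) {u v : V} (huv : u ≠ v) :
    edgeWeight g s(u, v) = g u + g v := by
  have : Finset.univ.filter (· ∈ s(u, v)) = {u, v} := by ext; simp
  rw [edgeWeight, this, Finset.sum_pair huv]

variable {G : SimpleGraph V} [DecidableRel G.Adj]

theorem sum_edgeWeight (g : V → ℝ) :
    ∑ e ∈ G.edgeFinset, edgeWeight g e = ∑ v, G.degree v * g v := by
  unfold edgeWeight
  rw [Finset.sum_comm' (t' := Finset.univ) (s' := fun v => G.incidenceFinset v)]
  · refine Finset.sum_congr rfl fun v _ => ?_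
    rw [Finset.sum_const, card_incidenceFinset_eq_degree, nsmul_eq_mul]
  · intro e v
    simp [incidenceFinset_eq_filter]

theorem card_edges_meeting_le (Q : Finset V) :
    (G.edgeFinset.filter (fun e => ¬ ∀ v ∈ e, v ∉ Q)).card ≤ Q.card * Fintype.card V := by
  have hsub : G.edgeFinset.filter (fun e => ¬ ∀ v ∈ e, v ∉ Q) ⊆
      Q.biUnion fun v => G.incidenceFinset v := by
    intro e he
    simp only [Finset.mem_filter, not_forall, not_not, Finset.mem_biUnion] at he ⊢
    obtain ⟨he, v, hv, hvQ⟩ := he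
    exact ⟨v, hvQ, by simp [incidenceFinset_eq_filter, hv, mem_edgeFinset.1 he]⟩
  refine (Finset.card_le_card hsub).trans (Finset.card_biUnion_le_card_mul _ _ _ fun v _ => ?_)
  rw [card_incidenceFinset_eq_degree]
  exact (G.degree_lt_card_verts v).le

variable {χ : Sym2 V → ℕ} {k r h : ℕ} {Q : Finset V}

theorem FarPairs.card_fiber_le (hdeg : ∀ v, Fintype.card V + 3 * h ≤ 3 * G.degree v)
    (hF : FarPairs G χ h Q) {S : Finset (Sym2 V)} (hS : S ⊆ G.edgeFinset)
    (hSQ : ∀ e ∈ S, ∀ v ∈ e, v ∉ Q) {c : ℕ} (hc : ∀ e ∈ S, χ e = c) : S.card ≤ 2 := by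
  by_contra! hcon
  obtain ⟨e₁, e₂, e₃, h₁, h₂, h₃, h₁₂, h₁₃, h₂₃⟩ := Finset.two_lt_card_iff.1 hcon
  have a₁ := hS h₁
  have a₂ := hS h₂
  have a₃ := hS h₃
  have b₁ := hSQ _ h₁
  have b₂ := hSQ _ h₂
  have b₃ := hSQ _ h₃
  have c₁ := hc _ h₁
  have c₂ := hc _ h₂
  have c₃ := hc _ h₃
  clear hS hSQ hc hcon h₁ h₂ h₃
  induction e₁ with | _ u v
  induction e₂ with | _ x y
  induction e₃ with | _ z w
  simp only [mem_edgeFinset, mem_edgeSet, Sym2.mem_iff, forall_eq_or_imp, forall_eq] at *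
  have d₁ := hF b₁.1 b₁.2 b₂.1 b₂.2 a₁ a₂ (c₁.trans c₂.symm) h₁₂
  have d₂ := hF b₁.1 b₁.2 b₃.1 b₃.2 a₁ a₃ (c₁.trans c₃.symm) h₁₃
  have d₃ := hF b₂.1 b₂.2 b₃.1 b₃.2 a₂ a₃ (c₂.trans c₃.symm) h₂₃
  have := codeg_triple hdeg u x z
  omega

/-- Under `FarPairs`, a suitable degree-based weighting gives every colour weight at most one. -/
theorem FarPairs.card_colors_ge (hdeg : ∀ v, Fintype.card V + 3 * h ≤ 3 * G.degree v)
    (hh : 0 < h) (hQ : Q.card ≤ 4) (hF : FarPairs G χ h Q) :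
    3 / 2 * (G.edgeFinset.card : ℝ) - Fintype.card V * (Fintype.card V + h) / 4 -
      4 * Fintype.card V ≤ ((G.edgeFinset.image χ).card : ℝ) := by
  set s : ℝ := (Fintype.card V : ℝ) with hs
  set σ : ℝ := s + h with hσ
  have hσ0 : 0 < σ := by positivity
  set g : V → ℝ := fun v => min (1 / 2) (G.degree v / σ - 1 / 4) with hg
  have hg1 : ∀ v, g v ≤ 1 / 2 := fun v => min_le_left _ _
  have hg2 : ∀ u x, codeg G u x < h → g u + g x ≤ 1 / 2 := by
    intro u x hux
    have h1 : (G.degree u : ℝ) + G.degree x ≤ σ := by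
      have := degree_add_degree_le G u x
      rw [hσ, hs]
      norm_cast
      omega
    have h2 : (G.degree u : ℝ) / σ + G.degree x / σ ≤ 1 := by
      rw [← add_div]; exact (div_le_one hσ0).2 h1
    have h3 : g u ≤ G.degree u / σ - 1 / 4 := min_le_right _ _
    have h4 : g x ≤ G.degree x / σ - 1 / 4 := min_le_right _ _
    linarith
  have hg3 : ∀ v, 3 / 4 * (G.degree v : ℝ) - σ / 4 ≤ G.degree v * g v := by
    intro v
    have h0 : (0 : ℝ) ≤ G.degree v := by positivity
    have h1 : (G.degree v : ℝ) ≤ σ := by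
      have := (G.degree_lt_card_verts v).le
      rw [hσ, hs]
      norm_cast
      omega
    rcases min_choice (1 / 2 : ℝ) (G.degree v / σ - 1 / 4) with h2 | h2
    · simp only [hg, h2]; linarith
    · simp only [hg, h2]
      have : (G.degree v : ℝ) * (G.degree v / σ - 1 / 4) - (3 / 4 * G.degree v - σ / 4) =
          (G.degree v - σ / 2) ^ 2 / σ := by
        field_simp; ring
      have : 0 ≤ (G.degree v - σ / 2) ^ 2 / σ := by positivity
      linarith
  have hW1 : ∀ e ∈ G.edgeFinset, edgeWeight g e ≤ 1 := by
    intro e he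
    induction e with | _ u v
    rw [edgeWeight_mk g (by simpa using (mem_edgeFinset.1 he : G.Adj u v).ne)]
    linarith [hg1 u, hg1 v]
  set E' := G.edgeFinset.filter (fun e => ∀ v ∈ e, v ∉ Q) with hE'
  have hfib : ∀ c ∈ E'.image χ, ∑ e ∈ E' with χ e = c, edgeWeight g e ≤ 1 := by
    intro c _
    have hsub : E'.filter (fun e => χ e = c) ⊆ G.edgeFinset :=
      (Finset.filter_subset _ _).trans (Finset.filter_subset _ _)
    have hQ' : ∀ e ∈ E'.filter (fun e => χ e = c), ∀ v ∈ e, v ∉ Q := fun e he =>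
      (Finset.mem_filter.1 (Finset.mem_filter.1 he).1).2
    have hc : ∀ e ∈ E'.filter (fun e => χ e = c), χ e = c := fun e he => (Finset.mem_filter.1 he).2
    have h2 := hF.card_fiber_le hdeg hsub hQ' hc
    generalize E'.filter (fun e => χ e = c) = S at *
    have h3 : S.card = 0 ∨ S.card = 1 ∨ S.card = 2 := by omega
    rcases h3 with h3 | h3 | h3
    · rw [Finset.card_eq_zero.1 h3]; simp
    · obtain ⟨e, rfl⟩ := Finset.card_eq_one.1 h3
      simpa using hW1 e (hsub (by simp))
    · obtain ⟨e₁, e₂, hne, rfl⟩ := Finset.card_eq_two.1 h3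
      rw [Finset.sum_pair hne]
      have a₁ := hsub (show e₁ ∈ _ by simp)
      have a₂ := hsub (show e₂ ∈ _ by simp)
      have b₁ := hQ' e₁ (by simp)
      have b₂ := hQ' e₂ (by simp)
      have c₁ := hc e₁ (by simp)
      have c₂ := hc e₂ (by simp)
      clear hsub hQ' hc h2 h3
      induction e₁ with | _ u v
      induction e₂ with | _ x y
      simp only [mem_edgeFinset, mem_edgeSet, Sym2.mem_iff, forall_eq_or_imp, forall_eq] at a₁ a₂ b₁ b₂
      rw [edgeWeight_mk g a₁.ne, edgeWeight_mk g a₂.ne]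
      have d₁ := hg2 _ _ (hF b₁.1 b₁.2 b₂.1 b₂.2 a₁ a₂ (c₁.trans c₂.symm) hne)
      have d₂ := hg2 _ _ (hF b₁.2 b₁.1 b₂.2 b₂.1 a₁.symm a₂.symm
        (by rw [Sym2.eq_swap, c₁, Sym2.eq_swap, c₂])
        (by rwa [Sym2.eq_swap, Sym2.eq_swap (a := y)]))
      linarith
  have hE'sum : ∑ e ∈ E', edgeWeight g e ≤ ((G.edgeFinset.image χ).card : ℝ) := by
    rw [← Finset.sum_fiberwise_of_maps_to (t := E'.image χ) (g := χ)
      (fun e he => Finset.mem_image_of_mem _ he)]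
    refine (Finset.sum_le_card_nsmul _ _ _ hfib).trans ?_
    rw [nsmul_eq_mul, mul_one, Nat.cast_le]
    exact Finset.card_le_card (Finset.image_subset_image (Finset.filter_subset _ _))
  have hrest : ∑ e ∈ G.edgeFinset.filter (fun e => ¬ ∀ v ∈ e, v ∉ Q), edgeWeight g e ≤ 4 * s := by
    have hcard : (G.edgeFinset.filter (fun e => ¬ ∀ v ∈ e, v ∉ Q)).card ≤ 4 * Fintype.card V :=
      (card_edges_meeting_le Q).trans (Nat.mul_le_mul_right _ hQ)
    refine (Finset.sum_le_card_nsmul _ _ 1 fun e he => hW1 e (Finset.mem_filter.1 he).1).trans ?_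
    rw [nsmul_eq_mul, mul_one, hs]
    exact_mod_cast hcard
  have htot := Finset.sum_filter_add_sum_filter_not G.edgeFinset (fun e => ∀ v ∈ e, v ∉ Q)
    (edgeWeight g)
  rw [sum_edgeWeight] at htot
  have hlow : ∑ v, (3 / 4 * (G.degree v : ℝ) - σ / 4) ≤ ∑ v, G.degree v * g v :=
    Finset.sum_le_sum fun v _ => hg3 v
  rw [Finset.sum_sub_distrib, ← Finset.mul_sum, Finset.sum_const, Finset.card_univ,
    nsmul_eq_mul] at hlow
  have hsum : ∑ v, (G.degree v : ℝ) = 2 * G.edgeFinset.card := by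
    exact_mod_cast G.sum_degrees_eq_twice_card_edges
  rw [hsum, ← hs] at hlow
  linarith

end Counting

section Transfer

theorem RainbowCycles.comap {V W : Type*} {G : SimpleGraph V} {χ : Sym2 V → ℕ} {L : ℕ}
    (hχ : RainbowCycles G χ L) (f : W ↪ V) :
    RainbowCycles (G.comap f) (fun e => χ (e.map f)) L := by
  intro v w hw hl
  have h := hχ (w.map (Embedding.comap f G).toHom)
    ((Walk.isCycle_map_iff_of_injective f.injective).2 hw) ((Walk.length_map _ _).trans hl)
  rw [Walk.edges_map, List.map_map] at h
  exact h

variable {V : Type*} [Fintype V]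

theorem card_image_comap_le {W : Type*} [Fintype W] (G : SimpleGraph V)
    [DecidableRel G.Adj] (χ : Sym2 V → ℕ) (f : W ↪ V) {H : SimpleGraph W} (hH : H = G.comap f)
    [DecidableRel H.Adj] :
    (H.edgeFinset.image (fun e => χ (e.map f))).card ≤ (G.edgeFinset.image χ).card := by
  refine Finset.card_le_card fun c hc => ?_
  obtain ⟨e, he, rfl⟩ := Finset.mem_image.1 hc
  refine Finset.mem_image_of_mem _ ?_
  induction e with | _ u v
  simpa [hH] using he

theorem cast_degree_eq_sum (G : SimpleGraph V) [DecidableRel G.Adj] (v : V) :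
    (G.degree v : ℝ) = ∑ b, if G.Adj v b then (1 : ℝ) else 0 := by
  rw [Finset.sum_boole, ← card_neighborFinset_eq_degree, neighborFinset_eq_filter]

theorem two_mul_card_edges_eq_sum (G : SimpleGraph V) [DecidableRel G.Adj] :
    2 * (G.edgeFinset.card : ℝ) = ∑ a, ∑ b, if G.Adj a b then (1 : ℝ) else 0 := by
  simp_rw [← cast_degree_eq_sum]
  exact_mod_cast G.sum_degrees_eq_twice_card_edges.symm

variable [DecidableEq V]

/-- A subset maximizing the number of edges minus a quadratic penalty has large minimum degree. -/
theorem exists_dense_subset (G : SimpleGraph V) [DecidableRel G.Adj] {l : ℝ} :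
    ∃ S : Finset V, ∀ H : SimpleGraph S, H = G.comap (Function.Embedding.subtype (· ∈ S)) →
      ∀ [DecidableRel H.Adj],
      2 * (G.edgeFinset.card : ℝ) - l * Fintype.card V ^ 2 ≤
        2 * (H.edgeFinset.card : ℝ) - l * S.card ^ 2 ∧
      ∀ v, l * (2 * S.card - 1) ≤ 2 * (H.degree v : ℝ) := by
  set f : V → V → ℝ := fun a b => if G.Adj a b then 1 else 0 with hf
  set F : Finset V → ℝ := fun S => ∑ a ∈ S, ∑ b ∈ S, f a b with hF
  obtain ⟨S, -, hS⟩ := Finset.exists_max_image (Finset.univ : Finset (Finset V))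
    (fun S => F S - l * S.card ^ 2) ⟨∅, by simp⟩
  refine ⟨S, fun H hH _ => ⟨?_, fun v => ?_⟩⟩
  · have h1 := hS Finset.univ (Finset.mem_univ _)
    have h2 : F S = 2 * (H.edgeFinset.card : ℝ) := by
      rw [two_mul_card_edges_eq_sum]
      change ∑ a ∈ S, ∑ b ∈ S, f a b = _
      rw [← Finset.sum_coe_sort S (fun a => ∑ b ∈ S, f a b)]
      refine Finset.sum_congr rfl fun a _ => ?_
      rw [← Finset.sum_coe_sort S (f a)]
      refine Finset.sum_congr rfl fun b _ => ?_
      simp [hf, hH]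
    rw [two_mul_card_edges_eq_sum, ← h2]
    simpa [hF, hf, Finset.card_univ] using h1
  · have h1 := hS (S.erase v) (Finset.mem_univ _)
    have h2 : (H.degree v : ℝ) = ∑ b ∈ S, f v b := by
      rw [cast_degree_eq_sum, ← Finset.sum_coe_sort S (f v)]
      refine Finset.sum_congr rfl fun b _ => ?_
      simp [hf, hH]
    have hvv : f v v = 0 := by simp [hf]
    have hsym : ∀ a, f a v = f v a := fun a => by simp [hf, G.adj_comm]
    have h3 : ∑ b ∈ S, f v b = ∑ b ∈ S.erase v, f v b := by
      rw [← Finset.add_sum_erase _ _ v.2, hvv, zero_add]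
    have h4 : F S = F (S.erase v) + 2 * ∑ b ∈ S, f v b := by
      simp only [hF]
      rw [← Finset.add_sum_erase S _ v.2, h3]
      have : ∀ a ∈ S.erase ↑v, ∑ b ∈ S, f a b = f v a + ∑ b ∈ S.erase ↑v, f a b := by
        intro a _
        rw [← Finset.add_sum_erase _ _ v.2, hsym]
      rw [Finset.sum_congr rfl this, Finset.sum_add_distrib]
      ring
    have h5 : ((S.erase (v : V)).card : ℝ) = S.card - 1 := by
      rw [Finset.card_erase_of_mem v.2, Nat.cast_sub (Finset.card_pos.2 ⟨_, v.2⟩), Nat.cast_one]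
    simp only [h5] at h1
    rw [h2]
    nlinarith

theorem NearlyBipartite.card_edges_le {G : SimpleGraph V} [DecidableRel G.Adj] {q : ℕ}
    (H : NearlyBipartite G q) :
    4 * G.edgeFinset.card ≤ Fintype.card V ^ 2 + 4 * (q * Fintype.card V) := by
  obtain ⟨Q, A, hQ, hA⟩ := H
  have h1 := Finset.card_filter_add_card_filter_not (s := G.edgeFinset)
    (fun e => ∀ v ∈ e, v ∉ Q)
  have h2 := (card_edges_meeting_le (G := G) Q).trans (Nat.mul_le_mul_right _ hQ)
  have h3 : (G.edgeFinset.filter fun e => ∀ v ∈ e, v ∉ Q).card ≤ A.card * Aᶜ.card := by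
    rw [← Finset.card_product]
    refine (Finset.card_le_card (t := (A ×ˢ Aᶜ).image fun p => s(p.1, p.2)) ?_).trans
      Finset.card_image_le
    intro e he
    rw [Finset.mem_filter] at he
    induction e with | _ u v
    have huv : G.Adj u v := by simpa using he.1
    have := hA (he.2 u (by simp)) (he.2 v (by simp))
    simp only [Finset.mem_image, Finset.mem_product, Finset.mem_compl, Prod.exists]
    by_cases hu : u ∈ A
    · exact ⟨u, v, ⟨hu, by tauto⟩, rfl⟩
    · exact ⟨v, u, ⟨by tauto, hu⟩, Sym2.eq_swap⟩
  have h4 := Finset.card_add_card_compl A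
  rw [← h4] at h2 ⊢
  nlinarith [four_mul_le_sq_add A.card Aᶜ.card]

theorem NearlyBipartite.of_comap {G : SimpleGraph V} {q : ℕ} {S : Finset V}
    (H : NearlyBipartite (G.comap (Function.Embedding.subtype (· ∈ S))) q) :
    NearlyBipartite G (q + Sᶜ.card) := by
  obtain ⟨Q, A, hQ, hA⟩ := H
  refine ⟨Q.map (Function.Embedding.subtype _) ∪ Sᶜ, A.map (Function.Embedding.subtype _),
    (Finset.card_union_le _ _).trans (by simpa using hQ), ?_⟩
  intro a b ha hb hab hadj
  simp only [Finset.mem_union, Finset.mem_map, Function.Embedding.coe_subtype, Subtype.exists,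
    exists_and_right, exists_eq_right, Finset.mem_compl, not_or, not_exists, not_not] at ha hb hab
  refine hA (a := ⟨a, ha.2⟩) (b := ⟨b, hb.2⟩) (ha.1 ha.2) (hb.1 hb.2) ?_ hadj
  constructor
  · intro h; obtain ⟨_, h'⟩ := hab.1 ⟨ha.2, h⟩; exact h'
  · intro h; obtain ⟨_, h'⟩ := hab.2 ⟨hb.2, h⟩; exact h'

theorem NearlyBipartite.comap {V : Type*} [DecidableEq V] {G : SimpleGraph V} {q : ℕ} (H : NearlyBipartite G q)
    (S : Finset V) : NearlyBipartite (G.comap (Function.Embedding.subtype (· ∈ S))) q := by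
  obtain ⟨Q, A, hQ, hA⟩ := H
  refine ⟨Q.subtype _, A.subtype _, ?_, ?_⟩
  · rw [Finset.card_subtype]
    exact (Finset.card_filter_le _ _).trans hQ
  · intro a b ha hb hab hadj
    simp only [Finset.mem_subtype] at ha hb hab
    exact hA ha hb hab hadj

end Transfer

section Extremal

variable {V : Type*} [Fintype V] [DecidableEq V]

theorem LinkedAvoiding.symm {V : Type*} {G : SimpleGraph V} {X : Finset V} {l : ℕ} {a b : V}
    (h : LinkedAvoiding G X l a b) : LinkedAvoiding G X l b a := by
  obtain ⟨p, hp, hl, hX⟩ := h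
  exact ⟨p.reverse, hp.reverse, by simpa using hl, by simpa using hX⟩

/-- A dense graph which is bipartite with parts `A` and `B` up to the few vertices of `P`. -/
structure NearExtremal (G : SimpleGraph V) [DecidableRel G.Adj] (k : ℕ) (A B P : Finset V) :
    Prop where
  cover : ∀ w, w ∈ A ∨ w ∈ B ∨ w ∈ P
  card_add_le : A.card + B.card ≤ Fintype.card V
  left : ∀ ⦃a b⦄, a ∈ A → b ∈ A → ¬ G.Adj a b
  right : ∀ ⦃a b⦄, a ∈ B → b ∈ B → ¬ G.Adj a b
  degree : ∀ v, 485 * Fintype.card V ≤ 1000 * G.degree v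
  small : 200 * P.card ≤ Fintype.card V
  large : 20 * (2 * k + 20) ≤ Fintype.card V

namespace NearExtremal

variable {G : SimpleGraph V} [DecidableRel G.Adj] {k : ℕ} {A B P : Finset V} {χ : Sym2 V → ℕ}

theorem symm {V : Type*} [Fintype V] {G : SimpleGraph V} [DecidableRel G.Adj] {k : ℕ}
    {A B P : Finset V} (H : NearExtremal G k A B P) : NearExtremal G k B A P where
  cover w := by have := H.cover w; tauto
  card_add_le := by rw [add_comm]; exact H.card_add_le
  left := H.right
  right := H.left
  degree := H.degree
  small := H.small
  large := H.large

theorem card_inter_add_card_inter (H : NearExtremal G k A B P) (w : V) :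
    480 * Fintype.card V ≤
      1000 * ((G.neighborFinset w ∩ A).card + (G.neighborFinset w ∩ B).card) := by
  have h1 : G.neighborFinset w ⊆ (G.neighborFinset w ∩ A) ∪ ((G.neighborFinset w ∩ B) ∪ P) := by
    intro x hx
    have := H.cover x
    simp only [Finset.mem_union, Finset.mem_inter]
    tauto
  have h2 := (Finset.card_le_card h1).trans ((Finset.card_union_le _ _).trans
    (Nat.add_le_add_left (Finset.card_union_le _ _) _))
  rw [card_neighborFinset_eq_degree] at h2
  have h3 := H.degree w
  have h4 := H.small
  omega

theorem card_inter_right (H : NearExtremal G k A B P) {a : V} (ha : a ∈ A) :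
    480 * Fintype.card V ≤ 1000 * (G.neighborFinset a ∩ B).card := by
  have h1 := H.card_inter_add_card_inter a
  have h2 : G.neighborFinset a ∩ A = ∅ := by
    ext x
    simp only [Finset.mem_inter, mem_neighborFinset, Finset.notMem_empty, iff_false, not_and]
    exact fun h1 h2 => H.left ha h2 h1
  rw [h2, Finset.card_empty, zero_add] at h1
  exact h1

theorem card_right_ge (H : NearExtremal G k A B P) : 480 * Fintype.card V ≤ 1000 * B.card := by
  have hne : ∀ {A B : Finset V}, NearExtremal G k A B P → ∀ a ∈ A,
      480 * Fintype.card V ≤ 1000 * B.card := fun H a ha =>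
    (H.card_inter_right ha).trans
      (Nat.mul_le_mul_left _ (Finset.card_le_card Finset.inter_subset_right))
  have hl := H.large
  obtain ⟨w, -, hw⟩ := Finset.exists_mem_notMem_of_card_lt_card (s := P)
    (t := (Finset.univ : Finset V)) (by have := H.small; rw [Finset.card_univ]; omega)
  rcases H.cover w with h | h | h
  · exact hne H w h
  · have h1 := hne H.symm w h
    obtain ⟨a, ha⟩ := Finset.card_pos.1 (show 0 < A.card by omega)
    exact hne H a ha
  · exact absurd h hw

theorem le_codeg (H : NearExtremal G k A B P) {a u : V} (ha : a ∈ A)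
    (hu : Fintype.card V ≤ 10 * (G.neighborFinset u ∩ B).card) :
    Fintype.card V ≤ 20 * codeg G a u := by
  have h1 := H.card_inter_right ha
  have h2 := H.symm.card_right_ge
  have h3 := H.card_add_le
  have h4 := Finset.card_union_add_card_inter (G.neighborFinset a ∩ B) (G.neighborFinset u ∩ B)
  have h5 : (G.neighborFinset a ∩ B ∪ G.neighborFinset u ∩ B).card ≤ B.card :=
    Finset.card_le_card (Finset.union_subset Finset.inter_subset_right Finset.inter_subset_right)
  have h6 : (G.neighborFinset a ∩ B ∩ (G.neighborFinset u ∩ B)).card ≤ codeg G a u :=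
    Finset.card_le_card (Finset.inter_subset_inter Finset.inter_subset_left
      Finset.inter_subset_left)
  omega

theorem le_codeg_self (H : NearExtremal G k A B P) {a a' : V} (ha : a ∈ A) (ha' : a' ∈ A) :
    Fintype.card V ≤ 20 * codeg G a a' :=
  H.le_codeg ha (by have := H.card_inter_right ha'; omega)

theorem exists_adj_left (H : NearExtremal G k A B P) {b : V} (hb : b ∈ B) {X : Finset V}
    (hX : X.card ≤ 8) : ∃ a ∈ A, G.Adj b a ∧ a ∉ X := by
  have h1 := H.symm.card_inter_right hb
  have h2 := H.large
  obtain ⟨w, hw, hwX⟩ := Finset.exists_mem_notMem_of_card_lt_card (s := X)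
    (t := G.neighborFinset b ∩ A) (by omega)
  simp only [Finset.mem_inter, mem_neighborFinset] at hw
  exact ⟨w, hw.2, hw.1, hwX⟩

theorem exists_common (H : NearExtremal G k A B P) {a b : V} {X : Finset V} (hX : X.card ≤ 8)
    (h : Fintype.card V ≤ 20 * codeg G a b) : ∃ w, G.Adj a w ∧ G.Adj w b ∧ w ∉ X := by
  have h2 := H.large
  exact exists_common_neighbor (by omega)

/-- An edge whose ends both see much of `B` provides odd paths between vertices of `A`. -/
theorem linked_odd (H : NearExtremal G k A B P) {u v : V} (huv : G.Adj u v)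
    (hu : Fintype.card V ≤ 10 * (G.neighborFinset u ∩ B).card)
    (hv : Fintype.card V ≤ 10 * (G.neighborFinset v ∩ B).card) {j : ℕ} (hj : j ≤ k)
    {X : Finset V} (hX : X.card ≤ 4) (huX : u ∉ X) (hvX : v ∉ X) {a a' : V} (ha : a ∈ A)
    (ha' : a' ∈ A) (haX : a ∉ X) (haX' : a' ∉ X) (haa : a ≠ a') (hau : a ≠ u) (hav : a ≠ v)
    (hau' : a' ≠ u) (hav' : a' ≠ v) :
    LinkedAvoiding G X (2 * (j + 1) + 1 + 1 + 1) a a' := by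
  have hl := H.large
  obtain ⟨w, haw, hwu, hw⟩ := H.exists_common (X := insert v (insert a' X))
    ((Finset.card_insert_le _ _).trans (by have := Finset.card_insert_le a' X; omega))
    (H.le_codeg ha hu)
  simp only [Finset.mem_insert, not_or] at hw
  have e1 := haw.ne
  have e2 := hwu.ne
  have e3 := huv.ne
  refine .cons haw haX (.cons hwu (by simp; tauto) (.cons huv (by simp; tauto) ?_))
  have hc := H.le_codeg ha' hv
  rw [codeg_comm] at hc
  refine linkedAvoiding_even (r := Fintype.card V / 20)
    (fun v => by have := H.degree v; omega) j _ _ _ hav'.symm (by simp; grind) (by simp; grind)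
    (by omega) ?_
  have c1 := Finset.card_insert_le a X
  have c2 := Finset.card_insert_le w (insert a X)
  have c3 := Finset.card_insert_le u (insert w (insert a X))
  omega

theorem color_ne (H : NearExtremal G k A B P) (hk : 4 ≤ k)
    (hχ : RainbowCycles G χ (2 * k + 1)) {u v : V} (huv : G.Adj u v)
    (hu : Fintype.card V ≤ 10 * (G.neighborFinset u ∩ B).card)
    (hv : Fintype.card V ≤ 10 * (G.neighborFinset v ∩ B).card)
    {a b a' b' : V} (ha : a ∈ A) (hb : b ∈ B) (ha' : a' ∈ A) (hb' : b' ∈ B) (hab : G.Adj a b)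
    (hab' : G.Adj a' b') (hne : a ≠ a' ∨ b ≠ b') (hau : a ≠ u) (hav : a ≠ v)
    (hau' : a' ≠ u) (hav' : a' ≠ v) (hbu : b ≠ u) (hbv : b ≠ v) (hbu' : b' ≠ u) (hbv' : b' ≠ v) :
    χ s(a, b) ≠ χ s(a', b') := by
  have hAB : ∀ {x y}, x ∈ A → y ∈ B → x ≠ y := by
    rintro x _ hx hy rfl
    obtain ⟨w, hw, hxw, -⟩ := H.exists_adj_left hy (X := ∅) (by simp)
    exact H.left hx hw hxw
  have e1 := hAB ha hb
  have e2 := hAB ha hb'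
  have e3 := hAB ha' hb
  have e4 := hAB ha' hb'
  by_cases hbb : b = b'
  · subst hbb
    have haa : a ≠ a' := by tauto
    rw [Sym2.eq_swap, Sym2.eq_swap (a := a')]
    exact hχ.ne_of_share hab.symm hab'.symm (H.linked_odd huv hu hv (j := k - 3) (by omega)
      (by simp) (by simp; tauto) (by simp; tauto) ha' ha (by simp; tauto) (by simp; tauto)
      haa.symm hau' hav' hau hav) (by omega) haa
  by_cases haa : a = a'
  · subst haa
    obtain ⟨c, hc, hbc, hcX⟩ := H.exists_adj_left hb (X := {a, u, v})
      (Finset.card_le_three.trans (by norm_num))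
    obtain ⟨c', hc', hbc', hcX'⟩ := H.exists_adj_left hb' (X := {a, u, v, c})
      (Finset.card_le_four.trans (by norm_num))
    simp only [Finset.mem_insert, Finset.mem_singleton, not_or] at hcX hcX'
    have f1 := hAB hc hb
    have f2 := hAB hc hb'
    have f3 := hAB hc' hb
    have f4 := hAB hc' hb'
    refine hχ.ne_of_share hab hab' (l := 2 * (k - 4 + 1) + 1 + 1 + 1 + 1 + 1)
      (.cons hbc' (by simp; tauto)
      (LinkedAvoiding.symm (.cons hbc (by simp; tauto) ?_))) (by omega) hbb
    exact H.linked_odd huv hu hv (by omega) (Finset.card_le_three.trans (by norm_num))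
      (by simp; grind) (by simp; grind) hc hc' (by simp; grind) (by simp; grind) (by grind)
      (by grind) (by grind) (by grind) (by grind)
  · obtain ⟨z, hbz, hzb, hz⟩ := H.exists_common (X := {a, a', u, v})
      (Finset.card_le_four.trans (by norm_num)) (H.symm.le_codeg_self hb hb')
    simp only [Finset.mem_insert, Finset.mem_singleton, not_or] at hz
    rw [Sym2.eq_swap (a := a')]
    refine hχ.ne_of_disjoint hab hbz hzb hab'.symm hbb (H.linked_odd huv hu hv (j := k - 4)
      (by omega) (Finset.card_le_three.trans (by norm_num)) (by simp; grind) (by simp; grind)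
      ha' ha (by simp; grind) (by simp; grind) (Ne.symm haa) hau' hav' hau hav) (by omega)

theorem injOn (H : NearExtremal G k A B P) (hk : 4 ≤ k)
    (hχ : RainbowCycles G χ (2 * k + 1)) {u v : V} (huv : G.Adj u v)
    (hu : Fintype.card V ≤ 10 * (G.neighborFinset u ∩ B).card)
    (hv : Fintype.card V ≤ 10 * (G.neighborFinset v ∩ B).card) :
    Set.InjOn χ (G.edgeFinset.filter fun e => ∀ x ∈ e, x ∉ insert u (insert v P)) := by
  have hrep : ∀ e ∈ G.edgeFinset.filter (fun e => ∀ x ∈ e, x ∉ insert u (insert v P)),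
      ∃ a b, e = s(a, b) ∧ a ∈ A ∧ b ∈ B ∧ G.Adj a b ∧ a ≠ u ∧ a ≠ v ∧ b ≠ u ∧ b ≠ v := by
    intro e he
    rw [Finset.mem_filter] at he
    induction e with | _ x y
    have hxy : G.Adj x y := by simpa using he.1
    have hx := he.2 x (by simp)
    have hy := he.2 y (by simp)
    simp only [Finset.mem_insert, not_or] at hx hy
    rcases H.cover x with h1 | h1 | h1
    · rcases H.cover y with h2 | h2 | h2
      · exact absurd hxy (H.left h1 h2)
      · exact ⟨x, y, rfl, h1, h2, hxy, hx.1, hx.2.1, hy.1, hy.2.1⟩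
      · exact absurd h2 hy.2.2
    · rcases H.cover y with h2 | h2 | h2
      · exact ⟨y, x, Sym2.eq_swap, h2, h1, hxy.symm, hy.1, hy.2.1, hx.1, hx.2.1⟩
      · exact absurd hxy (H.right h1 h2)
      · exact absurd h2 hy.2.2
    · exact absurd h1 hx.2.2
  intro e he e' he' hee
  obtain ⟨a, b, rfl, ha, hb, hab, h1, h2, h3, h4⟩ := hrep e he
  obtain ⟨a', b', rfl, ha', hb', hab', h1', h2', h3', h4'⟩ := hrep e' he'
  by_contra hne
  refine H.color_ne hk hχ huv hu hv ha hb ha' hb' hab hab' ?_ h1 h2 h1' h2' h3 h4 h3' h4' hee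
  by_contra! h
  exact hne (by rw [h.1, h.2])

theorem card_colors_ge_of_adj (H : NearExtremal G k A B P) (hk : 4 ≤ k)
    (hχ : RainbowCycles G χ (2 * k + 1)) {u v : V} (huv : G.Adj u v)
    (hu : Fintype.card V ≤ 10 * (G.neighborFinset u ∩ B).card)
    (hv : Fintype.card V ≤ 10 * (G.neighborFinset v ∩ B).card) :
    G.edgeFinset.card ≤ (G.edgeFinset.image χ).card + (P.card + 2) * Fintype.card V := by
  have h1 := Finset.card_image_of_injOn (H.injOn hk hχ huv hu hv)
  have h2 : (insert u (insert v P)).card ≤ P.card + 2 :=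
    (Finset.card_insert_le _ _).trans (Nat.succ_le_succ (Finset.card_insert_le _ _))
  have h3 := (card_edges_meeting_le (G := G) (insert u (insert v P))).trans
    (Nat.mul_le_mul_right _ h2)
  have h4 := Finset.card_filter_add_card_filter_not (s := G.edgeFinset)
    (fun e => ∀ x ∈ e, x ∉ insert u (insert v P))
  have h5 := Finset.card_le_card (Finset.image_subset_image (f := χ)
    (Finset.filter_subset (fun e => ∀ x ∈ e, x ∉ insert u (insert v P)) G.edgeFinset))
  omega

theorem card_colors_ge (H : NearExtremal G k A B P) (hk : 4 ≤ k)
    (hχ : RainbowCycles G χ (2 * k + 1)) (he : Fintype.card V ^ 2 < 4 * G.edgeFinset.card) :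
    G.edgeFinset.card ≤ (G.edgeFinset.image χ).card + (P.card + 2) * Fintype.card V := by
  by_cases h1 : ∃ u v, G.Adj u v ∧ Fintype.card V ≤ 10 * (G.neighborFinset u ∩ B).card ∧
      Fintype.card V ≤ 10 * (G.neighborFinset v ∩ B).card
  · obtain ⟨u, v, huv, hu, hv⟩ := h1
    exact H.card_colors_ge_of_adj hk hχ huv hu hv
  by_cases h2 : ∃ u v, G.Adj u v ∧ Fintype.card V ≤ 10 * (G.neighborFinset u ∩ A).card ∧
      Fintype.card V ≤ 10 * (G.neighborFinset v ∩ A).card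
  · obtain ⟨u, v, huv, hu, hv⟩ := h2
    exact H.symm.card_colors_ge_of_adj hk hχ huv hu hv
  exfalso
  push Not at h1 h2
  have hB : NearlyBipartite G 0 := by
    refine ⟨∅, Finset.univ.filter fun w =>
      Fintype.card V ≤ 10 * (G.neighborFinset w ∩ B).card, by simp, ?_⟩
    intro a b _ _ hab hadj
    simp only [Finset.mem_filter, Finset.mem_univ, true_and] at hab
    have h3 := h1 a b hadj
    have h4 := h2 a b hadj
    have h5 := H.card_inter_add_card_inter a
    have h6 := H.card_inter_add_card_inter b
    omega
  have := hB.card_edges_le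
  omega

end NearExtremal
end Extremal

section LowerBound

theorem mul_le_mul_of_mul_le {s d : ℕ} (h : (49 / 100 : ℝ) * (2 * s - 1) ≤ 2 * (d : ℝ))
    (hs : 49 ≤ s) : 485 * s ≤ 1000 * d := by
  have h1 : (49 : ℝ) ≤ s := by exact_mod_cast hs
  have h2 : (485 : ℝ) * s ≤ 1000 * d := by linarith
  exact_mod_cast h2

theorem add_le_mul_of_mul_le {K q s d : ℕ} {x : ℝ} (hxK : x * K = 1) (hx : 0 < x)
    (hx1 : x ≤ 1 / 12) (hq : 16 * K ^ 2 * q ≤ s) (hq1 : 1 ≤ K * q)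
    (h : (1 / 3 + x) * (2 * s - 1) ≤ 2 * (d : ℝ)) : s + 5 * (6 * K * q) ≤ 3 * d := by
  have h2 : 16 * (K : ℝ) * q ≤ x * s := by
    have : 16 * (K : ℝ) ^ 2 * q ≤ s := by exact_mod_cast hq
    calc 16 * (K : ℝ) * q = x * (16 * K ^ 2 * q) := by linear_combination (-16 * K * q) * hxK
      _ ≤ x * s := by gcongr
  have h3 : (1 : ℝ) ≤ K * q := by exact_mod_cast hq1
  have h4 : (s : ℝ) + 5 * (6 * K * q) ≤ 3 * d := by linarith
  exact_mod_cast h4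

theorem two_mul_add_lt {K q s : ℕ} (hK : 12 ≤ K) (hq : 28 ≤ q) (hs : s < 16 * K ^ 2 * (q + 1)) :
    2 * (s * q) + 4 * (6 * K * q) < (6 * K * q) * (6 * K * q) := by
  have h1 : s * q ≤ 16 * K ^ 2 * (q + 1) * q := Nat.mul_le_mul_right q hs.le
  have h2 : 12 * (K * q) ≤ K * (K * q) := Nat.mul_le_mul_right _ hK
  have h3 : 28 * (K ^ 2 * q) ≤ q * (K ^ 2 * q) := Nat.mul_le_mul_right _ hq
  have h4 : 0 < K ^ 2 * q := by positivity
  linarith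

variable {V : Type*} [Fintype V] [DecidableEq V] {G : SimpleGraph V} [DecidableRel G.Adj]
  {χ : Sym2 V → ℕ} {k : ℕ}

theorem NearlyBipartite.card_colors_ge {p : ℕ} (H : NearlyBipartite G p) (hk : 4 ≤ k)
    (hχ : RainbowCycles G χ (2 * k + 1)) (he : Fintype.card V ^ 2 < 4 * G.edgeFinset.card)
    (hn : 300 * p + 20 * (2 * k + 20) ≤ Fintype.card V) :
    (Fintype.card V : ℝ) ^ 2 / 4 - (51 * p + 2) * Fintype.card V ≤
      ((G.edgeFinset.image χ).card : ℝ) := by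
  classical
  obtain ⟨S, hS⟩ := exists_dense_subset G (l := 49 / 100)
  obtain ⟨F, hF⟩ : ∃ F, F = G.comap (Function.Embedding.subtype (· ∈ S)) := ⟨_, rfl⟩
  obtain ⟨hS1, hS2⟩ := hS F hF
  have hcol := card_image_comap_le G χ (Function.Embedding.subtype (· ∈ S)) hF
  have hFχ := hχ.comap (Function.Embedding.subtype (· ∈ S))
  have hFB := H.comap S
  rw [← hF] at hFχ hFB
  have hFe := hFB.card_edges_le
  have hcS : Fintype.card S = S.card := Fintype.card_coe S
  have hSn : S.card ≤ Fintype.card V := Finset.card_le_univ S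
  rw [hcS] at hFe
  generalize hs : S.card = s at *
  generalize hn' : Fintype.card V = n at *
  have heR : (n : ℝ) ^ 2 < 4 * G.edgeFinset.card := by exact_mod_cast he
  have hFeR : 4 * (F.edgeFinset.card : ℝ) ≤ s ^ 2 + 4 * (p * s) := by exact_mod_cast hFe
  have hSnR : (s : ℝ) ≤ n := by exact_mod_cast hSn
  have hsn : n ≤ s + 100 * p := by
    have : (n : ℝ) ^ 2 ≤ (s + 100 * p) ^ 2 := by nlinarith [sq_nonneg (p : ℝ)]
    have := (pow_le_pow_iff_left₀ (by positivity) (by positivity) two_ne_zero).1 this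
    exact_mod_cast this
  have hFe2R : (s : ℝ) ^ 2 < 4 * F.edgeFinset.card := by nlinarith
  have hFe2 : Fintype.card S ^ 2 < 4 * F.edgeFinset.card := by
    rw [hcS]; exact_mod_cast hFe2R
  obtain ⟨P, A, hP, hA⟩ := hFB
  have hE : NearExtremal F k (A \ P) (Aᶜ \ P) P := by
    refine ⟨fun w => ?_, ?_, ?_, ?_, fun v => ?_, ?_, ?_⟩
    · simp only [Finset.mem_sdiff, Finset.mem_compl]; tauto
    · rw [← Finset.card_add_card_compl A]
      exact add_le_add (Finset.card_le_card Finset.sdiff_subset)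
        (Finset.card_le_card Finset.sdiff_subset)
    · intro a b ha hb
      simp only [Finset.mem_sdiff] at ha hb
      exact hA ha.2 hb.2 (by tauto)
    · intro a b ha hb
      simp only [Finset.mem_sdiff, Finset.mem_compl] at ha hb
      exact hA ha.2 hb.2 (by tauto)
    · rw [hcS]
      exact mul_le_mul_of_mul_le (hS2 v) (by omega)
    · rw [hcS]
      exact Nat.le_of_add_le_add_right (b := 100 * p) (by linarith)
    · rw [hcS]
      exact Nat.le_of_add_le_add_right (b := 100 * p) (by linarith)
  have h1 := hE.card_colors_ge hk hFχ hFe2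
  have h2 : F.edgeFinset.card ≤ (G.edgeFinset.image χ).card + (p + 2) * s := by
    rw [hcS] at h1
    have := Nat.mul_le_mul_right s (Nat.add_le_add_right hP 2)
    omega
  have h2R : (F.edgeFinset.card : ℝ) ≤ (G.edgeFinset.image χ).card + (p + 2) * s := by
    exact_mod_cast h2
  have hsnR : (n : ℝ) ≤ s + 100 * p := by exact_mod_cast hsn
  have hpn : 200 * (p : ℝ) ≤ s := by
    have : 200 * p ≤ s := by omega
    exact_mod_cast this
  nlinarith

/-- A graph with more than `n²/4` edges all of whose `(2k+1)`-cycles are rainbow has almost `n²/8`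
colours. -/
theorem card_colors_ge_of_card_sq_lt (hk : 4 ≤ k) {K : ℕ} (hK : 12 ≤ K)
    (hχ : RainbowCycles G χ (2 * k + 1)) (he : Fintype.card V ^ 2 < 4 * G.edgeFinset.card)
    (hn : 64 * K ^ 2 * (2 * k + 20) ≤ Fintype.card V) (hn' : 50000 ≤ Fintype.card V)
    (hn'' : 300 * 104 + 20 * (2 * k + 20) ≤ Fintype.card V) :
    (Fintype.card V : ℝ) ^ 2 / 8 - 3 / (4 * K) * (Fintype.card V : ℝ) ^ 2 -
      4 * Fintype.card V ≤ ((G.edgeFinset.image χ).card : ℝ) := by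
  classical
  have hK0 : (0 : ℝ) < K := by positivity
  have hK12 : (12 : ℝ) ≤ K := by exact_mod_cast hK
  obtain ⟨x, hx⟩ : ∃ x : ℝ, x = 1 / K := ⟨_, rfl⟩
  have hxK : x * K = 1 := by rw [hx]; field_simp
  have hx0 : 0 < x := by rw [hx]; positivity
  have hx12 : x ≤ 1 / 12 := by nlinarith
  obtain ⟨S, hS⟩ := exists_dense_subset G (l := 1 / 3 + x)
  obtain ⟨F, hF⟩ : ∃ F, F = G.comap (Function.Embedding.subtype (· ∈ S)) := ⟨_, rfl⟩
  obtain ⟨hS1, hS2⟩ := hS F hF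
  have hcol := card_image_comap_le G χ (Function.Embedding.subtype (· ∈ S)) hF
  have hFχ := hχ.comap (Function.Embedding.subtype (· ∈ S))
  rw [← hF] at hFχ
  have hcS : Fintype.card S = S.card := Fintype.card_coe S
  have hSn : S.card ≤ Fintype.card V := Finset.card_le_univ S
  have hSc : Sᶜ.card = Fintype.card V - S.card := Finset.card_compl S
  have hF2 : 2 * F.edgeFinset.card ≤ Fintype.card S ^ 2 := by
    rw [← F.sum_degrees_eq_twice_card_edges, sq]
    exact (Finset.sum_le_card_nsmul _ _ _ fun v _ => (F.degree_lt_card_verts v).le).trans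
      (by simp)
  rw [hcS] at hF2
  have hF2R : 2 * (F.edgeFinset.card : ℝ) ≤ (S.card : ℝ) ^ 2 := by exact_mod_cast hF2
  have heR : (Fintype.card V : ℝ) ^ 2 < 4 * G.edgeFinset.card := by exact_mod_cast he
  have hSnR : (S.card : ℝ) ≤ Fintype.card V := by exact_mod_cast hSn
  have hB : ∀ p, NearlyBipartite F p → NearlyBipartite G (p + (Fintype.card V - S.card)) := by
    intro p hp
    rw [hF] at hp
    simpa [hSc] using hp.of_comap
  clear hS
  generalize hs : S.card = s at *
  generalize hnn : Fintype.card V = n at *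
  have h4s : n ≤ 4 * s := by
    have : (n : ℝ) ^ 2 ≤ (4 * s) ^ 2 := by nlinarith [sq_nonneg (s : ℝ), sq_nonneg (n : ℝ)]
    have := (pow_le_pow_iff_left₀ (by positivity) (by positivity) two_ne_zero).1 this
    exact_mod_cast this
  obtain ⟨q, hq⟩ : ∃ q, q = s / (16 * K ^ 2) := ⟨_, rfl⟩
  have hKK : 0 < 16 * K ^ 2 := by positivity
  have hq1 : 16 * K ^ 2 * q ≤ s := by rw [hq]; exact Nat.mul_div_le _ _
  have hq2 : s < 16 * K ^ 2 * (q + 1) := by rw [hq]; exact Nat.lt_mul_div_succ _ hKK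
  have hq3 : 2 * k + 20 ≤ q := by
    rw [hq, Nat.le_div_iff_mul_le hKK]
    nlinarith
  have hL : LargeDegrees F k q (6 * K * q) := by
    refine ⟨fun v => ?_, ?_, ?_, ?_⟩
    · rw [hcS]
      exact add_le_mul_of_mul_le hxK hx0 hx12 hq1 (Nat.mul_pos (by omega) (by omega)) (hS2 v)
    · rw [hcS]
      exact two_mul_add_lt hK (by omega) hq2
    · exact Nat.mul_le_mul_right q (show 4 ≤ 6 * K by omega)
    · exact hq3
  have hcolR : ((F.edgeFinset.image fun e => χ (e.map (Function.Embedding.subtype (· ∈ S)))).card : ℝ)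
      ≤ (G.edgeFinset.image χ).card := by exact_mod_cast hcol
  have hdiv : 3 / (4 * (K : ℝ)) = 3 / 4 * x := by rw [hx]; field_simp
  rw [hdiv]
  rcases hL.farPairs_or_nearlyBipartite hk hFχ with ⟨Q, hQ, hfar⟩ | hbip
  · have h1 := hfar.card_colors_ge (fun v => by have := hL.degree v; omega)
      (by have := hL.eighty_le; omega) hQ
    rw [hcS] at h1
    have h2 : ((6 * K * q : ℕ) : ℝ) ≤ x * s := by
      have : 16 * (K : ℝ) ^ 2 * q ≤ s := by exact_mod_cast hq1
      push_cast
      calc 6 * (K : ℝ) * q ≤ 16 * (K : ℝ) * q := by gcongr; norm_num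
        _ = x * (16 * K ^ 2 * q) := by linear_combination (-16 * K * q) * hxK
        _ ≤ x * s := by gcongr
    have h3 : (s : ℝ) * (6 * K * q : ℕ) ≤ x * s ^ 2 := by nlinarith
    nlinarith [mul_nonneg hx0.le (sq_nonneg (s : ℝ))]
  · have h1 := hbip.card_edges_le
    rw [hcS] at h1
    have h1R : 4 * (F.edgeFinset.card : ℝ) ≤ s ^ 2 + 4 * (8 * s) := by exact_mod_cast h1
    have h2 : n ≤ s + 96 := by
      have h0 : 0 ≤ (1 / 12 - x) * ((n : ℝ) ^ 2 - s ^ 2) :=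
        mul_nonneg (by linarith) (sub_nonneg.2 (by gcongr))
      have : (n : ℝ) ^ 2 ≤ (s + 96) ^ 2 := by linarith
      have := (pow_le_pow_iff_left₀ (by positivity) (by positivity) two_ne_zero).1 this
      exact_mod_cast this
    have h3 := ((hB 8 hbip).mono (show _ ≤ 104 by omega)).card_colors_ge hk hχ
      (by rw [hnn]; exact he) (by rw [hnn]; exact hn'')
    rw [hnn] at h3
    have hn'R : (50000 : ℝ) ≤ n := by exact_mod_cast hn'
    push_cast at h3
    linarith [mul_nonneg hx0.le (sq_nonneg (n : ℝ)),
      mul_nonneg (sub_nonneg.2 hn'R) (Nat.cast_nonneg (α := ℝ) n)]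

end LowerBound

section UpperBound

/-- The disjoint union of a clique on the vertices below `a` and a clique on the other ones. -/
def twoCliques (n a : ℕ) : SimpleGraph (Fin n) where
  Adj u v := u ≠ v ∧ (u.1 < a ↔ v.1 < a)
  symm := ⟨fun _ _ h => ⟨h.1.symm, h.2.symm⟩⟩
  loopless := ⟨fun _ h => h.1 rfl⟩

/-- The position of a vertex of `twoCliques n a` within its clique. -/
def cliquePos (a u : ℕ) : ℕ := if u < a then u else u - a

theorem cliquePos_injOn {a u v : ℕ} (h : u < a ↔ v < a) (huv : cliquePos a u = cliquePos a v) :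
    u = v := by
  unfold cliquePos at huv
  split_ifs at huv <;> omega

theorem twoCliques_walk_side {n a : ℕ} {u v x : Fin n} (w : (twoCliques n a).Walk u v)
    (hx : x ∈ w.support) : x.1 < a ↔ u.1 < a := by
  induction w with
  | nil => simp at hx; rw [hx]
  | cons h p ih =>
    rw [Walk.support_cons, List.mem_cons] at hx
    rcases hx with rfl | hx
    · rfl
    · rw [ih hx]; exact h.2.symm

theorem twoCliques_rainbow {n a L : ℕ} {f : Sym2 ℕ → ℕ} (hf : f.Injective) :
    ∀ ⦃v : Fin n⦄ (w : (twoCliques n a).Walk v v), w.IsCycle → w.length = L →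
      (w.edges.map fun e => f (e.map fun u : Fin n => cliquePos a u)).Nodup := by
  intro v w hw _
  refine List.Nodup.map_on ?_ hw.edges_nodup
  intro e he e' he' hee
  induction e with | _ x y
  induction e' with | _ x' y'
  have h1 := twoCliques_walk_side w (w.fst_mem_support_of_mem_edges he)
  have h2 := twoCliques_walk_side w (w.snd_mem_support_of_mem_edges he)
  have h3 := twoCliques_walk_side w (w.fst_mem_support_of_mem_edges he')
  have h4 := twoCliques_walk_side w (w.snd_mem_support_of_mem_edges he')
  have hee : s(cliquePos a x, cliquePos a y) = s(cliquePos a x', cliquePos a y') := hf hee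
  rw [Sym2.eq_iff] at hee ⊢
  rcases hee with ⟨h5, h6⟩ | ⟨h5, h6⟩
  · exact .inl ⟨Fin.ext (cliquePos_injOn (h1.trans h3.symm) h5),
      Fin.ext (cliquePos_injOn (h2.trans h4.symm) h6)⟩
  · exact .inr ⟨Fin.ext (cliquePos_injOn (h1.trans h4.symm) h5),
      Fin.ext (cliquePos_injOn (h2.trans h3.symm) h6)⟩

theorem twoCliques_card_image_le {n a : ℕ} (hna : n ≤ 2 * a) (f : Sym2 ℕ → ℕ) :
    ((fun e : Sym2 (Fin n) => f (e.map fun u : Fin n => cliquePos a u)) ''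
      (twoCliques n a).edgeSet).ncard ≤ a.choose 2 := by
  have h : ((fun e : Sym2 (Fin n) => f (e.map fun u : Fin n => cliquePos a u)) ''
      (twoCliques n a).edgeSet) ⊆
      ((⊤ : SimpleGraph (Fin a)).edgeFinset.image fun e => f (e.map fun u : Fin a => u.1) : Finset ℕ) := by
    rintro _ ⟨e, he, rfl⟩
    induction e with | _ x y
    rw [mem_edgeSet] at he
    have hpos : ∀ u : Fin n, cliquePos a u < a := by
      intro u
      have := u.2
      unfold cliquePos
      split_ifs <;> omega
    refine Finset.mem_coe.2 (Finset.mem_image.2 ⟨s(⟨_, hpos x⟩, ⟨_, hpos y⟩), ?_, rfl⟩)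
    rw [mem_edgeFinset, mem_edgeSet, top_adj, Ne, Fin.mk.injEq]
    exact fun hxy => he.1 (Fin.ext (cliquePos_injOn he.2 hxy))
  refine (Set.ncard_le_ncard h (Finset.finite_toSet _)).trans ?_
  rw [Set.ncard_coe_finset]
  refine Finset.card_image_le.trans ?_
  rw [card_edgeFinset_top_eq_card_choose_two, Fintype.card_fin]

theorem twoCliques_card_edges {a b : ℕ} :
    a * a + b * b ≤ 2 * (twoCliques (a + b) a).edgeSet.ncard + (a + b) := by
  classical
  rw [← coe_edgeFinset, Set.ncard_coe_finset, ← sum_degrees_eq_twice_card_edges]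
  have hd : ∀ v, (twoCliques (a + b) a).degree v + 1 =
      (Finset.univ.filter fun u : Fin (a + b) => u.1 < a ↔ v.1 < a).card := by
    intro v
    rw [← card_neighborFinset_eq_degree, ← Finset.card_erase_add_one (a := v)
      (s := Finset.univ.filter fun u : Fin (a + b) => u.1 < a ↔ v.1 < a) (by simp)]
    congr 2
    ext u
    simp only [mem_neighborFinset, Finset.mem_erase, Finset.mem_filter, Finset.mem_univ, true_and]
    exact ⟨fun h => ⟨h.1.symm, h.2.symm⟩, fun h => ⟨h.1.symm, h.2.symm⟩⟩
  have hs : ∑ v, ((twoCliques (a + b) a).degree v + 1) = a * a + b * b := by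
    simp only [hd, Finset.card_filter, Fin.sum_univ_add, Fin.val_castAdd, Fin.val_natAdd]
    simp
  rw [← hs, Finset.sum_add_distrib]
  simp

theorem maxAntiRamseyCycle_set_nonempty {n r : ℕ} (L : ℕ) (hr : 2 * n + 4 ≤ (2 * r) ^ 2)
    (hrn : r ≤ n / 2) :
    ∃ G : SimpleGraph (Fin n), n ^ 2 / 4 + 1 ≤ G.edgeSet.ncard ∧
      ∃ χ : Sym2 (Fin n) → ℕ, (χ '' G.edgeSet).ncard ≤ ((n + 1) / 2 + r).choose 2 ∧
        ∀ ⦃v : Fin n⦄ (w : G.Walk v v), w.IsCycle → w.length = L → (w.edges.map χ).Nodup := by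
  obtain ⟨f, hf⟩ := exists_injective_nat (Sym2 ℕ)
  refine ⟨twoCliques n ((n + 1) / 2 + r), ?_, _, twoCliques_card_image_le (by omega) f,
    twoCliques_rainbow hf⟩
  obtain ⟨b, hb⟩ : ∃ b, n = (n + 1) / 2 + r + b := ⟨n / 2 - r, by omega⟩
  have h := @twoCliques_card_edges ((n + 1) / 2 + r) b
  generalize ha : (n + 1) / 2 + r = a at *
  subst hb
  have h1 : 2 * r + b ≤ a := by omega
  obtain ⟨c, rfl⟩ := Nat.exists_eq_add_of_le h1
  have h2 : (2 * r + b + c + b) ^ 2 + (2 * r) ^ 2 ≤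
      2 * ((2 * r + b + c) * (2 * r + b + c) + b * b) := by nlinarith [Nat.zero_le (r * c)]
  have h3 : (2 * r + b + c + b) ^ 2 / 4 * 4 ≤ (2 * r + b + c + b) ^ 2 := Nat.div_mul_le_self _ _
  omega

end UpperBound

section Main

theorem maxAntiRamseyCycle_le {δ : ℝ} (hδ : 0 < δ) (hδ1 : δ ≤ 1) {M n : ℕ} (hM : 3 ≤ δ * M)
    (hM4 : 4 ≤ M) (hn : M ^ 2 ≤ n) (L : ℕ) :
    (maxAntiRamseyCycle n (n ^ 2 / 4 + 1) L : ℝ) ≤ (n : ℝ) ^ 2 / 8 + δ * n ^ 2 := by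
  obtain ⟨m, hm⟩ : ∃ m, m = n.sqrt := ⟨_, rfl⟩
  have h1 : M ≤ m := by rw [hm]; exact Nat.le_sqrt'.2 hn
  have h2 : m ^ 2 ≤ n := by rw [hm]; exact Nat.sqrt_le' n
  have h3 : n < (m + 1) ^ 2 := by rw [hm]; exact Nat.lt_succ_sqrt' n
  have h4 : m + 1 ≤ n / 2 := by
    rw [Nat.le_div_iff_mul_le two_pos]
    nlinarith
  have h5 : maxAntiRamseyCycle n (n ^ 2 / 4 + 1) L ≤ ((n + 1) / 2 + (m + 1)).choose 2 :=
    Nat.sInf_le (maxAntiRamseyCycle_set_nonempty L (by nlinarith) h4)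
  have h6 : (maxAntiRamseyCycle n (n ^ 2 / 4 + 1) L : ℝ) ≤ (((n + 1) / 2 + (m + 1) : ℕ) : ℝ) ^ 2 / 2 :=
    (Nat.cast_le.2 h5).trans (by simpa using Nat.choose_le_pow_div (α := ℝ) 2 ((n + 1) / 2 + (m + 1)))
  have h7 : (((n + 1) / 2 + (m + 1) : ℕ) : ℝ) ≤ n / 2 + (m + 2) := by
    have : 2 * ((n + 1) / 2 + (m + 1)) ≤ n + 2 * (m + 2) := by omega
    have : 2 * (((n + 1) / 2 + (m + 1) : ℕ) : ℝ) ≤ n + 2 * (m + 2) := by exact_mod_cast this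
    linarith
  have h8 : (m : ℝ) + 2 ≤ δ * n := by
    have hm1 : (1 : ℝ) ≤ m := by exact_mod_cast (by omega : 1 ≤ m)
    have hMm : (M : ℝ) ≤ m := by exact_mod_cast h1
    have hmn : (m : ℝ) ^ 2 ≤ n := by exact_mod_cast h2
    calc (m : ℝ) + 2 ≤ 3 * m := by linarith
      _ ≤ δ * M * m := by gcongr
      _ ≤ δ * m * m := by gcongr
      _ = δ * m ^ 2 := by ring
      _ ≤ δ * n := by gcongr
  calc (maxAntiRamseyCycle n (n ^ 2 / 4 + 1) L : ℝ)
      ≤ (((n + 1) / 2 + (m + 1) : ℕ) : ℝ) ^ 2 / 2 := h6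
    _ ≤ (n / 2 + δ * n) ^ 2 / 2 := by gcongr; linarith
    _ = (n : ℝ) ^ 2 / 8 + δ / 2 * n ^ 2 + δ * δ / 2 * n ^ 2 := by ring
    _ ≤ (n : ℝ) ^ 2 / 8 + δ / 2 * n ^ 2 + δ * 1 / 2 * n ^ 2 := by gcongr
    _ = _ := by ring

theorem exists_coloring_maxAntiRamseyCycle {n e L c : ℕ}
    (h : ∃ G : SimpleGraph (Fin n), e ≤ G.edgeSet.ncard ∧
      ∃ χ : Sym2 (Fin n) → ℕ, (χ '' G.edgeSet).ncard ≤ c ∧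
        ∀ ⦃v : Fin n⦄ (w : G.Walk v v), w.IsCycle → w.length = L → (w.edges.map χ).Nodup) :
    ∃ G : SimpleGraph (Fin n), e ≤ G.edgeSet.ncard ∧
      ∃ χ : Sym2 (Fin n) → ℕ, (χ '' G.edgeSet).ncard ≤ maxAntiRamseyCycle n e L ∧
        RainbowCycles G χ L :=
  Nat.sInf_mem (s := {c : ℕ | ∃ G : SimpleGraph (Fin n), e ≤ G.edgeSet.ncard ∧
    ∃ χ : Sym2 (Fin n) → ℕ, (χ '' G.edgeSet).ncard ≤ c ∧
      ∀ ⦃v : Fin n⦄ (w : G.Walk v v), w.IsCycle → w.length = L → (w.edges.map χ).Nodup}) ⟨c, h⟩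

theorem le_maxAntiRamseyCycle {k K n : ℕ} (hk : 4 ≤ k) (hK : 12 ≤ K)
    (hn : 64 * K ^ 2 * (2 * k + 20) ≤ n) (hn' : 50000 ≤ n)
    (hn'' : 300 * 104 + 20 * (2 * k + 20) ≤ n) :
    (n : ℝ) ^ 2 / 8 - 3 / (4 * K) * (n : ℝ) ^ 2 - 4 * n ≤
      (maxAntiRamseyCycle n (n ^ 2 / 4 + 1) (2 * k + 1) : ℝ) := by
  classical
  obtain ⟨G, he, χ, hc, hχ⟩ := exists_coloring_maxAntiRamseyCycle
    (maxAntiRamseyCycle_set_nonempty (n := n) (r := n / 2) (2 * k + 1)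
      (by nlinarith [Nat.div_add_mod n 2, Nat.mod_lt n two_pos]) le_rfl)
  rw [← coe_edgeFinset, Set.ncard_coe_finset] at he
  rw [← coe_edgeFinset, ← Finset.coe_image, Set.ncard_coe_finset] at hc
  have hlt : n ^ 2 < 4 * G.edgeFinset.card :=
    lt_of_lt_of_le (by rw [mul_comm]; exact Nat.lt_mul_of_div_lt (Nat.lt_succ_self _) four_pos)
      (Nat.mul_le_mul_left 4 he)
  have h := card_colors_ge_of_card_sq_lt hk hK hχ (by rwa [Fintype.card_fin])
    (by rw [Fintype.card_fin]; exact hn) (by rw [Fintype.card_fin]; exact hn')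
    (by rw [Fintype.card_fin]; exact hn'')
  rw [Fintype.card_fin] at h
  exact h.trans (Nat.cast_le.2 hc)

end Main

/-- For every `k ≥ 4` and `ε > 0`, for all sufficiently large `n`,
`|f(n, ⌊n²/4⌋ + 1, C_{2k+1}) - n²/8| ≤ ε n²`; that is,
`f(n, ⌊n²/4⌋ + 1, C_{2k+1}) = n²/8 + o(n²)`. -/
theorem statement1 (k : ℕ) (hk : 4 ≤ k) (ε : ℝ) (hε : 0 < ε) :
    ∃ N : ℕ, ∀ n : ℕ, N ≤ n →
      |(maxAntiRamseyCycle n (n ^ 2 / 4 + 1) (2 * k + 1) : ℝ) - (n : ℝ) ^ 2 / 8| ≤ ε * n ^ 2 := by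
  obtain ⟨δ, hδ⟩ : ∃ δ, δ = min ε 1 := ⟨_, rfl⟩
  have hδ0 : 0 < δ := by rw [hδ]; exact lt_min hε one_pos
  have hδε : δ ≤ ε := by rw [hδ]; exact min_le_left _ _
  have hδ1 : δ ≤ 1 := by rw [hδ]; exact min_le_right _ _
  obtain ⟨M, hM⟩ := exists_nat_ge (12 / δ)
  rw [div_le_iff₀ hδ0] at hM
  have hM12 : 12 ≤ M := by
    have : (12 : ℝ) ≤ M := by nlinarith [Nat.cast_nonneg (α := ℝ) M]
    exact_mod_cast this
  refine ⟨M ^ 2 + 64 * M ^ 2 * (2 * k + 20) + 50000 + (300 * 104 + 20 * (2 * k + 20)),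
    fun n hn => ?_⟩
  have h1 := maxAntiRamseyCycle_le hδ0 hδ1 (by linarith) (by omega) (n := n) (M := M) (by omega)
    (2 * k + 1)
  have h2 := le_maxAntiRamseyCycle (n := n) hk hM12 (by linarith [Nat.zero_le (M ^ 2)]) (by linarith [Nat.zero_le (M ^ 2), Nat.zero_le (M ^ 2 * k)]) (by linarith [Nat.zero_le (M ^ 2), Nat.zero_le (M ^ 2 * k)])
  have hM0 : (0 : ℝ) < M := by positivity
  have h3 : 3 / (4 * (M : ℝ)) ≤ δ / 2 := by
    rw [div_le_iff₀ (by positivity)]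
    linarith
  have h4 : 4 * (n : ℝ) ≤ δ / 2 * n ^ 2 := by
    have hMn : (M : ℝ) ≤ n := by exact_mod_cast (by nlinarith : M ≤ n)
    calc 4 * (n : ℝ) ≤ M * δ / 2 * n := by gcongr; linarith
      _ = δ / 2 * (M * n) := by ring
      _ ≤ δ / 2 * (n * n) := by gcongr
      _ = _ := by ring
  have h5 : 3 / (4 * (M : ℝ)) * (n : ℝ) ^ 2 ≤ δ / 2 * n ^ 2 := by gcongr
  have h6 : δ * (n : ℝ) ^ 2 ≤ ε * n ^ 2 := by gcongr
  rw [abs_le]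
  constructor <;> linarith
end

section
/- Let k ≥ 4 be an integer and let 0 < ε < 0.01 be a real number. Then for all positive integers n and e with n²/4 < e ≤ n(n−1)/2, we have f(n, e, C_{2k+1}) ≥ e/2 + (n/2)·√(e − n²/4) − ε·n² − 2k²·ε^{−26}. -/
open SimpleGraph

namespace AntiRamsey

open Finset

section Robust

variable {V : Type*} [DecidableEq V] (G : SimpleGraph V) [DecidableRel G.Adj]

/-- The number of neighbours of `v` in `T`. -/
def degIn (T : Finset V) (v : V) : ℕ := #{y ∈ T | G.Adj v y}

/-- The vertices of `U` reachable from `u` by walks of length `i + 1` that survive the deletion of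
any few vertices. -/
def reach (U : Finset V) (h : ℕ) (u : V) : ℕ → Finset V
  | 0 => {v ∈ U | G.Adj u v}
  | i + 1 => {v ∈ U | h ≤ degIn G (reach U h u i) v}

/-- Every cycle of length `L` is rainbow. -/
def Rainbow (χ : Sym2 V → ℕ) (L : ℕ) : Prop :=
  ∀ ⦃v : V⦄ (w : G.Walk v v), w.IsCycle → w.length = L → (w.edges.map χ).Nodup

variable {G} {U : Finset V} {h : ℕ}

omit [DecidableEq V] in
lemma reach_subset (u : V) (i : ℕ) : reach G U h u i ⊆ U := by
  cases i <;> exact filter_subset _ _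

lemma exists_path_of_mem_reach {u v : V} {i : ℕ} (hv : v ∈ reach G U h u i) (F : Finset V)
    (huF : u ∉ F) (hvF : v ∉ F) (huv : u ≠ v) (hF : #F + i + 2 ≤ h) :
    ∃ P : G.Walk u v, P.IsPath ∧ P.length = i + 1 ∧ ∀ x ∈ P.support, x ∉ F := by
  induction i generalizing v F with
  | zero =>
    have hadj : G.Adj u v := (mem_filter.1 hv).2
    refine ⟨hadj.toWalk, Walk.IsPath.of_adj hadj, by simp, ?_⟩
    intro x hx
    simp only [Walk.support_cons, Walk.support_nil, List.mem_cons, List.not_mem_nil, or_false,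
      Adj.toWalk] at hx
    rcases hx with rfl | rfl <;> assumption
  | succ i ih =>
    have hd : h ≤ #{y ∈ reach G U h u i | G.Adj v y} := (mem_filter.1 hv).2
    have hlt : #(insert u (insert v F)) < #{y ∈ reach G U h u i | G.Adj v y} := by
      have h1 := card_insert_le u (insert v F)
      have h2 := card_insert_le v F
      omega
    obtain ⟨w, hw, hwF⟩ := exists_mem_notMem_of_card_lt_card hlt
    simp only [mem_insert, not_or] at hwF
    obtain ⟨hw1, hw2⟩ := mem_filter.1 hw
    have h2 := card_insert_le v F
    obtain ⟨P, hP, hl, hs⟩ := ih hw1 (insert v F) (by simp [huF, huv]) (by simp [hwF]) (Ne.symm hwF.1)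
      (by omega)
    have hvP : v ∉ P.support := fun hx => hs v hx (mem_insert_self _ _)
    refine ⟨P.concat hw2.symm, hP.concat hvP _, by simp [hl], ?_⟩
    intro x hx
    rw [Walk.support_concat, List.mem_append, List.mem_singleton] at hx
    rcases hx with hx | rfl
    · exact fun hxF => hs x hx (mem_insert_of_mem hxF)
    · exact hvF

omit [DecidableRel G.Adj] in
lemma card_support_le {u v : V} (P : G.Walk u v) : #P.support.toFinset ≤ P.length + 1 := by
  have := P.support.toFinset_card_le
  rwa [Walk.length_support] at this

lemma exists_path_extending {a v w : V} (P : G.Walk a v) (hP : P.IsPath) {i : ℕ}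
    (hw : w ∈ reach G U h v i) (F : Finset V) (hwP : w ∉ P.support) (hwF : w ∉ F)
    (hPF : ∀ x ∈ P.support, x ∉ F) (hF : #F + P.length + i + 3 ≤ h) :
    ∃ Q : G.Walk a w, Q.IsPath ∧ Q.length = P.length + (i + 1) ∧
      (∀ x ∈ Q.support, x ∉ F) ∧ (∀ e ∈ P.edges, e ∈ Q.edges) := by
  have hvw : v ≠ w := by rintro rfl; exact hwP P.end_mem_support
  obtain ⟨Q, hQ, hl, hs⟩ := exists_path_of_mem_reach hw (F ∪ P.support.toFinset.erase v)
    (by simp [hPF v P.end_mem_support]) (by simp [hwF, hwP]) hvw (by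
      have h1 := card_union_le F (P.support.toFinset.erase v)
      have h2 := card_erase_le (s := P.support.toFinset) (a := v)
      have h3 := card_support_le P
      omega)
  refine ⟨P.append Q, ?_, by simp [hl], ?_, ?_⟩
  · rw [Walk.isPath_def, Walk.support_append, List.nodup_append']
    refine ⟨hP.support_nodup, hQ.support_nodup.tail, ?_⟩
    intro x hx hx'
    have hxQ := List.mem_of_mem_tail hx'
    have hxv : x ≠ v := by
      rintro rfl
      have := hQ.support_nodup
      rw [← Walk.cons_tail_support] at this
      exact (List.nodup_cons.1 this).1 hx'
    exact hs x hxQ (mem_union_right _ (by simp [hxv, hx]))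
  · intro x hx
    rw [Walk.mem_support_append_iff] at hx
    rcases hx with hx | hx
    · exact hPF x hx
    · exact fun hxF => hs x hx (mem_union_left _ hxF)
  · intro e he
    rw [Walk.edges_append]
    exact List.mem_append_left _ he

lemma Rainbow.nodup_of_mem_reach {χ : Sym2 V → ℕ} {L : ℕ} (hχ : Rainbow G χ L) {u r : V}
    (P : G.Walk u r) (hP : P.IsPath) {i : ℕ} (hr : r ∈ reach G U h u i) (hur : u ≠ r)
    (hL : P.length + (i + 1) = L) (h3 : 3 ≤ L) (hh : L + 2 ≤ h) : (P.edges.map χ).Nodup := by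
  obtain ⟨Q, hQ, hl, hs⟩ := exists_path_of_mem_reach hr ((P.support.toFinset.erase u).erase r)
    (by simp) (by simp) hur (by
      have h1 := card_erase_le (s := P.support.toFinset.erase u) (a := r)
      have h2 := card_erase_le (s := P.support.toFinset) (a := u)
      have h3 := card_support_le P
      omega)
  have hcyc : (P.append Q.reverse).IsCycle := by
    refine hP.isCycle_append hQ.reverse ?_ (by simp only [Walk.length_reverse]; omega)
    intro x hx hx'
    have hxP := List.mem_of_mem_tail hx
    have hxQ := List.mem_of_mem_tail hx'
    have hxu : x ≠ u := by
      rintro rfl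
      have := hP.support_nodup
      rw [← Walk.cons_tail_support] at this
      exact (List.nodup_cons.1 this).1 hx
    have hxr : x ≠ r := by
      rintro rfl
      have := hQ.reverse.support_nodup
      rw [← Walk.cons_tail_support] at this
      exact (List.nodup_cons.1 this).1 hx'
    rw [Walk.support_reverse, List.mem_reverse] at hxQ
    exact hs x hxQ (by simp [hxu, hxr, hxP])
  have := hχ _ hcyc (by simp only [Walk.length_append, Walk.length_reverse]; omega)
  rw [Walk.edges_append, List.map_append] at this
  exact this.of_append_left

/-- Vertices without a connection of length at most two through `U`. -/
def Far (G : SimpleGraph V) (U : Finset V) (x z : V) : Prop :=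
  x ≠ z ∧ ¬ G.Adj x z ∧ ∀ v ∈ U, ¬ (G.Adj v x ∧ G.Adj v z)

omit [DecidableEq V] [DecidableRel G.Adj] in
lemma Far.symm {x z : V} (hf : Far G U x z) : Far G U z x :=
  ⟨hf.1.symm, fun h => hf.2.1 h.symm, fun v hv h => hf.2.2 v hv h.symm⟩

lemma Rainbow.ne_of_common_vertex {χ : Sym2 V → ℕ} {k : ℕ} (hk : 4 ≤ k)
    (hχ : Rainbow G χ (2 * k + 1)) (hh : 2 * k + 3 ≤ h)
    (hR : ∀ u ∈ U, ∀ i, 4 ≤ i → reach G U h u i = U) {x y w : V} (hy : y ∈ U)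
    (hw : w ∈ U) (hxy : G.Adj x y) (hxw : G.Adj x w) (hyw : y ≠ w) : χ s(y, x) ≠ χ s(x, w) := by
  have := hχ.nodup_of_mem_reach (U := U) (h := h) (Walk.cons hxy.symm (Walk.cons hxw Walk.nil))
    (by simp [hxy.ne', hxw.ne, hyw]) (i := 2 * k - 2) (by rw [hR y hy _ (by omega)]; exact hw) hyw
    (by simp only [Walk.length_cons, Walk.length_nil]; omega) (by omega) (by omega)
  simpa using this

lemma Rainbow.ne_of_adj {χ : Sym2 V → ℕ} {k : ℕ} (hk : 4 ≤ k)
    (hχ : Rainbow G χ (2 * k + 1)) (hh : 2 * k + 3 ≤ h)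
    (hR : ∀ u ∈ U, ∀ i, 4 ≤ i → reach G U h u i = U) {x y z w : V} (hx : x ∈ U) (hy : y ∈ U)
    (hz : z ∈ U) (hw : w ∈ U) (hxy : G.Adj x y) (hzw : G.Adj z w) (hne : s(x, y) ≠ s(z, w))
    (hxz : x = z ∨ G.Adj x z) : χ s(x, y) ≠ χ s(z, w) := by
  rcases eq_or_ne x z with rfl | hxz'
  · have hyw : y ≠ w := by rintro rfl; exact hne rfl
    have := hχ.ne_of_common_vertex hk hh hR hy hw hxy hzw hyw
    rwa [Sym2.eq_swap (a := y)] at this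
  have hadj : G.Adj x z := hxz.resolve_left hxz'
  rcases eq_or_ne y z with rfl | hyz
  · have hxw : x ≠ w := by rintro rfl; exact hne Sym2.eq_swap
    exact hχ.ne_of_common_vertex hk hh hR hx hw hxy.symm hzw hxw
  rcases eq_or_ne x w with rfl | hxw
  · have := hχ.ne_of_common_vertex hk hh hR hy hz hxy hzw.symm hyz
    rwa [Sym2.eq_swap (a := y), Sym2.eq_swap (b := z)] at this
  rcases eq_or_ne y w with rfl | hyw
  · have := hχ.ne_of_common_vertex hk hh hR hx hz hxy.symm hzw.symm hxz'
    rwa [Sym2.eq_swap (b := z)] at this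
  have := hχ.nodup_of_mem_reach (U := U) (h := h)
    (Walk.cons hxy.symm (Walk.cons hadj (Walk.cons hzw Walk.nil)))
    (by simp [hxy.ne', hzw.ne, hyw, hyz, hxz', hxw]) (i := 2 * k - 3)
    (by rw [hR y hy _ (by omega)]; exact hw) hyw
    (by simp only [Walk.length_cons, Walk.length_nil]; omega) (by omega) (by omega)
  simp only [Walk.edges_cons, Walk.edges_nil, List.map_cons, List.map_nil, List.nodup_cons,
    List.mem_cons, List.not_mem_nil, or_false, not_or] at this
  rw [Sym2.eq_swap]
  exact this.1.2

lemma Rainbow.far_of_eq {χ : Sym2 V → ℕ} {k : ℕ} (hk : 4 ≤ k)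
    (hχ : Rainbow G χ (2 * k + 1)) (hh : 2 * k + 3 ≤ h)
    (hR : ∀ u ∈ U, ∀ i, 4 ≤ i → reach G U h u i = U) {x y z w : V} (hx : x ∈ U) (hy : y ∈ U)
    (hz : z ∈ U) (hw : w ∈ U) (hxy : G.Adj x y) (hzw : G.Adj z w) (hne : s(x, y) ≠ s(z, w))
    (heq : χ s(x, y) = χ s(z, w)) : Far G U x z := by
  have key : ∀ {x y z w : V}, x ∈ U → y ∈ U → z ∈ U → w ∈ U → G.Adj x y → G.Adj z w →
      s(x, y) ≠ s(z, w) → χ s(x, y) = χ s(z, w) → ¬ (x = z ∨ G.Adj x z) :=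
    fun hx hy hz hw hxy hzw hne heq hor =>
      hχ.ne_of_adj hk hh hR hx hy hz hw hxy hzw hne hor heq
  have h1 := key hx hy hz hw hxy hzw hne heq
  have h2 := key hy hx hz hw hxy.symm hzw (by rwa [Sym2.eq_swap (a := y)])
    (by rwa [Sym2.eq_swap (a := y)])
  have h3 := key hx hy hw hz hxy hzw.symm (by rwa [Sym2.eq_swap (a := w)])
    (by rwa [Sym2.eq_swap (a := w)])
  have h4 := key hy hx hw hz hxy.symm hzw.symm
    (by rwa [Sym2.eq_swap (a := w), Sym2.eq_swap (a := y)])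
    (by rwa [Sym2.eq_swap (a := w), Sym2.eq_swap (a := y)])
  push Not at h1 h2 h3 h4
  refine ⟨h1.1, h1.2, fun v hv ⟨hvx, hvz⟩ => ?_⟩
  have hvy : v ≠ y := by rintro rfl; exact h2.2 hvz
  have hvw : v ≠ w := by rintro rfl; exact h3.2 hvx.symm
  have := hχ.nodup_of_mem_reach (U := U) (h := h)
    (Walk.cons hxy.symm (Walk.cons hvx.symm (Walk.cons hvz (Walk.cons hzw Walk.nil))))
    (by simp [hxy.ne', hzw.ne, hvx.ne', hvz.ne, hvy.symm, hvw, h1.1, h2.1, h3.1, h4.1])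
    (i := 2 * k - 4) (by rw [hR y hy _ (by omega)]; exact hw) h4.1
    (by simp only [Walk.length_cons, Walk.length_nil]; omega) (by omega) (by omega)
  simp only [Walk.edges_cons, Walk.edges_nil, List.map_cons, List.map_nil, List.nodup_cons,
    List.mem_cons, List.not_mem_nil, or_false, not_or] at this
  rw [Sym2.eq_swap] at heq
  exact this.1.2.2 heq

end Robust

section Counting

variable {V : Type*} [DecidableEq V]

/-- A set covering every pair of `L` related by `F`. -/
def IsCover (F : V → V → Prop) (L K : Finset V) : Prop :=
  ∀ p ∈ L, ∀ q ∈ L, F p q → p ∈ K ∨ q ∈ K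

/-- A graph with vertex cover number at least `τ` has a set of at most twice as many vertices
as the vertex cover number which still needs `τ` vertices to be covered. -/
lemma exists_small_hard_to_cover (F : V → V → Prop) (hF : ∀ p q, F p q → F q p) (U C : Finset V)
    (hC : IsCover F U C) (hmin : ∀ K, IsCover F U K → #C ≤ #K) :
    ∃ L ⊆ U, #L ≤ 2 * #C ∧ ∀ K, IsCover F L K → #C ≤ #K := by
  classical
  obtain ⟨L, hLmem, hLmin⟩ := exists_min_image
    {L ∈ U.powerset | ∀ K, IsCover F L K → #C ≤ #K} (fun L => #L)
    ⟨U, mem_filter.2 ⟨mem_powerset_self U, hmin⟩⟩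
  obtain ⟨hLU', hL⟩ := mem_filter.1 hLmem
  have hLU := mem_powerset.1 hLU'
  refine ⟨L, hLU, ?_, hL⟩
  by_contra! hbig
  set I := L \ C with hI
  have hIindep : ∀ p ∈ I, ∀ q ∈ I, ¬ F p q := by
    intro p hp q hq hpq
    rw [hI, mem_sdiff] at hp hq
    rcases hC p (hLU hp.1) q (hLU hq.1) hpq with h | h
    · exact hp.2 h
    · exact hq.2 h
  let N : Finset V → Finset V := fun S => {q ∈ L | ∃ s ∈ S, F s q}
  have hNmono : ∀ S T, S ⊆ T → N S ⊆ N T := by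
    intro S T hST q hq
    obtain ⟨h1, s, hs, h2⟩ := mem_filter.1 hq
    exact mem_filter.2 ⟨h1, s, hST hs, h2⟩
  have hNI : #(N I) < #I := by
    have h1 : N I ⊆ C := by
      intro q hq
      obtain ⟨h1, s, hs, h2⟩ := mem_filter.1 hq
      by_contra hqC
      exact hIindep s hs q (mem_sdiff.2 ⟨h1, hqC⟩) h2
    have h2 := card_le_card h1
    have h3 := le_card_sdiff C L
    rw [← hI] at h3
    omega
  obtain ⟨S, hSmem, hSmin⟩ := exists_min_image {S ∈ I.powerset | #(N S) < #S} (fun S => #S)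
    ⟨I, mem_filter.2 ⟨mem_powerset_self I, hNI⟩⟩
  obtain ⟨hSI', hS⟩ := mem_filter.1 hSmem
  have hSI := mem_powerset.1 hSI'
  obtain ⟨u, hu⟩ : S.Nonempty := card_pos.1 (by omega)
  have huL : u ∈ L := (mem_sdiff.1 (hSI hu)).1
  have hnot : ¬ ∀ K, IsCover F (L.erase u) K → #C ≤ #K := by
    intro hall
    have := hLmin (L.erase u)
      (mem_filter.2 ⟨mem_powerset.2 ((erase_subset _ _).trans hLU), hall⟩)
    have h2 := card_erase_lt_of_mem huL
    omega
  push Not at hnot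
  obtain ⟨K, hK, hKC⟩ := hnot
  set S₁ := (S.erase u) \ K with hS₁
  have hS₁S : S₁ ⊆ S := sdiff_subset.trans (erase_subset _ _)
  have hS₁card : #S₁ ≤ #(N S₁) := by
    by_contra! hlt
    have h1 := hSmin S₁ (mem_filter.2 ⟨mem_powerset.2 (hS₁S.trans hSI), hlt⟩)
    have h2 : #S₁ ≤ #(S.erase u) := card_le_card sdiff_subset
    have h3 := card_erase_lt_of_mem hu
    omega
  have hNS₁K : N S₁ ⊆ N S ∩ K := by
    intro q hq
    refine mem_inter.2 ⟨hNmono _ _ hS₁S hq, ?_⟩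
    obtain ⟨h1, s, hs, h2⟩ := mem_filter.1 hq
    rw [hS₁, mem_sdiff, mem_erase] at hs
    have hqu : q ≠ u := by
      rintro rfl
      exact hIindep s (hSI hs.1.2) q (hSI hu) h2
    have hsL : s ∈ L := (mem_sdiff.1 (hSI hs.1.2)).1
    exact (hK s (mem_erase.2 ⟨hs.1.1, hsL⟩) q (mem_erase.2 ⟨hqu, h1⟩) h2).resolve_left hs.2
  have hcov : IsCover F L ((K \ S) ∪ N S) := by
    intro p hp q hq hpq
    by_cases hpS : p ∈ S
    · exact Or.inr (mem_union_right _ (mem_filter.2 ⟨hq, p, hpS, hpq⟩))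
    by_cases hqS : q ∈ S
    · exact Or.inl (mem_union_right _ (mem_filter.2 ⟨hp, q, hqS, hF _ _ hpq⟩))
    have hpu : p ≠ u := by rintro rfl; exact hpS hu
    have hqu : q ≠ u := by rintro rfl; exact hqS hu
    rcases hK p (mem_erase.2 ⟨hpu, hp⟩) q (mem_erase.2 ⟨hqu, hq⟩) hpq with h | h
    · exact Or.inl (mem_union_left _ (mem_sdiff.2 ⟨h, hpS⟩))
    · exact Or.inr (mem_union_left _ (mem_sdiff.2 ⟨h, hqS⟩))
  have hdisj : ∀ q ∈ N S, q ∉ S := by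
    intro q hq hqS
    obtain ⟨h1, s, hs, h2⟩ := mem_filter.1 hq
    exact hIindep s (hSI hs) q (hSI hqS) h2
  have hfin := hL _ hcov
  have e1 : (K \ S) ∪ N S = (K \ S) ∪ (N S \ K) := by
    ext q
    simp only [mem_union, mem_sdiff]
    have := hdisj q
    tauto
  have e2 := card_union_le (K \ S) (N S \ K)
  have e3 : #(N S \ K) + #(N S ∩ K) = #(N S) := card_sdiff_add_card_inter _ _
  have e4 : #(K \ S) + #(K ∩ S) = #K := card_sdiff_add_card_inter _ _
  have e5 : #S₁ + #((S.erase u) ∩ K) = #(S.erase u) := card_sdiff_add_card_inter _ _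
  have e6 : #((S.erase u) ∩ K) ≤ #(K ∩ S) := card_le_card (by
    intro q hq
    rw [mem_inter, mem_erase] at hq
    exact mem_inter.2 ⟨hq.2, hq.1.2⟩)
  have e7 := card_le_card hNS₁K
  have e8 := card_erase_of_mem hu
  rw [e1] at hfin
  omega

variable (G : SimpleGraph V) [DecidableRel G.Adj]

omit [DecidableEq V] in
lemma sum_degIn_comm (S T : Finset V) : ∑ x ∈ S, degIn G T x = ∑ y ∈ T, degIn G S y := by
  have := sum_card_bipartiteAbove_eq_sum_card_bipartiteBelow (s := S) (t := T) G.Adj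
  simp only [bipartiteAbove, bipartiteBelow] at this
  simp only [degIn, this, G.adj_comm]

/-- Twice the number of edges inside `U`. -/
def edgesIn (U : Finset V) : ℕ := ∑ v ∈ U, degIn G U v

variable {G} {U : Finset V}

omit [DecidableEq V] in
lemma degIn_le (T : Finset V) (v : V) : degIn G T v ≤ #T := card_filter_le _ _

omit [DecidableEq V] in
lemma degIn_mono {S T : Finset V} (h : S ⊆ T) (v : V) : degIn G S v ≤ degIn G T v :=
  card_le_card (filter_subset_filter _ h)

lemma degIn_sdiff_add {S T : Finset V} (h : S ⊆ T) (v : V) :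
    degIn G (T \ S) v + degIn G S v = degIn G T v := by
  unfold degIn
  rw [← card_union_of_disjoint, ← filter_union, sdiff_union_of_subset h]
  exact disjoint_filter_filter sdiff_disjoint

lemma degIn_union_le (S T : Finset V) (v : V) :
    degIn G (S ∪ T) v ≤ degIn G S v + degIn G T v := by
  unfold degIn
  rw [filter_union]
  exact card_union_le _ _

omit [DecidableEq V] in
lemma edgesIn_eq_card (U : Finset V) : edgesIn G U = #{p ∈ U ×ˢ U | G.Adj p.1 p.2} := by
  unfold edgesIn degIn
  rw [card_filter, sum_product]
  simp only [card_filter]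

omit [DecidableEq V] in
lemma edgesIn_le_sq (U : Finset V) : edgesIn G U ≤ #U ^ 2 := by
  rw [edgesIn_eq_card, sq, ← card_product]
  exact card_filter_le _ _

lemma edgesIn_erase {v : V} (hv : v ∈ U) :
    edgesIn G U = edgesIn G (U.erase v) + 2 * degIn G U v := by
  have h1 : ∀ x, degIn G U x = degIn G (U.erase v) x + degIn G {v} x := by
    intro x
    have := degIn_sdiff_add (G := G) (singleton_subset_iff.2 hv) x
    rw [sdiff_singleton_eq_erase] at this
    exact this.symm
  have h2 : degIn G {v} v = 0 := by simp [degIn]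
  have h3 : ∑ x ∈ U.erase v, degIn G {v} x = degIn G (U.erase v) v := by
    rw [sum_degIn_comm, sum_singleton]
  have h4 := h1 v
  unfold edgesIn
  rw [← add_sum_erase _ _ hv, sum_congr rfl fun x _ => h1 x, sum_add_distrib, h3]
  simp only [h4, h2]
  ring

/-- If every vertex of `U` has at least `t` non-neighbours in `Z`, up to a total deficit of at
most `err`, then `U` misses many edges. -/
lemma edgesIn_le_of_degIn_le {Z : Finset V} (hZ : Z ⊆ U) {t err : ℝ} (δ : V → ℝ)
    (hδ : ∀ v ∈ U, 0 ≤ δ v) (herr : ∑ v ∈ U, δ v ≤ err)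
    (hd : ∀ v ∈ U, (degIn G Z v : ℝ) ≤ #Z - t + δ v) :
    (edgesIn G U : ℝ) ≤ (#U : ℝ) ^ 2 - t * (2 * #U - #Z) + 2 * err := by
  have h1 : edgesIn G U = ∑ v ∈ U, degIn G Z v + ∑ y ∈ U \ Z, degIn G Z y
      + ∑ y ∈ U \ Z, degIn G (U \ Z) y := by
    have hs : ∀ v, degIn G U v = degIn G Z v + degIn G (U \ Z) v := fun v => by
      rw [add_comm, degIn_sdiff_add hZ]
    unfold edgesIn
    rw [sum_congr rfl fun v _ => hs v, sum_add_distrib, sum_degIn_comm G U (U \ Z),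
      sum_congr rfl fun v _ => hs v, sum_add_distrib, add_assoc]
  have h2 : (∑ v ∈ U, degIn G Z v : ℝ) ≤ #U * (#Z - t) + err := by
    calc (∑ v ∈ U, degIn G Z v : ℝ) ≤ ∑ v ∈ U, ((#Z : ℝ) - t + δ v) := sum_le_sum hd
      _ = #U * (#Z - t) + ∑ v ∈ U, δ v := by rw [sum_add_distrib, sum_const, nsmul_eq_mul]
      _ ≤ _ := by linarith
  have hcard : (#(U \ Z) : ℝ) = #U - #Z := by
    rw [card_sdiff_of_subset hZ, Nat.cast_sub (card_le_card hZ)]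
  have h3 : (∑ v ∈ U \ Z, degIn G Z v : ℝ) ≤ (#U - #Z) * (#Z - t) + err := by
    calc (∑ v ∈ U \ Z, degIn G Z v : ℝ) ≤ ∑ v ∈ U \ Z, ((#Z : ℝ) - t + δ v) :=
          sum_le_sum fun v hv => hd v (sdiff_subset hv)
      _ = (#U - #Z) * (#Z - t) + ∑ v ∈ U \ Z, δ v := by
          rw [sum_add_distrib, sum_const, nsmul_eq_mul, hcard]
      _ ≤ _ := by
          have := sum_le_sum_of_subset_of_nonneg (sdiff_subset (s := U) (t := Z))
            fun v hv _ => hδ v hv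
          linarith
  have h4 : (∑ v ∈ U \ Z, degIn G (U \ Z) v : ℝ) ≤ (#U - #Z) ^ 2 := by
    have := edgesIn_le_sq (G := G) (U \ Z)
    rw [← hcard]
    exact_mod_cast this
  rw [h1]
  push_cast
  nlinarith

omit [DecidableEq V] [DecidableRel G.Adj] in
lemma card_le_mul_ncard_colors [Finite V] (χ : Sym2 V → ℕ) (D : Finset (V × V)) (m : ℕ)
    (hD : ∀ p ∈ D, G.Adj p.1 p.2)
    (hm : ∀ p ∈ D, #{q ∈ D | χ s(q.1, q.2) = χ s(p.1, p.2)} ≤ m) :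
    #D ≤ m * (χ '' G.edgeSet).ncard := by
  have h1 := card_le_mul_card_image (s := D) (f := fun p => χ s(p.1, p.2)) m (by
    intro a ha
    obtain ⟨p, hp, rfl⟩ := mem_image.1 ha
    exact hm p hp)
  refine h1.trans (Nat.mul_le_mul_left _ ?_)
  rw [← Set.ncard_coe_finset]
  refine Set.ncard_le_ncard ?_ (Set.toFinite _)
  intro a ha
  rw [mem_coe, mem_image] at ha
  obtain ⟨p, hp, rfl⟩ := ha
  exact ⟨_, hD p hp, rfl⟩

/-- If equally coloured edges of `U` are far apart, then there are many colours. -/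
lemma exists_bound_of_far [Finite V] {χ : Sym2 V → ℕ}
    (hfar : ∀ x ∈ U, ∀ y ∈ U, ∀ z ∈ U, ∀ w ∈ U, G.Adj x y → G.Adj z w → s(x, y) ≠ s(z, w) →
      χ s(x, y) = χ s(z, w) → Far G U x z) {b : ℝ} (hb : 0 ≤ b) (hbU : b ≤ #U / 2)
    (hE : (edgesIn G U : ℝ) = #U ^ 2 - 2 * b * (#U - b)) :
    (edgesIn G U - b ^ 2 : ℝ) / 2 ≤ (χ '' G.edgeSet).ncard := by
  classical
  obtain ⟨C, hCmem, hCmin⟩ := exists_min_image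
    {C ∈ U.powerset | IsCover (Far G U) U C} (fun C => #C)
    ⟨U, mem_filter.2 ⟨mem_powerset_self U, fun p hp _ _ _ => Or.inl hp⟩⟩
  obtain ⟨hCU', hC⟩ := mem_filter.1 hCmem
  have hCU := mem_powerset.1 hCU'
  have hmin : ∀ K, IsCover (Far G U) U K → #C ≤ #K := by
    intro K hK
    refine (hCmin (K ∩ U) (mem_filter.2 ⟨mem_powerset.2 inter_subset_right, ?_⟩)).trans
      (card_le_card inter_subset_left)
    intro p hp q hq hpq
    simp only [mem_inter, hp, hq, and_true]
    exact hK p hp q hq hpq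
  have hCb : (#C : ℝ) ≤ b := by
    obtain ⟨L, hLU, hLcard, hL⟩ := exists_small_hard_to_cover (Far G U) (fun _ _ h => h.symm)
      U C hC hmin
    have hcount := edgesIn_le_of_degIn_le (G := G) hLU (t := #C) (err := 0) (fun _ => 0)
      (by simp) (by simp) (by
        intro v hv
        have h1 : #C ≤ #{y ∈ L | ¬ G.Adj v y} := by
          apply hL
          intro p hp q hq hpq
          by_contra! hcon
          simp only [mem_filter, hp, hq, true_and, not_not] at hcon
          exact hpq.2.2 v hv hcon
        have h2 := card_filter_add_card_filter_not (s := L) (fun y => G.Adj v y)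
        have h3 : (degIn G L v : ℝ) + #{y ∈ L | ¬ G.Adj v y} = #L := by
          unfold degIn; exact_mod_cast h2
        have h4 : (#C : ℝ) ≤ #{y ∈ L | ¬ G.Adj v y} := by exact_mod_cast h1
        linarith)
    have hL1 : (#L : ℝ) ≤ 2 * #C := by exact_mod_cast hLcard
    have hL2 : (#L : ℝ) ≤ #U := by exact_mod_cast card_le_card hLU
    by_contra! hlt
    rw [hE] at hcount
    rcases le_total (#C : ℝ) (#U / 2) with h | h
    · nlinarith
    · have hCU1 : (#C : ℝ) ≤ #U := by exact_mod_cast card_le_card hCU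
      have h1 : (#C : ℝ) * #U ≤ #C * (2 * #U - #L) := by gcongr; linarith
      have h2 : (#C : ℝ) * #U ≤ 2 * b * (#U - b) := by linarith
      have h3 : ((#C : ℝ) - b) * #U ≤ b * (#U - 2 * b) := by linarith
      have h4 : 0 < ((#C : ℝ) - b) * #U := mul_pos (by linarith) (by linarith)
      have h5 : (#U / 2 - b) * (#U : ℝ) ≤ ((#C : ℝ) - b) * #U := by gcongr
      have h6 : 0 < #U - 2 * b := by
        by_contra! hcon
        nlinarith
      nlinarith
  set D : Finset (V × V) := {p ∈ U ×ˢ U | G.Adj p.1 p.2} \ (C ×ˢ C) with hDdef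
  have hcard : edgesIn G U ≤ #D + #C ^ 2 := by
    rw [edgesIn_eq_card, sq, ← card_product]
    exact card_le_card_sdiff_add_card
  have hcol := card_le_mul_ncard_colors (G := G) χ D 2 (by
      intro p hp
      exact (mem_filter.1 (mem_sdiff.1 hp).1).2) (by
      rintro ⟨x, y⟩ hp
      refine (card_le_card (t := {(x, y), (y, x)}) ?_).trans card_le_two
      rintro ⟨z, w⟩ hq
      rw [mem_filter] at hq
      obtain ⟨hq, heq⟩ := hq
      rw [hDdef, mem_sdiff, mem_filter, mem_product, mem_product] at hp hq
      simp only at hp hq heq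
      obtain ⟨⟨⟨hx, hy⟩, hxy⟩, hxyC⟩ := hp
      obtain ⟨⟨⟨hz, hw⟩, hzw⟩, hzwC⟩ := hq
      by_contra hne
      have hne' : s(x, y) ≠ s(z, w) := by
        intro h
        apply hne
        rw [Sym2.eq_iff] at h
        rcases h with ⟨rfl, rfl⟩ | ⟨rfl, rfl⟩ <;> simp
      have f1 := hfar x hx y hy z hz w hw hxy hzw hne' heq.symm
      have f2 := hfar y hy x hx z hz w hw hxy.symm hzw (by rwa [Sym2.eq_swap (a := y)])
        (by rw [Sym2.eq_swap (a := y)]; exact heq.symm)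
      have f3 := hfar x hx y hy w hw z hz hxy hzw.symm (by rwa [Sym2.eq_swap (a := w)])
        (by rw [Sym2.eq_swap (a := w)]; exact heq.symm)
      have f4 := hfar y hy x hx w hw z hz hxy.symm hzw.symm
        (by rwa [Sym2.eq_swap (a := w), Sym2.eq_swap (a := y)])
        (by rw [Sym2.eq_swap (a := w), Sym2.eq_swap (a := y)]; exact heq.symm)
      have c1 := hC _ hx _ hz f1
      have c2 := hC _ hy _ hz f2
      have c3 := hC _ hx _ hw f3
      have c4 := hC _ hy _ hw f4
      tauto)
  have h1 : (edgesIn G U : ℝ) ≤ #D + (#C : ℝ) ^ 2 := by exact_mod_cast hcard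
  have h2 : (#D : ℝ) ≤ 2 * ((χ '' G.edgeSet).ncard : ℝ) := by exact_mod_cast hcol
  have h3 : (#C : ℝ) ^ 2 ≤ b ^ 2 := by gcongr
  linarith

end Counting

section NearlyBipartite

variable {V : Type*} [DecidableEq V] {G : SimpleGraph V} [DecidableRel G.Adj] {U : Finset V}
  {h : ℕ}

/-- Let `X`, `Y` be disjoint sets joined robustly as in a dense bipartite graph. If there is an
edge `uv` whose ends both look like vertices on the side of `X`, then all edges between `X` and `Y`
have different colours. -/
lemma Rainbow.eq_of_odd_edge {χ : Sym2 V → ℕ} {k : ℕ} (hk : 4 ≤ k)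
    (hχ : Rainbow G χ (2 * k + 1)) (hh : 2 * k + 3 ≤ h) {X Y : Finset V} (hXY : Disjoint X Y)
    {u v : V} (huv : G.Adj u v) (hu : u ∉ X ∪ Y) (hv : v ∉ X ∪ Y)
    (hX : ∀ a, a = u ∨ a = v → ∀ j, X ⊆ reach G U h a (2 * j + 1))
    (hY : ∀ a, a = u ∨ a = v → ∀ j, 1 ≤ j → Y ⊆ reach G U h a (2 * j))
    (hYY : ∀ q ∈ Y, Y ⊆ reach G U h q 1) {p q r s : V} (hp : p ∈ X) (hq : q ∈ Y) (hr : r ∈ X)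
    (hs : s ∈ Y) (hpq : G.Adj p q) (hrs : G.Adj r s) (heq : χ s(p, q) = χ s(r, s)) :
    s(p, q) = s(r, s) := by
  have hne : ∀ {a b}, a ∈ X → b ∈ Y → a ≠ b := fun ha hb h =>
    Finset.disjoint_left.1 hXY ha (h ▸ hb)
  have hneX : ∀ {b}, b ∈ X → b ≠ u ∧ b ≠ v := fun hb =>
    ⟨fun h => hu (h ▸ mem_union_left _ hb), fun h => hv (h ▸ mem_union_left _ hb)⟩
  have hneY : ∀ {b}, b ∈ Y → b ≠ u ∧ b ≠ v := fun hb =>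
    ⟨fun h => hu (h ▸ mem_union_right _ hb), fun h => hv (h ▸ mem_union_right _ hb)⟩
  obtain ⟨hpu, hpv⟩ := hneX hp
  obtain ⟨hru, hrv⟩ := hneX hr
  obtain ⟨hqu, hqv⟩ := hneY hq
  obtain ⟨hsu, hsv⟩ := hneY hs
  have hP₀ : (Walk.cons huv Walk.nil).IsPath := by simp [huv.ne]
  by_contra hdiff
  rcases eq_or_ne p r with rfl | hpr
  · have hqs : q ≠ s := by rintro rfl; exact hdiff rfl
    obtain ⟨P₁, hP₁, hl₁, hF₁, -⟩ := exists_path_extending _ hP₀ (hY v (Or.inr rfl) 1 le_rfl hq)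
      {p, s} (by simp [hqu, hqv]) (by simp [hqs, (hne hp hq).symm])
      (by simp [hpu.symm, hpv.symm, hsu.symm, hsv.symm]) (by
        have := card_le_two (a := p) (b := s)
        simp only [Walk.length_cons, Walk.length_nil]
        omega)
    have hpP : p ∉ P₁.support := fun h => hF₁ p h (by simp)
    have hP₂ := hP₁.concat hpP hpq.symm
    have hsP : s ∉ (P₁.concat hpq.symm).support := by
      rw [Walk.support_concat, List.mem_append]
      rintro (h | h)
      · exact hF₁ s h (by simp)
      · exact (hne hp hs).symm (by simpa using h)
    have hP₃ := hP₂.concat hsP hrs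
    have := hχ.nodup_of_mem_reach _ hP₃ (hY u (Or.inl rfl) (k - 3) (by omega) hs) hsu.symm
      (by simp only [Walk.length_concat, hl₁, Walk.length_cons, Walk.length_nil]; omega)
      (by omega) hh
    refine hdiff (List.inj_on_of_nodup_map this ?_ ?_ heq)
    · simp [Walk.edges_concat, Sym2.eq_swap (a := p)]
    · simp [Walk.edges_concat]
  rcases eq_or_ne q s with rfl | hqs
  · obtain ⟨P₁, hP₁, hl₁, hF₁, -⟩ := exists_path_extending _ hP₀ (hX v (Or.inr rfl) 0 hp)
      {q, r} (by simp [hpu, hpv]) (by simp [hpr, hne hp hq])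
      (by simp [hqu.symm, hqv.symm, hru.symm, hrv.symm]) (by
        have := card_le_two (a := q) (b := r)
        simp only [Walk.length_cons, Walk.length_nil]
        omega)
    have hqP : q ∉ P₁.support := fun h => hF₁ q h (by simp)
    have hP₂ := hP₁.concat hqP hpq
    have hrP : r ∉ (P₁.concat hpq).support := by
      rw [Walk.support_concat, List.mem_append]
      rintro (h | h)
      · exact hF₁ r h (by simp)
      · exact hne hr hq (by simpa using h)
    have hP₃ := hP₂.concat hrP hrs.symm
    have := hχ.nodup_of_mem_reach _ hP₃ (hX u (Or.inl rfl) (k - 3) hr) hru.symm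
      (by simp only [Walk.length_concat, hl₁, Walk.length_cons, Walk.length_nil]; omega)
      (by omega) hh
    refine hdiff (List.inj_on_of_nodup_map this ?_ ?_ heq)
    · simp [Walk.edges_concat]
    · simp [Walk.edges_concat, Sym2.eq_swap (a := r)]
  obtain ⟨P₁, hP₁, hl₁, hF₁, -⟩ := exists_path_extending _ hP₀ (hX v (Or.inr rfl) 0 hp)
    {q, r, s} (by simp [hpu, hpv]) (by simp [hpr, hne hp hq, hne hp hs])
    (by simp [hqu.symm, hqv.symm, hru.symm, hrv.symm, hsu.symm, hsv.symm]) (by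
      have := card_le_three (a := q) (b := r) (c := s)
      simp only [Walk.length_cons, Walk.length_nil]
      omega)
  have hqP : q ∉ P₁.support := fun h => hF₁ q h (by simp)
  have hP₂ := hP₁.concat hqP hpq
  have hl₂ : (P₁.concat hpq).length = 4 := by
    simp only [Walk.length_concat, hl₁, Walk.length_cons, Walk.length_nil]
  have hrs₂ : ∀ x, x = r ∨ x = s → x ∉ (P₁.concat hpq).support := by
    intro x hx
    rw [Walk.support_concat, List.mem_append]
    rintro (h | h)
    · exact hF₁ x h (by rcases hx with rfl | rfl <;> simp)
    · rcases hx with rfl | rfl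
      · exact hne hr hq (by simpa using h)
      · exact hqs.symm (by simpa using h)
  obtain ⟨P₃, hP₃, hl₃, hF₃, he₃⟩ := exists_path_extending _ hP₂ (hYY q hq hs)
    {r} (hrs₂ s (Or.inr rfl)) (by simpa using (hne hr hs).symm)
    (by
      intro x hx hxr
      exact hrs₂ x (Or.inl (mem_singleton.1 hxr)) hx) (by
      rw [hl₂, card_singleton]
      omega)
  have hrP : r ∉ P₃.support := fun h => hF₃ r h (by simp)
  have hP₄ := hP₃.concat hrP hrs.symm
  have := hχ.nodup_of_mem_reach _ hP₄ (hX u (Or.inl rfl) (k - 4) hr) hru.symm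
    (by simp only [Walk.length_concat, hl₃, hl₂]; omega) (by omega) hh
  refine hdiff (List.inj_on_of_nodup_map this ?_ ?_ heq)
  · have := he₃ s(p, q) (by simp [Walk.edges_concat])
    simp [Walk.edges_concat, this]
  · simp [Walk.edges_concat, Sym2.eq_swap (a := r)]

end NearlyBipartite

section MaxCut

variable {V : Type*} [DecidableEq V] {G : SimpleGraph V} [DecidableRel G.Adj] {U : Finset V}
  {h : ℕ}

omit [DecidableEq V] in
lemma mul_card_filter_le_deficit (X Y : Finset V) (m : ℝ) :
    m * #{x ∈ X | (degIn G Y x : ℝ) < #Y - m} ≤ #X * #Y - ∑ x ∈ X, (degIn G Y x : ℝ) := by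
  have h1 : (#X * #Y - ∑ x ∈ X, (degIn G Y x : ℝ)) = ∑ x ∈ X, ((#Y : ℝ) - degIn G Y x) := by
    rw [sum_sub_distrib, sum_const, nsmul_eq_mul]
  rw [h1, mul_comm, ← nsmul_eq_mul]
  refine (card_nsmul_le_sum _ (fun x => (#Y : ℝ) - degIn G Y x) m ?_).trans ?_
  · intro x hx
    have := (mem_filter.1 hx).2
    linarith
  · refine sum_le_sum_of_subset_of_nonneg (filter_subset _ _) fun x _ _ => ?_
    have : (degIn G Y x : ℝ) ≤ #Y := by exact_mod_cast degIn_le Y x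
    linarith

omit [DecidableEq V] in
lemma sum_degIn_eq_card (X Y : Finset V) :
    ∑ x ∈ X, degIn G Y x = #{p ∈ X ×ˢ Y | G.Adj p.1 p.2} := by
  unfold degIn
  rw [card_filter, sum_product]
  simp only [card_filter]

lemma le_degIn_of_subset {X Y : Finset V} (hXY : X ⊆ Y) (v : V) :
    (degIn G Y v : ℝ) - (#Y - #X) ≤ degIn G X v := by
  have h1 := degIn_sdiff_add (G := G) hXY v
  have h2 := degIn_le (G := G) (Y \ X) v
  rw [card_sdiff_of_subset hXY] at h2
  have h3 := card_le_card hXY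
  have h4 : degIn G Y v + #X ≤ degIn G X v + #Y := by omega
  have h5 : (degIn G Y v : ℝ) + #X ≤ degIn G X v + #Y := by exact_mod_cast h4
  linarith

lemma le_degIn_nbrs (Y : Finset V) (u v : V) :
    (degIn G Y u : ℝ) + degIn G Y v - #Y ≤ degIn G {y ∈ Y | G.Adj u y} v := by
  have := le_degIn_of_subset (G := G) (filter_subset (fun y => G.Adj u y) Y) v
  have h2 : (degIn G Y u : ℝ) = #{y ∈ Y | G.Adj u y} := rfl
  linarith

lemma mem_reach_one {Y : Finset V} (hY : Y ⊆ U) {u v : V} (hv : v ∈ U)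
    (hd : (h : ℝ) ≤ degIn G Y u + degIn G Y v - #Y) : v ∈ reach G U h u 1 := by
  have h1 := hd.trans (le_degIn_nbrs Y u v)
  refine mem_filter.2 ⟨hv, ?_⟩
  have h2 : h ≤ degIn G {y ∈ Y | G.Adj u y} v := by exact_mod_cast h1
  exact h2.trans (degIn_mono (filter_subset_filter _ hY) v)

lemma Rainbow.bound_of_cut [Finite V] {χ : Sym2 V → ℕ} {k : ℕ} (hk : 4 ≤ k)
    (hχ : Rainbow G χ (2 * k + 1)) (hh : 2 * k + 3 ≤ h) (hhU : (h : ℝ) ≤ #U / 1000)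
    {X Y : Finset V} (hX : X ⊆ U) (hY : Y ⊆ U) (hXY : Disjoint X Y) (hcard : #X + #Y = #U)
    (hcut : (1 / 4 - 3 / 2000 : ℝ) * #U ^ 2 ≤ ∑ x ∈ X, degIn G Y x) {u v : V} (hu : u ∈ X)
    (hv : v ∈ X) (huv : G.Adj u v) (hdu : (#U : ℝ) / 5 ≤ degIn G Y u)
    (hdv : (#U : ℝ) / 5 ≤ degIn G Y v) :
    (3 / 20 : ℝ) * #U ^ 2 ≤ (χ '' G.edgeSet).ncard := by
  have hcardR : (#X : ℝ) + #Y = #U := by exact_mod_cast hcard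
  have hN : (11000 : ℝ) ≤ #U := by
    have : (11 : ℝ) ≤ h := by exact_mod_cast (by omega : 11 ≤ h)
    linarith
  set N : ℝ := (#U : ℝ) with hNdef
  set A := {x ∈ X | (degIn G Y x : ℝ) < #Y - N / 20} with hA
  set B := {y ∈ Y | (degIn G X y : ℝ) < #X - N / 20} with hB
  have hcut' : (∑ x ∈ X, (degIn G Y x : ℝ)) = ∑ y ∈ Y, (degIn G X y : ℝ) := by
    exact_mod_cast sum_degIn_comm G X Y
  push_cast at hcut
  have hprod : (#X : ℝ) * #Y - ∑ x ∈ X, (degIn G Y x : ℝ) ≤ 3 / 2000 * N ^ 2 := by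
    nlinarith [sq_nonneg ((#X : ℝ) - #Y)]
  have hAle := mul_card_filter_le_deficit (G := G) X Y (N / 20)
  have hBle := mul_card_filter_le_deficit (G := G) Y X (N / 20)
  rw [← hA] at hAle
  rw [← hB, ← hcut', mul_comm (#Y : ℝ)] at hBle
  have hA1 : (#A : ℝ) ≤ 3 / 100 * N := by nlinarith
  have hB1 : (#B : ℝ) ≤ 3 / 100 * N := by nlinarith
  have hprod2 : (1 / 4 - 3 / 2000 : ℝ) * N ^ 2 ≤ #X * #Y := by
    have : ∑ x ∈ X, (degIn G Y x : ℝ) ≤ ∑ x ∈ X, (#Y : ℝ) :=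
      sum_le_sum fun x _ => by exact_mod_cast degIn_le Y x
    rw [sum_const, nsmul_eq_mul] at this
    linarith
  have hX1 : 46 / 100 * N ≤ #X := by
    by_contra! hcon
    nlinarith
  have hY1 : 46 / 100 * N ≤ #Y := by
    by_contra! hcon
    nlinarith
  set X' := X \ (A ∪ {u, v}) with hX'
  set Y' := Y \ B with hY'
  have hX'X : X' ⊆ X := sdiff_subset
  have hY'Y : Y' ⊆ Y := sdiff_subset
  have hX'card : (#X : ℝ) - #X' ≤ 4 / 100 * N := by
    have h1 : #X ≤ #X' + #(A ∪ {u, v}) := by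
      have := le_card_sdiff (A ∪ {u, v}) X
      rw [← hX'] at this
      omega
    have h2 := card_union_le A {u, v}
    have h3 := card_le_two (a := u) (b := v)
    have h4 : #X ≤ #X' + #A + 2 := by omega
    have h5 : (#X : ℝ) ≤ #X' + #A + 2 := by exact_mod_cast h4
    linarith
  have hY'card : (#Y : ℝ) - #Y' ≤ 3 / 100 * N := by
    have h1 : #Y ≤ #Y' + #B := by
      have := le_card_sdiff B Y
      rw [← hY'] at this
      omega
    have h5 : (#Y : ℝ) ≤ #Y' + #B := by exact_mod_cast h1
    linarith
  have hdX : ∀ x ∈ X', (#Y : ℝ) - N / 20 ≤ degIn G Y x := by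
    intro x hx
    rw [hX', mem_sdiff, mem_union, not_or, hA, mem_filter] at hx
    by_contra! hcon
    exact hx.2.1 ⟨hx.1, hcon⟩
  have hdY : ∀ y ∈ Y', (#X : ℝ) - N / 20 ≤ degIn G X y := by
    intro y hy
    rw [hY', mem_sdiff, hB, mem_filter] at hy
    by_contra! hcon
    exact hy.2 ⟨hy.1, hcon⟩
  have hdX' : ∀ x ∈ X', (#Y' : ℝ) - N / 20 ≤ degIn G Y' x := by
    intro x hx
    have := le_degIn_of_subset (G := G) hY'Y x
    linarith [hdX x hx]
  have hdY' : ∀ y ∈ Y', (#X' : ℝ) - N / 20 ≤ degIn G X' y := by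
    intro y hy
    have := le_degIn_of_subset (G := G) hX'X y
    linarith [hdY y hy]
  have hone : ∀ a, a = u ∨ a = v → X' ⊆ reach G U h a 1 := by
    intro a ha x hx
    have hda : N / 5 ≤ degIn G Y a := by rcases ha with rfl | rfl <;> assumption
    exact mem_reach_one hY (hX (hX'X hx)) (by linarith [hdX x hx])
  have hXtoY : ∀ a i, X' ⊆ reach G U h a i → Y' ⊆ reach G U h a (i + 1) := by
    intro a i hi y hy
    refine mem_filter.2 ⟨hY (hY'Y hy), le_trans ?_ (degIn_mono hi y)⟩
    have : (h : ℝ) ≤ degIn G X' y := by linarith [hdY' y hy]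
    exact_mod_cast this
  have hYtoX : ∀ a i, Y' ⊆ reach G U h a i → X' ⊆ reach G U h a (i + 1) := by
    intro a i hi x hx
    refine mem_filter.2 ⟨hX (hX'X hx), le_trans ?_ (degIn_mono hi x)⟩
    have : (h : ℝ) ≤ degIn G Y' x := by linarith [hdX' x hx]
    exact_mod_cast this
  have hodd : ∀ a, a = u ∨ a = v → ∀ j, X' ⊆ reach G U h a (2 * j + 1) := by
    intro a ha j
    induction j with
    | zero => exact hone a ha
    | succ j ih => exact hYtoX a _ (hXtoY a _ ih)
  have heven : ∀ a, a = u ∨ a = v → ∀ j, 1 ≤ j → Y' ⊆ reach G U h a (2 * j) := by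
    intro a ha j hj
    obtain ⟨j, rfl⟩ := Nat.exists_eq_add_of_le' hj
    exact hXtoY a _ (hodd a ha j)
  have hYY : ∀ q ∈ Y', Y' ⊆ reach G U h q 1 := by
    intro q hq s hs
    exact mem_reach_one hX (hY (hY'Y hs)) (by linarith [hdY q hq, hdY s hs])
  have hdisj' : Disjoint X' Y' := disjoint_of_subset_left hX'X (disjoint_of_subset_right hY'Y hXY)
  have hnot : ∀ a, a ∈ X → (a = u ∨ a = v) → a ∉ X' ∪ Y' := by
    intro a ha hor
    rw [mem_union, not_or]
    refine ⟨?_, fun h => disjoint_left.1 hXY ha (hY'Y h)⟩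
    rw [hX', mem_sdiff, mem_union, mem_insert, mem_singleton]
    tauto
  have hcol := card_le_mul_ncard_colors (G := G) χ {p ∈ X' ×ˢ Y' | G.Adj p.1 p.2} 1
    (fun p hp => (mem_filter.1 hp).2) (by
      rintro ⟨p, q⟩ hpq
      rw [card_le_one]
      have key : ∀ c ∈ {c ∈ {p ∈ X' ×ˢ Y' | G.Adj p.1 p.2} | χ s(c.1, c.2) = χ s(p, q)},
          c = (p, q) := by
        rintro ⟨r, s⟩ hrs
        simp only [mem_filter, mem_product] at hpq hrs
        obtain ⟨⟨⟨hr, hs⟩, hadj'⟩, heq⟩ := hrs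
        obtain ⟨⟨hp, hq⟩, hadj⟩ := hpq
        have := hχ.eq_of_odd_edge hk hh hdisj' huv (hnot u hu (Or.inl rfl))
          (hnot v hv (Or.inr rfl)) hodd heven hYY hr hs hp hq hadj' hadj heq
        rw [Sym2.eq_iff] at this
        rcases this with ⟨rfl, rfl⟩ | ⟨rfl, rfl⟩
        · rfl
        · exact (disjoint_left.1 hdisj' hp hs).elim
      intro a ha b hb
      rw [key a ha, key b hb])
  rw [one_mul, ← sum_degIn_eq_card] at hcol
  have hcolR : (∑ x ∈ X', (degIn G Y' x : ℝ)) ≤ (χ '' G.edgeSet).ncard := by exact_mod_cast hcol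
  have hsum : (#X' : ℝ) * (#Y' - N / 20) ≤ ∑ x ∈ X', (degIn G Y' x : ℝ) := by
    rw [← nsmul_eq_mul]
    exact card_nsmul_le_sum _ _ _ hdX'
  have h1 : (42 / 100 * N) * (38 / 100 * N) ≤ (#X' : ℝ) * (#Y' - N / 20) := by
    gcongr <;> linarith
  nlinarith

lemma edgesIn_eq_add_cut {X : Finset V} (hX : X ⊆ U) :
    edgesIn G U = edgesIn G X + edgesIn G (U \ X) + 2 * ∑ x ∈ X, degIn G (U \ X) x := by
  have hs : ∀ v, degIn G U v = degIn G X v + degIn G (U \ X) v := fun v => by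
    rw [add_comm, degIn_sdiff_add hX]
  have h1 : ∑ v ∈ U, degIn G U v = ∑ v ∈ U \ X, degIn G U v + ∑ v ∈ X, degIn G U v :=
    (sum_sdiff hX).symm
  unfold edgesIn
  rw [h1, sum_congr rfl fun v _ => hs v, sum_congr (s₁ := X) rfl fun v _ => hs v, sum_add_distrib,
    sum_add_distrib, sum_degIn_comm G (U \ X) X]
  ring

omit [DecidableEq V] in
lemma exists_adj_of_edgesIn_pos {X : Finset V} (hX : 0 < edgesIn G X) :
    ∃ u ∈ X, ∃ v ∈ X, G.Adj u v := by
  rw [edgesIn_eq_card, card_pos] at hX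
  obtain ⟨p, hp⟩ := hX
  simp only [mem_filter, mem_product] at hp
  exact ⟨p.1, hp.1.1, p.2, hp.1.2, hp.2⟩

lemma Rainbow.bound_of_nearly_bipartite [Finite V] {χ : Sym2 V → ℕ} {k : ℕ} (hk : 4 ≤ k)
    (hχ : Rainbow G χ (2 * k + 1)) (hh : 2 * k + 3 ≤ h) (hhU : (h : ℝ) ≤ #U / 1000)
    (hE : #U ^ 2 < 2 * edgesIn G U) (hd : ∀ v ∈ U, 2 / 5 * (#U : ℝ) ≤ degIn G U v)
    {S : Finset V} (hS : S ⊆ U)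
    (hcut : (1 / 4 - 3 / 2000 : ℝ) * #U ^ 2 ≤ ∑ x ∈ S, degIn G (U \ S) x) :
    (3 / 20 : ℝ) * #U ^ 2 ≤ (χ '' G.edgeSet).ncard := by
  obtain ⟨X, hXmem, hXmin⟩ := exists_min_image U.powerset
    (fun X => edgesIn G X + edgesIn G (U \ X)) ⟨S, mem_powerset.2 hS⟩
  have hX := mem_powerset.1 hXmem
  have hY : U \ X ⊆ U := sdiff_subset
  have hmin : ∀ Z ⊆ U, edgesIn G X + edgesIn G (U \ X) ≤ edgesIn G Z + edgesIn G (U \ Z) :=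
    fun Z hZ => hXmin Z (mem_powerset.2 hZ)
  have hcutX : ∑ x ∈ S, degIn G (U \ S) x ≤ ∑ x ∈ X, degIn G (U \ X) x := by
    have h1 := edgesIn_eq_add_cut (G := G) hX
    have h2 := edgesIn_eq_add_cut (G := G) hS
    have := hmin S hS
    omega
  have hlocal : ∀ A B : Finset V, A ⊆ U → B = U \ A →
      (∀ Z ⊆ U, edgesIn G A + edgesIn G B ≤ edgesIn G Z + edgesIn G (U \ Z)) →
      ∀ v ∈ A, degIn G A v ≤ degIn G B v := by
    rintro A B hA rfl hm v hv
    have h1 := hm (A.erase v) ((erase_subset _ _).trans hA)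
    have h2 := edgesIn_erase (G := G) hv
    have h3 : U \ A.erase v = insert v (U \ A) := by
      ext x
      simp only [mem_sdiff, mem_erase, mem_insert]
      have := @hA x
      rcases eq_or_ne x v with rfl | hne
      · simp [hA hv]
      · simp [hne]
    have h4 := edgesIn_erase (G := G) (mem_insert_self v (U \ A))
    rw [erase_insert (by simp [hv])] at h4
    have h5 : degIn G (insert v (U \ A)) v = degIn G (U \ A) v := by
      simp [degIn, filter_insert]
    rw [h3] at h1
    omega
  have hdeg : ∀ A ⊆ U, ∀ v ∈ U, degIn G A v ≤ degIn G (U \ A) v →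
      (#U : ℝ) / 5 ≤ degIn G (U \ A) v := by
    intro A hA v hv hle
    have h1 := degIn_sdiff_add (G := G) hA v
    have h2 := hd v hv
    have h3 : degIn G U v ≤ 2 * degIn G (U \ A) v := by omega
    have h4 : (degIn G U v : ℝ) ≤ 2 * degIn G (U \ A) v := by exact_mod_cast h3
    linarith
  have hcard : #X + #(U \ X) = #U := by rw [add_comm, card_sdiff_add_card_eq_card hX]
  have hcutR : (1 / 4 - 3 / 2000 : ℝ) * #U ^ 2 ≤ (∑ x ∈ X, degIn G (U \ X) x : ℕ) :=
    hcut.trans (by exact_mod_cast hcutX)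
  have hYX : X = U \ (U \ X) := (Finset.sdiff_sdiff_eq_self hX).symm
  rcases Nat.eq_zero_or_pos (edgesIn G X) with h0 | hpos
  · rcases Nat.eq_zero_or_pos (edgesIn G (U \ X)) with h0' | hpos
    · exfalso
      have h1 := edgesIn_eq_add_cut (G := G) hX
      have h2 : ∑ x ∈ X, degIn G (U \ X) x ≤ #X * #(U \ X) := by
        rw [← smul_eq_mul]
        exact sum_le_card_nsmul _ _ _ fun x _ => degIn_le _ _
      rw [← hcard] at hE
      zify at *
      nlinarith [sq_nonneg ((#X : ℤ) - #(U \ X))]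
    · obtain ⟨u, hu, v, hv, huv⟩ := exists_adj_of_edgesIn_pos hpos
      have hl := hlocal (U \ X) X hY hYX (by
        intro Z hZ
        rw [add_comm]
        exact hmin Z hZ)
      have hdl : ∀ a ∈ U \ X, (#U : ℝ) / 5 ≤ degIn G X a := by
        intro a ha
        rw [hYX]
        exact hdeg _ hY a (hY ha) (by rw [← hYX]; exact hl a ha)
      exact hχ.bound_of_cut hk hh hhU hY hX sdiff_disjoint (by omega)
        (by rwa [sum_degIn_comm]) hu hv huv (hdl u hu) (hdl v hv)
  · obtain ⟨u, hu, v, hv, huv⟩ := exists_adj_of_edgesIn_pos hpos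
    have hl := hlocal X (U \ X) hX rfl hmin
    exact hχ.bound_of_cut hk hh hhU hX hY disjoint_sdiff hcard hcutR hu hv huv
      (hdeg X hX u (hX hu) (hl u hu)) (hdeg X hX v (hX hv) (hl v hv))

end MaxCut

section Separation

variable {V : Type*} [DecidableEq V] {G : SimpleGraph V} [DecidableRel G.Adj] {U : Finset V}
  {h : ℕ}

omit [DecidableEq V] in
lemma sum_degIn_le {A B : Finset V} (hB : B ⊆ U) (hd : ∀ w ∈ B, degIn G A w ≤ h) :
    ∑ v ∈ A, (degIn G B v : ℝ) ≤ h * #U := by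
  have h1 : ∑ v ∈ A, degIn G B v ≤ #B * h := by
    rw [sum_degIn_comm, ← smul_eq_mul]
    exact sum_le_card_nsmul _ _ _ hd
  have h2 : #B * h ≤ h * #U := by
    rw [mul_comm]
    exact Nat.mul_le_mul_left _ (card_le_card hB)
  exact_mod_cast h1.trans h2

/-- If `v` is not robustly reachable from `u`, then there are large disjoint sets `S`, `T` such that
hardly any vertex is adjacent to both of them. -/
lemma exists_separated_sets {D : ℝ} (hD : 0 < D) (hd : ∀ v ∈ U, D ≤ degIn G U v) {u v : V}
    (hu : u ∈ U) (hv : v ∈ U) (hnot : v ∉ reach G U h u 4) :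
    ∃ S T W, S ⊆ U ∧ T ⊆ U ∧ W ⊆ U ∧ Disjoint S T ∧ (∀ t ∈ T, degIn G (U \ W) t ≤ h) ∧
      (∀ w ∈ W, degIn G S w ≤ h) ∧ D - h ≤ #T ∧ D * (D - #S) ≤ 3 * h * #U := by
  have hout : ∀ i, ∀ v ∈ U, v ∉ reach G U h u (i + 1) → degIn G (reach G U h u i) v ≤ h := by
    intro i v hv hn
    by_contra! hcon
    exact hn (mem_filter.2 ⟨hv, hcon.le⟩)
  have hsub := reach_subset (G := G) (U := U) (h := h) u
  set R := reach G U h u with hR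
  have hUU : U \ (U \ R 2) = R 2 := Finset.sdiff_sdiff_eq_self (hsub 2)
  have hdouble : D * #(R 1 ∩ (U \ R 3)) ≤ 2 * h * #U := by
    have h1 : D * #(R 1 ∩ (U \ R 3)) ≤ ∑ v ∈ R 1 ∩ (U \ R 3), (degIn G U v : ℝ) := by
      rw [mul_comm, ← nsmul_eq_mul]
      exact card_nsmul_le_sum _ _ _ fun v hv => hd v (hsub 1 (inter_subset_left hv))
    have h2 : ∑ v ∈ R 1 ∩ (U \ R 3), (degIn G (R 2) v : ℝ) ≤ h * #U := by
      calc ∑ v ∈ R 1 ∩ (U \ R 3), (degIn G (R 2) v : ℝ) ≤ ∑ v ∈ R 1 ∩ (U \ R 3), (h : ℝ) := by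
            refine sum_le_sum fun v hv => ?_
            obtain ⟨hvU, hvR⟩ := mem_sdiff.1 (inter_subset_right hv)
            exact_mod_cast hout 2 v hvU hvR
        _ = h * #(R 1 ∩ (U \ R 3)) := by rw [sum_const, nsmul_eq_mul, mul_comm]
        _ ≤ h * #U := by
            gcongr
            exact inter_subset_left.trans (hsub 1)
    have h3 : ∑ v ∈ R 1 ∩ (U \ R 3), (degIn G (U \ R 2) v : ℝ) ≤ h * #U := by
      refine sum_degIn_le sdiff_subset fun w hw => ?_
      obtain ⟨hwU, hwR⟩ := mem_sdiff.1 hw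
      exact (degIn_mono inter_subset_left w).trans (hout 1 w hwU hwR)
    have h4 : ∀ v, (degIn G U v : ℝ) = degIn G (U \ R 2) v + degIn G (R 2) v := by
      intro v
      exact_mod_cast (degIn_sdiff_add (hsub 2) v).symm
    simp only [h4, sum_add_distrib] at h1
    linarith
  have hsecond : D * (D - #(R 1)) ≤ h * #U := by
    have h0 : D ≤ #(R 0) := hd u hu
    have h1 : D * #(R 0) ≤ ∑ v ∈ R 0, (degIn G U v : ℝ) := by
      rw [mul_comm, ← nsmul_eq_mul]
      exact card_nsmul_le_sum _ _ _ fun v hv => hd v (hsub 0 hv)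
    have h2 : ∑ v ∈ R 0, (degIn G (U \ R 1) v : ℝ) ≤ h * #U := by
      refine sum_degIn_le sdiff_subset fun w hw => ?_
      obtain ⟨hwU, hwR⟩ := mem_sdiff.1 hw
      exact hout 0 w hwU hwR
    have h3 : ∑ v ∈ R 0, (degIn G (R 1) v : ℝ) ≤ #(R 0) * #(R 1) := by
      rw [← nsmul_eq_mul]
      exact sum_le_card_nsmul _ _ _ fun v _ => by exact_mod_cast degIn_le _ v
    have h4 : ∀ v, (degIn G U v : ℝ) = degIn G (U \ R 1) v + degIn G (R 1) v := by
      intro v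
      exact_mod_cast (degIn_sdiff_add (hsub 1) v).symm
    simp only [h4, sum_add_distrib] at h1
    have h5 : (0 : ℝ) ≤ h * #U := by positivity
    rcases le_total D #(R 1) with h6 | h6
    · nlinarith
    · nlinarith
  refine ⟨R 1 \ (U \ R 3), U \ R 3, U \ R 2, sdiff_subset.trans (hsub 1), sdiff_subset,
    sdiff_subset, sdiff_disjoint, ?_, ?_, ?_, ?_⟩
  · intro t ht
    obtain ⟨htU, htR⟩ := mem_sdiff.1 ht
    rw [hUU]
    exact hout 2 t htU htR
  · intro w hw
    obtain ⟨hwU, hwR⟩ := mem_sdiff.1 hw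
    exact (degIn_mono sdiff_subset w).trans (hout 1 w hwU hwR)
  · have h1 := hd v hv
    have h2 : (degIn G U v : ℝ) = degIn G (U \ R 3) v + degIn G (R 3) v := by
      exact_mod_cast (degIn_sdiff_add (hsub 3) v).symm
    have h3 : (degIn G (R 3) v : ℝ) ≤ h := by exact_mod_cast hout 3 v hv hnot
    have h4 : (degIn G (U \ R 3) v : ℝ) ≤ #(U \ R 3) := by exact_mod_cast degIn_le _ v
    linarith
  · have h1 : (#(R 1 \ (U \ R 3)) : ℝ) + #(R 1 ∩ (U \ R 3)) = #(R 1) := by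
      exact_mod_cast card_sdiff_add_card_inter _ _
    rw [← h1] at hsecond
    nlinarith

lemma edgesIn_le_of_separated {S T W : Finset V} (hS : S ⊆ U) (hT : T ⊆ U) (hW : W ⊆ U)
    (hST : Disjoint S T) (hTW : ∀ t ∈ T, degIn G (U \ W) t ≤ h) (hSW : ∀ w ∈ W, degIn G S w ≤ h)
    {t : ℕ} (htS : t ≤ #S) (htT : t ≤ #T) :
    (edgesIn G U : ℝ) ≤ (#U : ℝ) ^ 2 - 2 * t * (#U - t) + 4 * (h * #U) := by
  obtain ⟨A, hAS, hA⟩ := exists_subset_card_eq htS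
  obtain ⟨B, hBT, hB⟩ := exists_subset_card_eq htT
  have hAB : Disjoint A B := disjoint_of_subset_left hAS (disjoint_of_subset_right hBT hST)
  have hZ : (#(A ∪ B) : ℝ) = 2 * t := by
    rw [card_union_of_disjoint hAB, hA, hB]
    push_cast
    ring
  have h1 := edgesIn_le_of_degIn_le (G := G) (union_subset (hAS.trans hS) (hBT.trans hT)) (t := t)
    (err := 2 * (h * #U)) (fun v => if v ∈ W then degIn G A v else degIn G B v)
    (fun v _ => by positivity) (by
      rw [← sum_sdiff hW]
      have h1 : ∑ v ∈ U \ W, (if v ∈ W then (degIn G A v : ℝ) else degIn G B v)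
          = ∑ v ∈ U \ W, (degIn G B v : ℝ) :=
        sum_congr rfl fun v hv => if_neg (mem_sdiff.1 hv).2
      have h2 : ∑ v ∈ W, (if v ∈ W then (degIn G A v : ℝ) else degIn G B v)
          = ∑ v ∈ W, (degIn G A v : ℝ) := sum_congr rfl fun v hv => if_pos hv
      have h3 : ∑ v ∈ U \ W, (degIn G B v : ℝ) ≤ h * #U :=
        sum_degIn_le (hBT.trans hT) fun w hw => hTW w (hBT hw)
      have h4 : ∑ v ∈ W, (degIn G A v : ℝ) ≤ h * #U := by
        calc ∑ v ∈ W, (degIn G A v : ℝ) ≤ ∑ v ∈ W, (h : ℝ) := by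
              refine sum_le_sum fun v hv => ?_
              exact_mod_cast (degIn_mono hAS v).trans (hSW v hv)
          _ = h * #W := by rw [sum_const, nsmul_eq_mul, mul_comm]
          _ ≤ h * #U := by gcongr
      rw [h1, h2]
      linarith) (by
      intro v _
      have h0 : (degIn G (A ∪ B) v : ℝ) ≤ degIn G A v + degIn G B v := by
        exact_mod_cast degIn_union_le A B v
      have h1 : (degIn G A v : ℝ) ≤ t := by exact_mod_cast hA ▸ degIn_le A v
      have h2 : (degIn G B v : ℝ) ≤ t := by exact_mod_cast hB ▸ degIn_le B v
      rw [hZ]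
      split_ifs <;> linarith)
  rw [hZ] at h1
  linarith

end Separation

section Optimal

variable {V : Type*} [DecidableEq V] (G : SimpleGraph V) [DecidableRel G.Adj]

/-- The square root of the excess of the number of edges in `U` over a quarter of the square of
the number of vertices. -/
noncomputable def excess (U : Finset V) : ℝ := √((edgesIn G U : ℝ) / 2 - (#U : ℝ) ^ 2 / 4)

variable {G} {U : Finset V}

omit [DecidableEq V] in
lemma excess_nonneg : 0 ≤ excess G U := Real.sqrt_nonneg _

omit [DecidableEq V] in
lemma sq_excess (hU : #U ^ 2 < 2 * edgesIn G U) :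
    excess G U ^ 2 = (edgesIn G U : ℝ) / 2 - (#U : ℝ) ^ 2 / 4 := by
  have : (#U : ℝ) ^ 2 < 2 * edgesIn G U := by exact_mod_cast hU
  exact Real.sq_sqrt (by linarith)

omit [DecidableEq V] in
lemma excess_le (hU : #U ^ 2 < 2 * edgesIn G U) : excess G U ≤ #U / 2 := by
  have h1 : (edgesIn G U : ℝ) ≤ (#U : ℝ) ^ 2 := by exact_mod_cast edgesIn_le_sq U
  have h2 := sq_excess hU
  refine le_of_sq_le_sq ?_ (by positivity)
  nlinarith

variable (G) in
/-- `U` maximizes `#U / 2 + excess G U - ε * #U` among the sets spanning many edges. -/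
def Optimal (ε : ℝ) (U : Finset V) : Prop :=
  #U ^ 2 < 2 * edgesIn G U ∧ ∀ A, #A ^ 2 < 2 * edgesIn G A →
    (#A : ℝ) / 2 + excess G A - ε * #A ≤ #U / 2 + excess G U - ε * #U

omit [DecidableEq V] in
lemma exists_optimal [Fintype V] (ε : ℝ) {A : Finset V} (hA : #A ^ 2 < 2 * edgesIn G A) :
    ∃ U, Optimal G ε U := by
  obtain ⟨U, hU, hmax⟩ := exists_max_image {A : Finset V | #A ^ 2 < 2 * edgesIn G A}
    (fun A => (#A : ℝ) / 2 + excess G A - ε * #A) ⟨A, by simpa using hA⟩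
  exact ⟨U, by simpa using hU, fun A hA => hmax A (by simpa using hA)⟩

lemma Optimal.le_degIn {ε : ℝ} (hU : Optimal G ε U) (hε0 : 0 ≤ ε) (hε1 : ε ≤ 1 / 2) {v : V}
    (hv : v ∈ U) :
    (#U : ℝ) / 2 - excess G U + 2 * ε * excess G U - 1 / 2 ≤ degIn G U v := by
  have hx := excess_nonneg (G := G) (U := U)
  have hxsq := sq_excess hU.1
  have hE : (edgesIn G U : ℝ) = edgesIn G (U.erase v) + 2 * degIn G U v := by
    exact_mod_cast edgesIn_erase hv
  have hcard : (#(U.erase v) : ℝ) = #U - 1 := by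
    rw [card_erase_of_mem hv, Nat.cast_sub (card_pos.2 ⟨v, hv⟩), Nat.cast_one]
  by_cases hA : #(U.erase v) ^ 2 < 2 * edgesIn G (U.erase v)
  · have h1 := hU.2 _ hA
    have h2 := sq_excess hA
    have h3 := excess_nonneg (G := G) (U := U.erase v)
    rw [hcard] at h1 h2
    have h4 : excess G (U.erase v) ≤ excess G U + (1 / 2 - ε) := by linarith
    have h5 : excess G (U.erase v) ^ 2 ≤ (excess G U + (1 / 2 - ε)) ^ 2 := by gcongr
    nlinarith
  · have h1 : 2 * (edgesIn G (U.erase v) : ℝ) ≤ (#(U.erase v) : ℝ) ^ 2 := by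
      exact_mod_cast not_lt.1 hA
    rw [hcard] at h1
    nlinarith [sq_nonneg (excess G U - 1 / 2), mul_nonneg hε0 hx]

end Optimal

section Cases

variable {V : Type*} [DecidableEq V] {G : SimpleGraph V} [DecidableRel G.Adj] {U : Finset V}
  {h : ℕ} {ε n D : ℝ}

lemma card_mul_le_edgesIn {S T W : Finset V} (hd : ∀ v ∈ U, D ≤ degIn G U v) (hS : S ⊆ U)
    (hT : T ⊆ U) (hW : W ⊆ U) (hTW : ∀ t ∈ T, degIn G (U \ W) t ≤ h)
    (hSW : ∀ w ∈ W, degIn G S w ≤ h) :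
    #(S \ W) * (D - #(U \ (S ∪ T))) ≤ edgesIn G (S \ W) + 2 * (h * #U) := by
  have hAT : ∑ v ∈ S \ W, (degIn G T v : ℝ) ≤ h * #U :=
    sum_degIn_le hT fun w hw => (degIn_mono (sdiff_subset_sdiff hS Subset.rfl) w).trans (hTW w hw)
  have hAW : ∑ v ∈ S \ W, (degIn G W v : ℝ) ≤ h * #U :=
    sum_degIn_le hW fun w hw => (degIn_mono sdiff_subset w).trans (hSW w hw)
  have hpoint : ∀ v ∈ S \ W, D - #(U \ (S ∪ T)) ≤
      degIn G (S \ W) v + degIn G T v + degIn G W v := by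
    intro v hv
    have h1 : degIn G U v ≤ degIn G (S \ W ∪ (U \ (S ∪ T)) ∪ T ∪ W) v := by
      refine degIn_mono ?_ v
      intro y hy
      simp only [mem_union, mem_sdiff]
      tauto
    have h2 := degIn_union_le (G := G) (S \ W ∪ (U \ (S ∪ T)) ∪ T) W v
    have h3 := degIn_union_le (G := G) (S \ W ∪ (U \ (S ∪ T))) T v
    have h4 := degIn_union_le (G := G) (S \ W) (U \ (S ∪ T)) v
    have h5 := degIn_le (G := G) (U \ (S ∪ T)) v
    have h6 : degIn G U v ≤
        degIn G (S \ W) v + #(U \ (S ∪ T)) + degIn G T v + degIn G W v := by omega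
    have h7 : (degIn G U v : ℝ) ≤
        degIn G (S \ W) v + #(U \ (S ∪ T)) + degIn G T v + degIn G W v := by exact_mod_cast h6
    linarith [hd v (hS (sdiff_subset hv))]
  have h1 : #(S \ W) * (D - #(U \ (S ∪ T))) ≤
      ∑ v ∈ S \ W, ((degIn G (S \ W) v : ℝ) + degIn G T v + degIn G W v) := by
    rw [← nsmul_eq_mul]
    exact card_nsmul_le_sum _ _ _ hpoint
  rw [sum_add_distrib, sum_add_distrib] at h1
  have h2 : (edgesIn G (S \ W) : ℝ) = ∑ v ∈ S \ W, (degIn G (S \ W) v : ℝ) := by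
    unfold edgesIn
    push_cast
    rfl
  linarith

lemma card_mul_le_cut {S W : Finset V} (hd : ∀ v ∈ U, D ≤ degIn G U v) (hS : S ⊆ U)
    (hW : W ⊆ U) (hSW : ∀ w ∈ W, degIn G S w ≤ h) :
    #S * D ≤ ∑ v ∈ S, (degIn G (U \ S) v : ℝ) + #S * #(S \ W) + h * #U := by
  have hsumS : #S * D ≤ ∑ v ∈ S, ((degIn G (U \ S) v : ℝ) + degIn G (S \ W) v + degIn G W v) := by
    rw [← nsmul_eq_mul]
    refine card_nsmul_le_sum _ _ _ fun v hv => ?_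
    have h1 : degIn G U v ≤ degIn G (U \ S ∪ S \ W ∪ W) v := by
      refine degIn_mono ?_ v
      intro y hy
      simp only [mem_union, mem_sdiff]
      tauto
    have h2 := degIn_union_le (G := G) (U \ S ∪ S \ W) W v
    have h3 := degIn_union_le (G := G) (U \ S) (S \ W) v
    have h4 : degIn G U v ≤ degIn G (U \ S) v + degIn G (S \ W) v + degIn G W v := by omega
    have h5 : (degIn G U v : ℝ) ≤ degIn G (U \ S) v + degIn G (S \ W) v + degIn G W v := by
      exact_mod_cast h4
    exact (hd v (hS hv)).trans h5
  rw [sum_add_distrib, sum_add_distrib] at hsumS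
  have h1 : ∑ v ∈ S, (degIn G (S \ W) v : ℝ) ≤ #S * #(S \ W) := by
    rw [← nsmul_eq_mul]
    exact sum_le_card_nsmul _ _ _ fun v _ => by exact_mod_cast degIn_le _ v
  linarith [sum_degIn_le hW hSW]

lemma false_of_separated_of_excess (hU : #U ^ 2 < 2 * edgesIn G U) (hε0 : 0 < ε) (hε1 : ε < 0.01)
    (hn : #U ≤ n) (hh1 : 11 ≤ h) (hh2 : h ≤ 2 * ε ^ 7 * n) (hx : ε * n / 40 ≤ excess G U)
    (hD : D = (#U : ℝ) / 2 - excess G U + 2 * ε * excess G U - 1 / 2)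
    {S T W : Finset V} (hS : S ⊆ U) (hT : T ⊆ U) (hW : W ⊆ U)
    (hST : Disjoint S T) (hTW : ∀ t ∈ T, degIn G (U \ W) t ≤ h) (hSW : ∀ w ∈ W, degIn G S w ≤ h)
    (hTD : D - h ≤ #T) (hSD : D * (D - #S) ≤ 3 * h * #U) : False := by
  have hx0 := excess_nonneg (G := G) (U := U)
  have hxsq := sq_excess hU
  have hxle := excess_le hU
  set x := excess G U
  set N : ℝ := (#U : ℝ) with hN
  have hN0 : 0 ≤ N := by positivity
  have hh1' : (11 : ℝ) ≤ h := by exact_mod_cast hh1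
  obtain ⟨θ, hθ⟩ : ∃ θ, θ = ε ^ 2 * n / 80 := ⟨_, rfl⟩
  have hε3 : ε ^ 3 ≤ 1 / 1000000 := by
    calc ε ^ 3 ≤ 0.01 ^ 3 := by gcongr
      _ = _ := by norm_num
  have hε5 : ε ^ 5 ≤ 1 / 10000000000 := by
    calc ε ^ 5 ≤ 0.01 ^ 5 := by gcongr
      _ = _ := by norm_num
  have hn0 : 0 ≤ n := hN0.trans hn
  have hθ0 : 0 ≤ θ := by rw [hθ]; positivity
  have hhθ : h ≤ θ / 1000000 := by
    calc (h : ℝ) ≤ 2 * ε ^ 7 * n := hh2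
      _ = 160 * ε ^ 5 * θ := by rw [hθ]; ring
      _ ≤ 160 * (1 / 10000000000) * θ := by gcongr
      _ ≤ _ := by linarith
  have hhn : h * N ≤ 0.0128 * θ ^ 2 := by
    calc (h : ℝ) * N ≤ (2 * ε ^ 7 * n) * n := by gcongr
      _ = 12800 * ε ^ 3 * θ ^ 2 := by rw [hθ]; ring
      _ ≤ 12800 * (1 / 1000000) * θ ^ 2 := by gcongr
      _ = _ := by norm_num
  have hεx : 4 * θ ≤ 2 * ε * x := by
    calc 4 * θ = 2 * ε * (ε * n / 40) := by rw [hθ]; ring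
      _ ≤ _ := by gcongr
  have hθx : 3 * θ ≤ 2 * x := by
    have : ε * x ≤ 0.01 * x := by gcongr
    linarith
  have hDθ : 3 * θ ≤ D := by linarith
  have hSθ : D - θ ≤ #S := by
    by_contra! hcon
    have : 3 * θ * θ ≤ D * (D - #S) := by
      gcongr <;> linarith
    nlinarith
  obtain ⟨t, ht⟩ : ∃ t : ℕ, t = ⌈N / 2 - x + θ⌉₊ := ⟨_, rfl⟩
  have ht1 : N / 2 - x + θ ≤ t := ht ▸ Nat.le_ceil _
  have ht2 : t < N / 2 - x + θ + 1 := ht ▸ Nat.ceil_lt_add_one (by linarith)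
  have htS : t ≤ #S := by
    have : (t : ℝ) ≤ #S := by linarith
    exact_mod_cast this
  have htT : t ≤ #T := by
    have : (t : ℝ) ≤ #T := by linarith
    exact_mod_cast this
  have h1 := edgesIn_le_of_separated hS hT hW hST hTW hSW htS htT
  rw [← hN] at h1
  have h2 : θ * θ ≤ (t - (N / 2 - x)) * (N / 2 + x - t) := by
    gcongr <;> linarith
  nlinarith

lemma le_of_mul_sub_le {a N η h L : ℝ} (hh : 0 < h) (hha : 12 * h < a)
    (hhη : h ≤ η / 100000000000) (hηN : η ≤ 0.0101 * N) (hL : N / 2 - 0.08 * η ≤ L)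
    (haL : a * (L - a) ≤ 2 * (h * N)) : N / 2 - 0.09 * η ≤ a := by
  by_contra! hcon
  have hN : 0 < h * N := mul_pos hh (by linarith)
  rcases le_total a (N / 4) with h2 | h2
  · have h3 : 12 * h * (0.2 * N) ≤ a * (L - a) := by gcongr <;> linarith
    linarith
  · have h3 : N / 4 * (0.01 * η) ≤ a * (L - a) := by gcongr <;> linarith
    have h4 : h * N ≤ (η / 100000000000) * N := by gcongr; linarith
    linarith

omit [DecidableEq V] in
lemma false_of_dense_subset {A : Finset V} {N η x L : ℝ} (hε0 : 0 < ε) (hη : η = ε * n)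
    (hη1 : 0 < η) (hηN : η ≤ 0.0101 * N) (hNn : 0.999 * n ≤ N) (hx : x ≤ η / 40)
    (hopt : #A ^ 2 < 2 * edgesIn G A →
      (#A : ℝ) / 2 + excess G A - ε * #A ≤ N / 2 + x - ε * N)
    (hAlarge : N / 2 - 0.09 * η ≤ #A) (hAle : #A ≤ N / 2 + 0.027 * η)
    (hL : N / 2 - 0.08 * η ≤ L) (hAL : #A * L ≤ edgesIn G A + 0.002 * (η * #A)) : False := by
  have hEA : (#A : ℝ) * (#A - 0.12 * η) ≤ edgesIn G A := by
    have h1 : (#A : ℝ) * (#A - 0.11 * η) ≤ #A * L :=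
      mul_le_mul_of_nonneg_left (by linarith) (by positivity)
    have h2 : 0 ≤ η * #A := by positivity
    linarith
  have hA2 : #A ^ 2 < 2 * edgesIn G A := by
    have h1 : 0 < (#A : ℝ) * (#A - 0.24 * η) := mul_pos (by linarith) (by linarith)
    have h2 : (#A : ℝ) ^ 2 < 2 * edgesIn G A := by linarith
    exact_mod_cast h2
  have h1 := hopt hA2
  have h2 := sq_excess hA2
  have h3 : (#A : ℝ) / 2 - 0.13 * η ≤ excess G A := by
    refine le_of_sq_le_sq ?_ excess_nonneg
    have h4 : η * η ≤ η * #A := mul_le_mul_of_nonneg_left (by linarith) hη1.le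
    have h5 : 0 ≤ η * #A := by positivity
    rw [h2]
    linarith
  have h4 : ε * (0.49 * n) ≤ ε * (N - #A) :=
    mul_le_mul_of_nonneg_left (by linarith) hε0.le
  linarith

/-- The color bound when `U` barely spans more than a quarter of the square of its size. -/
lemma Rainbow.bound_of_separated_of_excess [Finite V] {χ : Sym2 V → ℕ} {k : ℕ} (hk : 4 ≤ k)
    (hχ : Rainbow G χ (2 * k + 1)) (hh : 2 * k + 3 ≤ h)
    (hU : Optimal G ε U) (hε0 : 0 < ε) (hε1 : ε < 0.01)
    (hn : #U ≤ n) (hnU : n / 2 - ε * n ≤ #U / 2 + excess G U - ε * #U)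
    (hh2 : h ≤ 2 * ε ^ 7 * n) (hx : excess G U ≤ ε * n / 40)
    (hD : D = (#U : ℝ) / 2 - excess G U - 1 / 2) (hd : ∀ v ∈ U, D ≤ degIn G U v)
    {S T W : Finset V} (hS : S ⊆ U) (hT : T ⊆ U) (hW : W ⊆ U)
    (hST : Disjoint S T) (hTW : ∀ t ∈ T, degIn G (U \ W) t ≤ h) (hSW : ∀ w ∈ W, degIn G S w ≤ h)
    (hTD : D - h ≤ #T) (hSD : D * (D - #S) ≤ 3 * h * #U) :
    ((#U : ℝ) / 2 + excess G U) ^ 2 / 2 ≤ (χ '' G.edgeSet).ncard := by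
  have hx0 := excess_nonneg (G := G) (U := U)
  have hUopt := hU.2
  have hE := hU.1
  clear hU
  generalize excess G U = x at *
  obtain ⟨N, hN⟩ : ∃ N : ℝ, N = #U := ⟨_, rfl⟩
  simp only [← hN] at hUopt hn hnU hD hSD ⊢
  have hN0 : 0 ≤ N := by rw [hN]; positivity
  have hn0 : 0 ≤ n := hN0.trans hn
  have hh1' : (11 : ℝ) ≤ h := by exact_mod_cast (by omega : 11 ≤ h)
  obtain ⟨η, hη⟩ : ∃ η, η = ε * n := ⟨_, rfl⟩
  have hε6 : ε ^ 6 ≤ 1 / 1000000000000 := by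
    calc ε ^ 6 ≤ 0.01 ^ 6 := by gcongr
      _ = _ := by norm_num
  have hη0 : 0 ≤ η := by rw [hη]; positivity
  have hηn : η ≤ 0.01 * n := by rw [hη]; gcongr
  have hhη : h ≤ η / 100000000000 := by
    calc (h : ℝ) ≤ 2 * ε ^ 7 * n := hh2
      _ = 2 * ε ^ 6 * η := by rw [hη]; ring
      _ ≤ 2 * (1 / 1000000000000) * η := by gcongr
      _ ≤ _ := by linarith
  rw [← hη] at hnU hx
  have hnN : n - N ≤ 0.06 * η := by
    by_contra! hcon
    have : ε * (n - N) ≤ 0.01 * (n - N) := by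
      gcongr
    nlinarith
  have hNn : 0.999 * n ≤ N := by linarith
  have hηN : η ≤ 0.0101 * N := by linarith
  have hD1 : N / 2 - 0.026 * η ≤ D := by linarith
  have hT1 : N / 2 - 0.027 * η ≤ #T := by linarith
  have hS1 : N / 2 - 0.027 * η ≤ #S := by
    by_contra! hcon
    have : 0.4 * N * (0.001 * η) ≤ D * (D - #S) := by
      gcongr <;> linarith
    nlinarith
  have hSTU : (#S : ℝ) + #T + #(U \ (S ∪ T)) = N := by
    have h1 := card_sdiff_add_card_eq_card (union_subset hS hT)
    rw [card_union_of_disjoint hST] at h1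
    rw [hN, ← h1]
    push_cast
    ring
  obtain ⟨c, hc⟩ : ∃ c : ℝ, c = #(U \ (S ∪ T)) := ⟨_, rfl⟩
  rw [← hc] at hSTU
  have hsumA := card_mul_le_edgesIn hd hS hT hW hTW hSW
  have hsumS := card_mul_le_cut hd hS hW hSW
  rw [← hN, ← hc] at hsumA
  rw [← hN] at hsumS
  have hAleS : (#(S \ W) : ℝ) ≤ #S := by exact_mod_cast card_le_card sdiff_subset
  have hSN : (#S : ℝ) ≤ N := by
    rw [hN]
    exact_mod_cast card_le_card hS
  obtain ⟨A, hA⟩ : ∃ A, A = S \ W := ⟨_, rfl⟩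
  rw [← hA] at hsumA hsumS hAleS
  have hAsq : (edgesIn G A : ℝ) ≤ (#A : ℝ) ^ 2 := by exact_mod_cast edgesIn_le_sq A
  have hAle : (#A : ℝ) ≤ N / 2 + 0.027 * η := by
    have hc0 : 0 ≤ c := by rw [hc]; positivity
    linarith
  have hDc : N / 2 - 0.08 * η ≤ D - c := by linarith
  have hhN : 0 ≤ h * N := by positivity
  rcases le_or_gt (#A : ℝ) (12 * h) with hAsmall | hAbig
  · have hSA : (#S : ℝ) * #A ≤ N * (12 * h) := by gcongr
    have hSD' : (0.4997 * N) * (0.4997 * N) ≤ #S * D := by gcongr <;> linarith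
    have hhN2 : h * N ≤ 0.000001 * N * N := by gcongr; linarith
    have hbound := hχ.bound_of_nearly_bipartite hk hh (by rw [← hN]; linarith) hE
      (fun v hv => le_trans (by rw [← hN]; linarith) (hd v hv)) hS (by
        push_cast
        rw [← hN]
        linarith [sq_nonneg N])
    rw [← hN] at hbound
    refine le_trans ?_ hbound
    have : (N / 2 + x) ^ 2 ≤ (0.51 * N) ^ 2 := by
      gcongr
      linarith
    linarith [sq_nonneg N]
  · exfalso
    have hη1 : 0 < η := by linarith
    have hAlarge : N / 2 - 0.09 * η ≤ #A :=
      le_of_mul_sub_le (by linarith) hAbig hhη hηN hDc (by linarith)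
    have hNA : N ≤ 4 * #A := by linarith
    have hhN2 : h * N ≤ 0.001 * (η * #A) := by
      have h1 : h * N ≤ (η / 100000000000) * (4 * #A) := by gcongr
      have h2 : 0 ≤ η * #A := by positivity
      linarith
    exact false_of_dense_subset hε0 hη hη1 hηN hNn hx (hUopt A) hAlarge hAle hDc (by linarith)

end Cases

section Main

variable {V : Type*} [DecidableEq V] {G : SimpleGraph V} [DecidableRel G.Adj] {U : Finset V}
  {h : ℕ} {ε n : ℝ}

omit [DecidableEq V] in
lemma reach_eq_of_forall_mem (hR : ∀ u ∈ U, ∀ v ∈ U, v ∈ reach G U h u 4) {u : V} (hu : u ∈ U)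
    {i : ℕ} (hi : 4 ≤ i) : reach G U h u i = U := by
  induction i, hi using Nat.le_induction with
  | base => exact (reach_subset u 4).antisymm (hR u hu)
  | succ i _ ih =>
    refine (reach_subset u _).antisymm fun v hv => mem_filter.2 ⟨hv, ?_⟩
    rw [ih]
    exact (mem_filter.1 (hR u hu v hv)).2.trans (degIn_mono (reach_subset u 3) v)

lemma Rainbow.bound_of_optimal [Finite V] {χ : Sym2 V → ℕ} {k : ℕ} (hk : 4 ≤ k)
    (hχ : Rainbow G χ (2 * k + 1)) (hh : 2 * k + 3 ≤ h) (hU : Optimal G ε U) (hε0 : 0 < ε)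
    (hε1 : ε < 0.01) (hn : #U ≤ n) (hnU : n / 2 - ε * n ≤ #U / 2 + excess G U - ε * #U)
    (hh2 : h ≤ 2 * ε ^ 7 * n) :
    ((#U : ℝ) / 2 + excess G U) ^ 2 / 2 ≤ (χ '' G.edgeSet).ncard := by
  have hx0 := excess_nonneg (G := G) (U := U)
  have hxle := excess_le hU.1
  by_cases hR : ∀ u ∈ U, ∀ v ∈ U, v ∈ reach G U h u 4
  · have hxsq := sq_excess hU.1
    have h1 := exists_bound_of_far (χ := χ) (b := (#U : ℝ) / 2 - excess G U)
      (fun x hx y hy z hz w hw hxy hzw hne heq => hχ.far_of_eq hk hh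
        (fun u hu i hi => reach_eq_of_forall_mem hR hu hi) hx hy hz hw hxy hzw hne heq)
      (by linarith) (by linarith) (by linarith)
    linarith
  · push Not at hR
    obtain ⟨u, hu, v, hv, hnot⟩ := hR
    have hn0 : 0 ≤ n := le_trans (by positivity) hn
    have hh1 : (11 : ℝ) ≤ h := by exact_mod_cast (by omega : 11 ≤ h)
    have hε5 : ε ^ 5 ≤ 1 / 10000000000 := by
      calc ε ^ 5 ≤ 0.01 ^ 5 := by gcongr
        _ = _ := by norm_num
    have hε2 : ε ^ 2 ≤ 1 / 10000 := by
      calc ε ^ 2 ≤ 0.01 ^ 2 := by gcongr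
        _ = _ := by norm_num
    have hhn : h ≤ ε ^ 2 * n / 5000000000 := by
      calc (h : ℝ) ≤ 2 * ε ^ 7 * n := hh2
        _ = 2 * ε ^ 5 * (ε ^ 2 * n) := by ring
        _ ≤ 2 * (1 / 10000000000) * (ε ^ 2 * n) := by gcongr
        _ = _ := by ring
    have hd := fun v hv => hU.le_degIn hε0.le (by linarith) (v := v) hv
    rcases le_total (ε * n / 40) (excess G U) with hx | hx
    · have h1 : ε * (ε * n / 40) ≤ ε * excess G U := by gcongr
      obtain ⟨S, T, W, hS, hT, hW, hST, hTW, hSW, hTD, hSD⟩ :=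
        exists_separated_sets (by linarith) hd hu hv hnot
      exact (false_of_separated_of_excess hU.1 hε0 hε1 hn (by omega) hh2 hx rfl hS hT hW hST hTW
        hSW hTD hSD).elim
    · have h1 : ε * n ≤ 0.01 * n := by gcongr
      have h2 : ε ^ 2 * n ≤ 1 / 10000 * n := by gcongr
      have h3 : 0 ≤ ε * #U := by positivity
      have h4 : 0 ≤ ε * excess G U := by positivity
      have hd' : ∀ v ∈ U, (#U : ℝ) / 2 - excess G U - 1 / 2 ≤ degIn G U v :=
        fun v hv => le_trans (by linarith) (hd v hv)
      obtain ⟨S, T, W, hS, hT, hW, hST, hTW, hSW, hTD, hSD⟩ :=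
        exists_separated_sets (by linarith) hd' hu hv hnot
      exact hχ.bound_of_separated_of_excess hk hh hU hε0 hε1 hn hnU hh2 hx rfl hd' hS hT hW hST hTW
        hSW hTD hSD

omit [DecidableEq V] in
lemma edgesIn_univ [Fintype V] : edgesIn G univ = 2 * G.edgeSet.ncard := by
  rw [← coe_edgeFinset G, Set.ncard_coe_finset, ← G.sum_degrees_eq_twice_card_edges]
  refine sum_congr rfl fun v _ => ?_
  rw [degIn, ← card_neighborFinset_eq_degree, neighborFinset_eq_filter]

lemma Rainbow.bound_of_lt_ncard [Fintype V] {χ : Sym2 V → ℕ} {k : ℕ} (hk : 4 ≤ k)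
    (hχ : Rainbow G χ (2 * k + 1)) (hε0 : 0 < ε) (hε1 : ε < 0.01)
    (hk13 : 2 * k < ε ^ 13 * Fintype.card V) {a : ℝ} (ha : 0 ≤ a)
    (hE : (Fintype.card V : ℝ) ^ 2 / 4 + a ^ 2 ≤ G.edgeSet.ncard)
    (hE' : (Fintype.card V : ℝ) ^ 2 / 4 < G.edgeSet.ncard) :
    ((Fintype.card V : ℝ) / 2 + a - ε * Fintype.card V) ^ 2 / 2 ≤ (χ '' G.edgeSet).ncard := by
  obtain ⟨n, hn⟩ : ∃ n : ℝ, n = Fintype.card V := ⟨_, rfl⟩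
  rw [← hn] at hk13 hE hE' ⊢
  have hn0 : 0 ≤ n := by rw [hn]; positivity
  have huniv : (edgesIn G univ : ℝ) = 2 * G.edgeSet.ncard := by exact_mod_cast edgesIn_univ
  have hcard : (#(univ : Finset V) : ℝ) = n := by rw [hn, card_univ]
  have hA : #(univ : Finset V) ^ 2 < 2 * edgesIn G univ := by
    have : (#(univ : Finset V) : ℝ) ^ 2 < 2 * edgesIn G univ := by
      rw [huniv, hcard]
      linarith
    exact_mod_cast this
  have hax : a ≤ excess G univ := by
    refine Real.le_sqrt_of_sq_le ?_
    rw [huniv, hcard]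
    linarith
  obtain ⟨U, hU⟩ := exists_optimal ε hA
  have hUn : (#U : ℝ) ≤ n := by
    rw [hn]
    exact_mod_cast card_le_univ U
  have hopt := hU.2 _ hA
  rw [hcard] at hopt
  have hk4 : (4 : ℝ) ≤ k := by exact_mod_cast hk
  have hε6 : ε ^ 6 ≤ 1 / 1000000000000 := by
    calc ε ^ 6 ≤ 0.01 ^ 6 := by gcongr
      _ = _ := by norm_num
  have hkε : 2 * k + 3 ≤ ε ^ 7 * n := by
    have : ε ^ 13 * n ≤ 1 / 1000000000000 * (ε ^ 7 * n) := by
      calc ε ^ 13 * n = ε ^ 6 * (ε ^ 7 * n) := by ring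
        _ ≤ _ := by gcongr
    linarith
  have hh : 2 * k + 3 ≤ ⌈ε ^ 7 * n⌉₊ := by
    have : (2 * k + 3 : ℝ) ≤ ⌈ε ^ 7 * n⌉₊ := hkε.trans (Nat.le_ceil _)
    exact_mod_cast this
  have hh2 : (⌈ε ^ 7 * n⌉₊ : ℝ) ≤ 2 * ε ^ 7 * n := by
    have : (⌈ε ^ 7 * n⌉₊ : ℝ) < ε ^ 7 * n + 1 := Nat.ceil_lt_add_one (by positivity)
    linarith
  refine le_trans ?_ (hχ.bound_of_optimal hk hh hU hε0 hε1 hUn (by linarith) hh2)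
  have h1 : 0 ≤ ε * #U := by positivity
  have h2 : ε * n ≤ 0.01 * n := by gcongr
  gcongr <;> linarith

lemma exists_mem_maxAntiRamseyCycle {n e : ℕ} (he : e ≤ n * (n - 1) / 2) (L : ℕ) :
    ∃ G : SimpleGraph (Fin n), e ≤ G.edgeSet.ncard ∧ ∃ χ : Sym2 (Fin n) → ℕ,
      (χ '' G.edgeSet).ncard ≤ maxAntiRamseyCycle n e L ∧ Rainbow G χ L := by
  refine Nat.sInf_mem (s := {c : ℕ | ∃ G : SimpleGraph (Fin n), e ≤ G.edgeSet.ncard ∧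
    ∃ χ : Sym2 (Fin n) → ℕ, (χ '' G.edgeSet).ncard ≤ c ∧ Rainbow G χ L}) ?_
  obtain ⟨χ, hχ⟩ := exists_injective_nat (Sym2 (Fin n))
  refine ⟨_, ⊤, ?_, χ, le_rfl, fun v w hw _ => hw.1.1.edges_nodup.map hχ⟩
  rw [← coe_edgeFinset, Set.ncard_coe_finset, card_edgeFinset_top_eq_card_choose_two,
    Fintype.card_fin, Nat.choose_two_right]
  exact he

end Main

end AntiRamsey

/-- For every integer `k ≥ 4` and real `0 < ε < 0.01`, for all positive integers `n, e` with
`n²/4 < e ≤ n(n-1)/2`, we have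
`f(n, e, C_{2k+1}) ≥ e/2 + (n/2)·√(e - n²/4) - ε n² - 2 k² ε⁻²⁶`. -/
theorem statement2 (k : ℕ) (hk : 4 ≤ k) (ε : ℝ) (hε0 : 0 < ε) (hε1 : ε < 0.01)
    (n e : ℕ) (hn : 0 < n) (he : 0 < e)
    (he1 : (n : ℝ) ^ 2 / 4 < e) (he2 : e ≤ n * (n - 1) / 2) :
    (maxAntiRamseyCycle n e (2 * k + 1) : ℝ) ≥
      (e : ℝ) / 2 + (n : ℝ) / 2 * Real.sqrt ((e : ℝ) - (n : ℝ) ^ 2 / 4)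
        - ε * n ^ 2 - 2 * k ^ 2 * ε ^ (-26 : ℤ) := by
  classical
  have hn0 : (0 : ℝ) ≤ n := by positivity
  have hen : (e : ℝ) ≤ (n : ℝ) ^ 2 / 2 := by
    have h1 : 2 * e ≤ n ^ 2 := by
      calc 2 * e ≤ n * (n - 1) := by omega
        _ ≤ n * n := by gcongr; omega
        _ = n ^ 2 := by ring
    have h2 : (2 : ℝ) * e ≤ (n : ℝ) ^ 2 := by exact_mod_cast h1
    linarith
  have ha0 := Real.sqrt_nonneg ((e : ℝ) - (n : ℝ) ^ 2 / 4)
  have hasq := Real.sq_sqrt (x := (e : ℝ) - (n : ℝ) ^ 2 / 4) (by linarith)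
  set a := √((e : ℝ) - (n : ℝ) ^ 2 / 4)
  have han : a ≤ n / 2 := le_of_sq_le_sq (by linarith) (by positivity)
  have hεn : 0 ≤ ε * n ^ 2 := by positivity
  have hz : ε ^ (-26 : ℤ) = ((ε ^ 13) ^ 2)⁻¹ := by
    rw [← pow_mul, zpow_neg]
    norm_cast
  rcases le_or_gt (ε ^ 13 * n) (2 * k) with hsmall | hlarge
  · have h1 : (n : ℝ) ^ 2 ≤ 4 * k ^ 2 * ε ^ (-26 : ℤ) := by
      rw [hz, ← div_eq_mul_inv, le_div_iff₀ (by positivity)]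
      calc (n : ℝ) ^ 2 * (ε ^ 13) ^ 2 = (ε ^ 13 * n) ^ 2 := by ring
        _ ≤ (2 * (k : ℝ)) ^ 2 := by gcongr
        _ = _ := by ring
    have h2 : (n : ℝ) * a ≤ n * (n / 2) := by gcongr
    have h3 : (0 : ℝ) ≤ maxAntiRamseyCycle n e (2 * k + 1) := by positivity
    linarith
  · obtain ⟨G, hGe, χ, hχc, hχ⟩ := AntiRamsey.exists_mem_maxAntiRamseyCycle he2 (2 * k + 1)
    have hGe' : (e : ℝ) ≤ G.edgeSet.ncard := by exact_mod_cast hGe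
    have hbound := hχ.bound_of_lt_ncard hk hε0 hε1 (by simpa using hlarge) ha0
      (by rw [Fintype.card_fin]; linarith) (by rw [Fintype.card_fin]; linarith)
    rw [Fintype.card_fin] at hbound
    have hχc' : ((χ '' G.edgeSet).ncard : ℝ) ≤ maxAntiRamseyCycle n e (2 * k + 1) := by
      exact_mod_cast hχc
    have h1 : ε * n * (n / 2 + a) ≤ ε * n * n := by
      gcongr
      linarith
    have h2 : 0 ≤ 2 * (k : ℝ) ^ 2 * ε ^ (-26 : ℤ) := by positivity
    have h3 := sq_nonneg (ε * n)
    linarith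
end

section
/- Let G be a simple graph with n vertices and e edges, where e ≥ n²/4 − n/2. Then G contains a vertex set A such that any two vertices in A are at distance at most 3 in G, and |A| ≥ n/2 + √(e − n²/4 + n/2). -/
open SimpleGraph

/-- `a` is the largest cardinality of a subset of `S` any two of whose elements are `R`-related. -/
def IsMaxCliqueCard {V : Type*} (R : V → V → Prop) (S : Finset V) (a : ℕ) : Prop :=
  (∃ I ⊆ S, (∀ x ∈ I, ∀ y ∈ I, R x y) ∧ I.card = a) ∧
    ∀ I ⊆ S, (∀ x ∈ I, ∀ y ∈ I, R x y) → I.card ≤ a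

theorem exists_isMaxCliqueCard {V : Type*} (R : V → V → Prop) (S : Finset V) :
    ∃ a, IsMaxCliqueCard R S a := by
  classical
  have hne : (S.powerset.filter fun I => ∀ x ∈ I, ∀ y ∈ I, R x y).Nonempty :=
    ⟨∅, by simp⟩
  obtain ⟨I, hI, hmax⟩ := Finset.exists_max_image _ Finset.card hne
  simp only [Finset.mem_filter, Finset.mem_powerset] at hI hmax
  exact ⟨I.card, ⟨I, hI.1, hI.2, rfl⟩, fun J hJ hJR => hmax J ⟨hJ, hJR⟩⟩

open Classical in
/-- Hajnal's lemma: the intersection and the union of a nonempty family of maximum cliques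
together have at least twice as many elements as a maximum clique. -/
theorem IsMaxCliqueCard.two_mul_le_card_inter_add_card_union {V : Type*} {R : V → V → Prop}
    {S : Finset V} {a : ℕ} (h : IsMaxCliqueCard R S a) {F : Finset (Finset V)}
    (hF : F.Nonempty)
    (hmem : ∀ I ∈ F, I ⊆ S ∧ (∀ x ∈ I, ∀ y ∈ I, R x y) ∧ I.card = a) :
    2 * a ≤ (S.filter fun x => ∀ J ∈ F, x ∈ J).card +
      (S.filter fun x => ∃ J ∈ F, x ∈ J).card := by
  induction hF using Finset.Nonempty.cons_induction with
  | singleton I =>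
    obtain ⟨hIS, -, hIa⟩ := hmem I (by simp)
    have : (S.filter fun x => x ∈ I) = I := by
      ext x
      simpa using @hIS x
    simp [this, hIa, two_mul]
  | cons I F hIF hF ih =>
    obtain ⟨hIS, hIR, hIa⟩ := hmem I (by simp)
    have hmem' : ∀ J ∈ F, J ⊆ S ∧ (∀ x ∈ J, ∀ y ∈ J, R x y) ∧ J.card = a :=
      fun J hJ => hmem J (by simp [hJ])
    specialize ih hmem'
    set T := S.filter fun x => ∀ J ∈ F, x ∈ J with hT
    set U := S.filter fun x => ∃ J ∈ F, x ∈ J with hU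
    have hT' : (S.filter fun x => ∀ J ∈ Finset.cons I F hIF, x ∈ J) = T ∩ I := by
      ext x
      simp only [hT, Finset.mem_filter, Finset.mem_inter, Finset.forall_mem_cons]
      tauto
    have hU' : (S.filter fun x => ∃ J ∈ Finset.cons I F hIF, x ∈ J) = U ∪ I := by
      ext x
      simp only [hU, Finset.mem_filter, Finset.mem_union, Finset.mem_cons, exists_eq_or_imp]
      rw [and_or_left, and_iff_right_of_imp (@hIS x), or_comm]
    rw [hT', hU']
    have hTU : T ⊆ U := by
      obtain ⟨J, hJ⟩ := hF
      intro x hx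
      simp only [hT, hU, Finset.mem_filter] at hx ⊢
      exact ⟨hx.1, J, hJ, hx.2 J hJ⟩
    have key : (T ∪ (I ∩ U)).card ≤ a := by
      refine h.2 _ ?_ ?_
      · exact Finset.union_subset (Finset.filter_subset _ _)
          (Finset.inter_subset_left.trans hIS)
      · intro x hx y hy
        simp only [Finset.mem_union, Finset.mem_inter, hT, hU, Finset.mem_filter] at hx hy
        rcases hx with ⟨-, hx⟩ | ⟨hxI, -, J, hJ, hxJ⟩
        · rcases hy with ⟨-, hy⟩ | ⟨-, -, J, hJ, hyJ⟩
          · obtain ⟨J, hJ⟩ := hF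
            exact (hmem' J hJ).2.1 x (hx J hJ) y (hy J hJ)
          · exact (hmem' J hJ).2.1 x (hx J hJ) y hyJ
        · rcases hy with ⟨-, hy⟩ | ⟨hyI, -⟩
          · exact (hmem' J hJ).2.1 x hxJ y (hy J hJ)
          · exact hIR x hxI y hyI
    have h1 := Finset.card_union_add_card_inter T (I ∩ U)
    have h2 : T ∩ (I ∩ U) = T ∩ I := by
      ext x
      have := @hTU x
      simp only [Finset.mem_inter]
      tauto
    have h3 := Finset.card_union_add_card_inter U I
    rw [Finset.inter_comm U I] at h3
    rw [h2] at h1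
    omega

/-- Deleting vertices that lie in every maximum clique, one reaches a subset in which maximum
cliques cover at most half of the elements. -/
theorem IsMaxCliqueCard.exists_subset_two_mul_le {V : Type*} {R : V → V → Prop}
    {S : Finset V} {a : ℕ} (h : IsMaxCliqueCard R S a) :
    ∃ S' ⊆ S, ∃ b, IsMaxCliqueCard R S' b ∧ S'.card + a = S.card + b ∧ 2 * b ≤ S'.card := by
  classical
  induction S using Finset.strongInduction generalizing a with
  | H S ih =>
    by_cases hS : 2 * a ≤ S.card
    · exact ⟨S, subset_rfl, a, h, rfl, hS⟩
    let F := S.powerset.filter fun I => (∀ x ∈ I, ∀ y ∈ I, R x y) ∧ I.card = a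
    have hmem : ∀ I, I ∈ F ↔ I ⊆ S ∧ (∀ x ∈ I, ∀ y ∈ I, R x y) ∧ I.card = a := by
      simp [F]
    obtain ⟨I, hIS, hIR, hIa⟩ := h.1
    have hF : F.Nonempty := ⟨I, (hmem I).2 ⟨hIS, hIR, hIa⟩⟩
    have hajnal := h.two_mul_le_card_inter_add_card_union hF fun J hJ => (hmem J).1 hJ
    have hU := Finset.card_filter_le S fun x => ∃ J ∈ F, x ∈ J
    obtain ⟨v, hv⟩ : (S.filter fun x => ∀ J ∈ F, x ∈ J).Nonempty := by
      rw [← Finset.card_pos]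
      omega
    obtain ⟨hvS, hv⟩ := Finset.mem_filter.1 hv
    have hvI := hv I ((hmem I).2 ⟨hIS, hIR, hIa⟩)
    have hpos : 0 < I.card := Finset.card_pos.2 ⟨v, hvI⟩
    have herase : IsMaxCliqueCard R (S.erase v) (a - 1) := by
      refine ⟨⟨I.erase v, Finset.erase_subset_erase v hIS, ?_, ?_⟩, ?_⟩
      · exact fun x hx y hy => hIR x (Finset.mem_of_mem_erase hx) y (Finset.mem_of_mem_erase hy)
      · rw [Finset.card_erase_of_mem hvI, hIa]
      · intro J hJ hJR
        have hJS := hJ.trans (Finset.erase_subset v S)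
        have hJa := h.2 J hJS hJR
        by_contra hlt
        have := hv J ((hmem J).2 ⟨hJS, hJR, by omega⟩)
        exact Finset.notMem_erase v S (hJ this)
    obtain ⟨S', hS', b, hb, hcard, hle⟩ := ih _ (Finset.erase_ssubset hvS) herase
    refine ⟨S', hS'.trans (Finset.erase_subset v S), b, hb, ?_, hle⟩
    have := Finset.card_erase_add_one hvS
    omega

/-- If `a` is the largest size of a set of vertices pairwise joined by walks of length at most
two, then `2e + n ≤ a² + (n - a)²` and `2e + n ≤ n * a`. -/
theorem SimpleGraph.two_mul_card_edgeFinset_add_card_le {V : Type*} [Fintype V] [DecidableEq V]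
    (G : SimpleGraph V) [DecidableRel G.Adj] {a : ℕ}
    (h : IsMaxCliqueCard (fun x y => ∃ w : G.Walk x y, w.length ≤ 2) Finset.univ a) :
    (2 * G.edgeFinset.card + Fintype.card V : ℤ) ≤ a ^ 2 + (Fintype.card V - a) ^ 2 ∧
      2 * G.edgeFinset.card + Fintype.card V ≤ Fintype.card V * a := by
  have hnbhd : ∀ x y z, (y = x ∨ G.Adj y x) → (z = x ∨ G.Adj z x) →
      ∃ w : G.Walk y z, w.length ≤ 2 := by
    rintro x y z (rfl | hy) (rfl | hz)
    · exact ⟨.nil, by simp⟩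
    · exact ⟨.cons hz.symm .nil, by simp⟩
    · exact ⟨.cons hy .nil, by simp⟩
    · exact ⟨.cons hy (.cons hz.symm .nil), by simp⟩
  have hcard : ∀ v, G.degree v + 1 = (Finset.univ.filter fun x => v = x ∨ G.Adj v x).card := by
    intro v
    have : (Finset.univ.filter fun x => v = x ∨ G.Adj v x) = insert v (G.neighborFinset v) := by
      ext x
      simp [eq_comm]
    rw [this, Finset.card_insert_of_notMem (by simp), G.card_neighborFinset_eq_degree]
  have hbound : ∀ S b, IsMaxCliqueCard (fun x y => ∃ w : G.Walk x y, w.length ≤ 2) S b →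
      ∑ v ∈ S, (G.degree v + 1) ≤ Fintype.card V * b := by
    intro S b hb
    simp only [hcard]
    have := Finset.sum_card_bipartiteAbove_eq_sum_card_bipartiteBelow (s := S)
      (t := Finset.univ) (fun v x => v = x ∨ G.Adj v x)
    simp only [Finset.bipartiteAbove, Finset.bipartiteBelow] at this
    rw [this]
    refine (Finset.sum_le_card_nsmul _ _ b fun x _ => hb.2 _ (Finset.filter_subset _ _) ?_).trans
      (by simp)
    intro y hy z hz
    exact hnbhd x y z (Finset.mem_filter.1 hy).2 (Finset.mem_filter.1 hz).2
  have htotal : ∑ v, (G.degree v + 1) = 2 * G.edgeFinset.card + Fintype.card V := by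
    rw [Finset.sum_add_distrib, G.sum_degrees_eq_twice_card_edges]
    simp
  refine ⟨?_, htotal ▸ hbound _ _ h⟩
  obtain ⟨S, -, b, hb, hSb, hle⟩ := h.exists_subset_two_mul_le
  have hcompl : ∑ v ∈ Sᶜ, (G.degree v + 1) ≤ Sᶜ.card * a := by
    refine (Finset.sum_le_card_nsmul _ _ a fun v _ => ?_).trans (by simp)
    rw [hcard]
    refine h.2 _ (Finset.subset_univ _) fun y hy z hz => hnbhd v y z ?_ ?_
    · simpa [eq_comm, G.adj_comm] using hy
    · simpa [eq_comm, G.adj_comm] using hz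
  have hsplit := Finset.sum_add_sum_compl S fun v => G.degree v + 1
  have hScompl := Finset.card_add_card_compl S
  have hS := hbound S b hb
  have han : a ≤ Fintype.card V := by
    obtain ⟨I, -, -, rfl⟩ := h.1
    exact Finset.card_le_univ I
  rw [Finset.card_univ] at hSb
  have hD : 2 * G.edgeFinset.card + Fintype.card V ≤ Fintype.card V * b + Sᶜ.card * a := by
    omega
  zify at hD hScompl hSb hle han
  have hb' : (b : ℤ) = S.card + a - Fintype.card V := by linarith
  have hc' : (Sᶜ.card : ℤ) = Fintype.card V - S.card := by linarith
  rw [hb', hc'] at hD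
  rw [hb'] at hle
  nlinarith [mul_nonneg (sub_nonneg.2 han)
    (by linarith : (0 : ℤ) ≤ 2 * (Fintype.card V - a) - S.card)]

/-- Let `G` be a simple graph with `n` vertices and `e ≥ n²/4 - n/2` edges. Then `G` contains a
vertex set `A` in which any two vertices are at distance at most `3` in `G` (i.e. are joined by
a walk of length at most `3`), with `|A| ≥ n/2 + √(e - n²/4 + n/2)`. -/
theorem statement5 {V : Type} [Fintype V] (G : SimpleGraph V) (n e : ℕ)
    (hn : Fintype.card V = n) (he : G.edgeSet.ncard = e)
    (he' : (n : ℝ) ^ 2 / 4 - (n : ℝ) / 2 ≤ (e : ℝ)) :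
    ∃ A : Set V,
      (∀ x ∈ A, ∀ y ∈ A, ∃ w : G.Walk x y, w.length ≤ 3) ∧
      (n : ℝ) / 2 + Real.sqrt ((e : ℝ) - (n : ℝ) ^ 2 / 4 + (n : ℝ) / 2) ≤ (A.ncard : ℝ) := by
  classical
  obtain ⟨a, ha⟩ := exists_isMaxCliqueCard
    (fun x y => ∃ w : G.Walk x y, w.length ≤ 2) (Finset.univ : Finset V)
  obtain ⟨h1, h2⟩ := G.two_mul_card_edgeFinset_add_card_le ha
  obtain ⟨I, -, hI, hIa⟩ := ha.1
  refine ⟨I, fun x hx y hy => ?_, ?_⟩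
  · obtain ⟨w, hw⟩ := hI x hx y hy
    exact ⟨w, hw.trans (by norm_num)⟩
  · have hE : G.edgeFinset.card = e := by
      rw [← he, ← G.coe_edgeFinset, Set.ncard_coe_finset]
    rw [Set.ncard_coe_finset, hIa]
    rw [hE, hn] at h1 h2
    have h1' : (2 * e + n : ℝ) ≤ a ^ 2 + (n - a) ^ 2 := by exact_mod_cast h1
    have h2' : (2 * e + n : ℝ) ≤ n * a := by exact_mod_cast h2
    have hhalf : (n : ℝ) / 2 ≤ a := by
      rcases Nat.eq_zero_or_pos n with rfl | hpos
      · simp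
      · have hpos' : (0 : ℝ) < n := by exact_mod_cast hpos
        refine le_of_mul_le_mul_left ?_ hpos'
        nlinarith
    have := Real.sqrt_le_sqrt (show (e : ℝ) - (n : ℝ) ^ 2 / 4 + (n : ℝ) / 2 ≤ (a - n / 2) ^ 2 by
      nlinarith)
    rw [Real.sqrt_sq (by linarith)] at this
    linarith
end
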